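/- arXiv:0902.1026 — 2 statements merged into one kernel-verified Lean document; each statement's English description precedes it below -/
import Mathlib

section
/- Let p ∈ (1/2, 3/4) and let X be a random walk in the homogeneous 'have your cookie and eat it' environment ω ≡ p with X_0 = 0 almost surely. Then the process is non-ballistic: lim_{n→∞} X_n/n = 0 almost surely. -/
open MeasureTheory Filter

noncomputable section

/-- The hitting time of site `x` by the process `X`, with value `⊤` if `x` is never hit. -/
def hitTime {Ω : Type*} (X : ℕ → Ω → ℤ) (x : ℤ) (ω : Ω) : ℕ∞ :=
  ⨅ (n : ℕ) (_ : X n ω = x), (n : ℕ∞)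

/-- The natural filtration of the process `X` at time `n`. -/
def natSA {Ω : Type*} (X : ℕ → Ω → ℤ) (n : ℕ) : MeasurableSpace Ω :=
  ⨆ m ∈ Finset.range (n + 1), MeasurableSpace.comap (X m) ⊤

/-- The event `A_n` that before time `n` the walk has never jumped leftward from its
current site `X_n`. -/
def freshEvent {Ω : Type*} (X : ℕ → Ω → ℤ) (n : ℕ) : Set Ω :=
  {ω | ∀ m < n, ¬(X m ω = X n ω ∧ X (m + 1) ω = X m ω - 1)}

/-- A random walk in the "have your cookie and eat it" environment `env`. -/
structure IsCookieRW {Ω : Type*} [MeasurableSpace Ω] (P : Measure Ω)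
    (env : ℤ → ℝ) (X : ℕ → Ω → ℤ) : Prop where
  envRange : ∀ x : ℤ, env x ∈ Set.Ico (1 / 2 : ℝ) 1
  meas : ∀ n, Measurable (X n)
  steps : ∀ n : ℕ, ∀ᵐ ω ∂P, |X (n + 1) ω - X n ω| = 1
  cond : ∀ n : ℕ,
    (P[Set.indicator {ω | X (n + 1) ω = X n ω + 1} (fun _ => (1 : ℝ)) | natSA X n])
      =ᵐ[P]
    fun ω => env (X n ω) * Set.indicator (freshEvent X n) (fun _ => (1 : ℝ)) ω
      + (1 / 2) * Set.indicator (freshEvent X n)ᶜ (fun _ => (1 : ℝ)) ω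

/-- The probability of exactly `l` left jumps before the `r`-th right jump from a site whose
cookie has been eaten. -/
def eatenProb : ℕ → ℕ → ℝ
  | 0, 0 => 1
  | 0, _ + 1 => 0
  | r + 1, 0 => 1 / 2 * eatenProb r 0
  | r + 1, l + 1 => 1 / 2 * eatenProb r (l + 1) + 1 / 2 * eatenProb (r + 1) l

/-- The probability of exactly `l` left jumps before the `r`-th right jump from a site whose
cookie, of strength `p`, has not been eaten. -/
def freshProb (p : ℝ) : ℕ → ℕ → ℝ
  | 0, 0 => 1
  | 0, _ + 1 => 0
  | r + 1, 0 => p * freshProb p r 0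
  | r + 1, l + 1 => p * freshProb p r (l + 1) + (1 - p) * eatenProb (r + 1) l

lemma eatenProb_nonneg (r l : ℕ) : 0 ≤ eatenProb r l := by
  fun_induction eatenProb r l <;> positivity

lemma freshProb_nonneg {p : ℝ} (hp0 : 0 ≤ p) (hp1 : p ≤ 1) (r l : ℕ) : 0 ≤ freshProb p r l := by
  have h1 : 0 ≤ 1 - p := by linarith
  fun_induction freshProb p r l with
  | case1 => norm_num
  | case2 => norm_num
  | case3 r ih => exact mul_nonneg hp0 ih
  | case4 r l ih => exact add_nonneg (mul_nonneg hp0 ih) (mul_nonneg h1 (eatenProb_nonneg _ _))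

lemma hasSum_eatenProb {s : ℝ} (hs0 : 0 ≤ s) (hs1 : s ≤ 1) (r : ℕ) :
    HasSum (fun l => eatenProb r l * s ^ l) ((1 / (2 - s)) ^ r) := by
  induction r with
  | zero =>
    have := hasSum_single (f := fun l => eatenProb 0 l * s ^ l) 0 (by
      intro l hl
      obtain ⟨l, rfl⟩ := Nat.exists_eq_succ_of_ne_zero hl
      simp [eatenProb])
    simpa [eatenProb] using this
  | succ r ih =>
    have hnn : ∀ r l, 0 ≤ eatenProb r l * s ^ l := fun r l =>
      mul_nonneg (eatenProb_nonneg r l) (pow_nonneg hs0 l)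
    have hsucc : ∀ l, eatenProb (r + 1) (l + 1) * s ^ (l + 1) =
        1 / 2 * (eatenProb r (l + 1) * s ^ (l + 1)) +
          s / 2 * (eatenProb (r + 1) l * s ^ l) := by
      intro l
      rw [eatenProb]
      ring
    have hpartial : ∀ n, ∑ l ∈ Finset.range (n + 1), eatenProb (r + 1) l * s ^ l =
        1 / 2 * ∑ l ∈ Finset.range (n + 1), eatenProb r l * s ^ l +
          s / 2 * ∑ l ∈ Finset.range n, eatenProb (r + 1) l * s ^ l := by
      intro n
      rw [Finset.sum_range_succ', Finset.sum_congr rfl fun l _ => hsucc l,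
        Finset.sum_add_distrib, ← Finset.mul_sum, ← Finset.mul_sum,
        Finset.sum_range_succ' (fun l => eatenProb r l * s ^ l)]
      simp only [eatenProb, pow_zero, mul_one]
      ring
    have hsum : Summable fun l => eatenProb (r + 1) l * s ^ l := by
      refine summable_of_sum_range_le (c := (1 / (2 - s)) ^ r) (hnn _) fun n => ?_
      have h1 := hpartial n
      have h2 := ih.summable.sum_le_tsum (Finset.range (n + 1)) fun l _ => hnn r l
      rw [ih.tsum_eq] at h2
      have h3 : ∑ l ∈ Finset.range n, eatenProb (r + 1) l * s ^ l ≤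
          ∑ l ∈ Finset.range (n + 1), eatenProb (r + 1) l * s ^ l :=
        Finset.sum_le_sum_of_subset_of_nonneg (Finset.range_mono (Nat.le_succ n))
          fun l _ _ => hnn _ l
      have h4 : 0 ≤ ∑ l ∈ Finset.range n, eatenProb (r + 1) l * s ^ l :=
        Finset.sum_nonneg fun l _ => hnn _ l
      nlinarith
    have hlim := hsum.hasSum.tendsto_sum_nat
    have hlim' := ((ih.tendsto_sum_nat.comp (tendsto_add_atTop_nat 1)).const_mul (1 / 2)).add
      (hlim.const_mul (s / 2))
    have heq := tendsto_nhds_unique (hlim.comp (tendsto_add_atTop_nat 1))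
      (hlim'.congr fun n => (hpartial n).symm)
    have hval : ∑' l, eatenProb (r + 1) l * s ^ l = (1 / (2 - s)) ^ (r + 1) := by
      have h2 : 2 - s ≠ 0 := by linarith
      rw [pow_succ]
      field_simp
      field_simp at heq
      linarith
    rw [← hval]
    exact hsum.hasSum

lemma hasSum_freshProb_zero (p s : ℝ) : HasSum (fun l => freshProb p 0 l * s ^ l) 1 := by
  have := hasSum_single (f := fun l => freshProb p 0 l * s ^ l) 0 (by
    intro l hl
    obtain ⟨l, rfl⟩ := Nat.exists_eq_succ_of_ne_zero hl
    simp [freshProb])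
  simpa [freshProb] using this

lemma hasSum_freshProb_succ {p s a : ℝ} (hs0 : 0 ≤ s) (hs1 : s ≤ 1) {r : ℕ}
    (h : HasSum (fun l => freshProb p r l * s ^ l) a) :
    HasSum (fun l => freshProb p (r + 1) l * s ^ l)
      (p * a + (1 - p) * s * (1 / (2 - s)) ^ (r + 1)) := by
  rw [← hasSum_nat_add_iff' 1] at h ⊢
  have hf : (fun l => freshProb p (r + 1) (l + 1) * s ^ (l + 1)) = fun l =>
      p * (freshProb p r (l + 1) * s ^ (l + 1)) +
        (1 - p) * s * (eatenProb (r + 1) l * s ^ l) := by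
    funext l
    rw [freshProb]
    ring
  have hv : p * a + (1 - p) * s * (1 / (2 - s)) ^ (r + 1) -
      ∑ i ∈ Finset.range 1, freshProb p (r + 1) i * s ^ i =
        p * (a - ∑ i ∈ Finset.range 1, freshProb p r i * s ^ i) +
          (1 - p) * s * (1 / (2 - s)) ^ (r + 1) := by
    simp only [Finset.range_one, Finset.sum_singleton, freshProb]
    ring
  rw [hf, hv]
  exact (h.mul_left p).add ((hasSum_eatenProb hs0 hs1 (r + 1)).mul_left ((1 - p) * s))

lemma hasSum_freshProb_one (p : ℝ) (r : ℕ) : HasSum (fun l => freshProb p r l) 1 := by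
  suffices HasSum (fun l => freshProb p r l * 1 ^ l) 1 by simpa using this
  induction r with
  | zero => exact hasSum_freshProb_zero p 1
  | succ r ih =>
    convert hasSum_freshProb_succ zero_le_one le_rfl ih using 1
    norm_num

/-- The image of `z ↦ (1 - 1 / y) ^ z` under the transition operator of the backward branching
process, where `δ` is the total drift `(2 * p - 1) / (1 - p)` of a site. -/
def genFun (p δ y : ℝ) (j : ℕ) : ℝ :=
  (y - 1) / (y - 1 - δ) * (y / (y + 1)) ^ (j + 1) - δ / (y - 1 - δ) * p ^ (j + 1)

lemma hasSum_freshProb_geom {p δ y : ℝ} (hp : p * (δ + 2) = δ + 1) (hδ0 : 0 < δ)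
    (hy : 1 + δ < y) (j : ℕ) :
    HasSum (fun l => freshProb p (j + 1) l * (1 - 1 / y) ^ l) (genFun p δ y j) := by
  suffices ∀ r, HasSum (fun l => freshProb p r l * (1 - 1 / y) ^ l)
      ((y - 1) / (y - 1 - δ) * (y / (y + 1)) ^ r - δ / (y - 1 - δ) * p ^ r) from this (j + 1)
  have hy0 : 0 < y := by linarith
  have hy1 : 0 < y - 1 - δ := by linarith
  have hs0 : 0 ≤ 1 - 1 / y := by
    rw [sub_nonneg, div_le_one hy0]
    linarith
  have hs1 : 1 - 1 / y ≤ 1 := by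
    have : 0 < 1 / y := by positivity
    linarith
  have ht : 1 / (2 - (1 - 1 / y)) = y / (y + 1) := by
    have : 2 - (1 - 1 / y) = (y + 1) / y := by
      field_simp
      ring
    rw [this, one_div_div]
  have hpe : p = (δ + 1) / (δ + 2) := by
    rw [eq_div_iff (by linarith)]
    exact hp
  intro r
  induction r with
  | zero =>
    convert hasSum_freshProb_zero p (1 - 1 / y) using 1
    field_simp
  | succ r ih =>
    convert hasSum_freshProb_succ hs0 hs1 ih using 1
    rw [ht, pow_succ, pow_succ]
    generalize (y / (y + 1)) ^ r = a
    generalize p ^ r = b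
    rw [hpe]
    field_simp
    ring

/-- The factor `κ` in the expansion `genFun p δ y j = κ * (y / (y + 1)) ^ j - …`. -/
def genCoeff (δ y : ℝ) : ℝ := (y - 1) / (y - 1 - δ) * (y / (y + 1))

lemma genFun_eq (p δ y : ℝ) (j : ℕ) :
    genFun p δ y j = genCoeff δ y * (y / (y + 1)) ^ j - δ / (y - 1 - δ) * p ^ (j + 1) := by
  rw [genFun, genCoeff, pow_succ (y / (y + 1))]
  ring

lemma genCoeff_sub_one {δ y : ℝ} (hδ0 : 0 < δ) (hy : 1 + δ < y) :
    genCoeff δ y - 1 = ((δ - 1) * y + 1 + δ) / ((y + 1) * (y - 1 - δ)) := by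
  have h1 : 0 < y - 1 - δ := by linarith
  have h2 : 0 < y + 1 := by linarith
  rw [genCoeff]
  field_simp
  ring

lemma one_sub_two_div_le_genCoeff {δ y : ℝ} (hδ0 : 0 < δ) (hδ2 : δ < 2) (hy : 10 ≤ y) :
    1 - 2 / y ≤ genCoeff δ y := by
  have h1 : 0 < y - 1 - δ := by linarith
  have h2 : 0 < y + 1 := by linarith
  have h := genCoeff_sub_one hδ0 (by linarith : 1 + δ < y)
  have : -(2 / y) ≤ ((δ - 1) * y + 1 + δ) / ((y + 1) * (y - 1 - δ)) := by
    rw [← neg_div, div_le_div_iff₀ (by linarith) (by positivity)]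
    nlinarith [mul_pos hδ0 (by linarith : 0 < y)]
  linarith

lemma genCoeff_sub_one_le {δ y : ℝ} (hδ0 : 0 < δ) (hδ2 : δ < 2) (hy : 10 ≤ y)
    (hyδ : 20 ≤ (2 - δ) * y) : genCoeff δ y - 1 ≤ δ / 2 / y := by
  have h1 : 0 < y - 1 - δ := by linarith
  have h2 : 0 < y + 1 := by linarith
  rw [genCoeff_sub_one hδ0 (by linarith), div_le_div_iff₀ (by positivity) (by linarith)]
  nlinarith [mul_le_mul_of_nonneg_right hyδ (by linarith : 0 ≤ y),
    mul_nonneg (sub_nonneg.2 hδ2.le) (by linarith : 0 ≤ y)]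

lemma genCoeff_sub_one_le_of_large {δ y : ℝ} (hδ0 : 0 < δ) (hδ2 : δ < 2) (hy : 10 ≤ y) :
    genCoeff δ y - 1 ≤ (δ - 1) / y + 10 / y ^ 2 := by
  have h1 : 0 < y - 1 - δ := by linarith
  have h2 : 0 < y + 1 := by linarith
  have h3 : 0 < y := by linarith
  have : (δ - 1) / y + 10 / y ^ 2 = ((δ - 1) * y + 10) / y ^ 2 := by
    field_simp
  rw [genCoeff_sub_one hδ0 (by linarith), this, div_le_div_iff₀ (by positivity) (by positivity)]
  have h4 : (δ ^ 2 + 1) * y ^ 2 ≤ 5 * y ^ 2 := by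
    gcongr
    nlinarith
  nlinarith [mul_nonneg h3.le hδ0.le, mul_nonneg h3.le (sub_nonneg.2 hδ2.le)]

lemma one_sub_div_le_pow {y : ℝ} (hy : 1 ≤ y) (j : ℕ) : 1 - j / y ≤ (1 - 1 / y) ^ j := by
  have h : 1 / y ≤ 1 := by
    rw [div_le_one (by linarith)]
    exact hy
  have := one_add_mul_le_pow (a := -(1 / y)) (by linarith) j
  calc 1 - j / y = 1 + j * -(1 / y) := by ring
    _ ≤ _ := this
    _ = _ := by ring

/-- The expected increment of `z ↦ (1 - 1 / y) ^ z - 1 + z / y`, a rescaled and linearly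
truncated parabola, in one step of the backward branching process. -/
def excess (p δ y : ℝ) (j : ℕ) : ℝ :=
  genFun p δ y j - (1 - 1 / y) ^ j + (1 - δ + δ * p ^ (j + 1)) / y

lemma excess_ge_of_le {p δ y ε : ℝ} (hp : p * (δ + 2) = δ + 1) (hp0 : 0 < p) (hp1 : p < 1)
    (hδ0 : 0 < δ) (hδ2 : δ < 2) (hε : 4 * ε = 2 - δ) (hy : 10 ≤ y) (hyε : 5 ≤ ε * y)
    {j : ℕ} (hj : (j : ℝ) ≤ ε * y) : 1 / 4 ≤ y ^ 2 * excess p δ y j := by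
  have hy0 : 0 < y := by linarith
  have h1 : 0 < y - 1 - δ := by linarith
  have hS1 := one_sub_div_le_pow (by linarith : 1 ≤ y) j
  have hs0 : 0 ≤ 1 - 1 / y := by
    rw [sub_nonneg, div_le_one hy0]
    linarith
  have hS2 : (1 - 1 / y) ^ j ≤ 1 := by
    refine pow_le_one₀ hs0 ?_
    have : 0 < 1 / y := by positivity
    linarith
  have hT : (1 - 1 / y) ^ j * (1 + j / y ^ 2) ≤ (y / (y + 1)) ^ j := by
    have h : (1 - 1 / y) * (1 + 1 / y ^ 2) ≤ y / (y + 1) := by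
      rw [le_div_iff₀ (by linarith)]
      have : (1 - 1 / y) * (1 + 1 / y ^ 2) * (y + 1) = y - 1 / y ^ 3 := by
        field_simp
        ring
      rw [this]
      have : 0 < 1 / y ^ 3 := by positivity
      linarith
    calc (1 - 1 / y) ^ j * (1 + j / y ^ 2) ≤ (1 - 1 / y) ^ j * (1 + 1 / y ^ 2) ^ j := by
          gcongr
          have := one_add_mul_le_pow (a := 1 / y ^ 2) (by
            have : 0 < 1 / y ^ 2 := by positivity
            linarith) j
          calc 1 + (j : ℝ) / y ^ 2 = 1 + j * (1 / y ^ 2) := by ring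
            _ ≤ _ := this
      _ = ((1 - 1 / y) * (1 + 1 / y ^ 2)) ^ j := (mul_pow _ _ _).symm
      _ ≤ _ := by
          apply pow_le_pow_left₀ _ h
          positivity
  have hκ1 := one_sub_two_div_le_genCoeff hδ0 hδ2 hy
  have hκ2 := genCoeff_sub_one_le hδ0 hδ2 hy (by nlinarith)
  have hκ3 := genCoeff_sub_one hδ0 (by linarith : 1 + δ < y)
  have hjy : (j : ℝ) / y ≤ ε := by
    rw [div_le_iff₀ hy0]
    exact hj
  have hyε' : 2 / y ≤ ε := by
    rw [div_le_iff₀ hy0]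
    linarith
  have hj0 : 0 ≤ (j : ℝ) / y ^ 2 := by positivity
  have hε0 : 0 < ε := by linarith
  have hε1 : ε < 1 / 2 := by linarith
  set κ := genCoeff δ y
  set S := (1 - 1 / y) ^ j
  set T := (y / (y + 1)) ^ j
  have hκS : δ / 2 ≤ κ * S := by
    have h2 : (1 - ε) * (1 - ε) ≤ κ * S := by
      apply mul_le_mul <;> linarith
    nlinarith
  have hκT : κ * S + δ / 2 * (j / y ^ 2) ≤ κ * T := by
    have : κ * (S * (1 + j / y ^ 2)) ≤ κ * T := by
      apply mul_le_mul_of_nonneg_left hT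
      linarith
    nlinarith
  have hcorr : (κ - 1) * (1 - S) ≤ δ / 2 * (j / y ^ 2) := by
    have h2 : (κ - 1) * (1 - S) ≤ δ / 2 / y * (1 - S) := by
      apply mul_le_mul_of_nonneg_right hκ2
      linarith
    have h3 : δ / 2 / y * (1 - S) ≤ δ / 2 / y * (j / y) := by
      gcongr
      linarith
    have h4 : δ / 2 / y * (j / y) = δ / 2 * (j / y ^ 2) := by
      field_simp
    linarith
  have hpj : p ^ (j + 1) ≤ p := by
    rw [pow_succ]
    exact mul_le_of_le_one_left hp0.le (pow_le_one₀ hp0.le hp1.le)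
  have hpcoef : 0 ≤ δ / (y - 1 - δ) - δ / y := by
    rw [sub_nonneg]
    gcongr
    linarith
  have hfinal : 1 / 4 / y ^ 2 ≤ κ - 1 + (1 - δ) / y - (δ / (y - 1 - δ) - δ / y) * p := by
    have hpe : p = (δ + 1) / (δ + 2) := by
      rw [eq_div_iff (by linarith)]
      exact hp
    have : κ - 1 + (1 - δ) / y - (δ / (y - 1 - δ) - δ / y) * p =
        (2 * (y + 1) - 2 * (δ + 2)) / ((δ + 2) * (y * (y + 1) * (y - 1 - δ))) := by
      rw [hκ3, hpe]
      field_simp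
      ring
    rw [this, div_le_div_iff₀ (by positivity) (by positivity)]
    have h5 : (δ + 2) * (y * (y + 1) * (y - 1 - δ)) ≤ 4 * (y * (y + 1) * (y - 1 - δ)) := by
      gcongr
      linarith
    have h6 : y * ((y + 1) * (y - 1 - δ)) ≤ y * (2 * (y - 1 - δ) * y * 1) := by
      have : 0 ≤ (y - 1 - δ) * y * (y - 1) := by
        apply mul_nonneg (by positivity)
        linarith
      nlinarith
    nlinarith
  have hmain : 1 / 4 / y ^ 2 ≤ excess p δ y j := by
    rw [excess, genFun_eq]
    have h5 := mul_le_mul_of_nonneg_left hpj hpcoef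
    have h6 : (1 - δ + δ * p ^ (j + 1)) / y = (1 - δ) / y + δ / y * p ^ (j + 1) := by ring
    rw [h6]
    linarith
  rw [div_le_iff₀ (by positivity)] at hmain
  linarith

lemma excess_ge {p δ y : ℝ} (hp0 : 0 < p) (hp1 : p < 1)
    (hδ0 : 0 < δ) (hδ2 : δ < 2) (hy : 10 ≤ y) (j : ℕ) : -(6 * y) ≤ y ^ 2 * excess p δ y j := by
  have hy0 : 0 < y := by linarith
  have h1 : 0 < y - 1 - δ := by linarith
  have hst : 1 - 1 / y ≤ y / (y + 1) := by
    rw [le_div_iff₀ (by linarith)]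
    have : (1 - 1 / y) * (y + 1) = y - 1 / y := by
      field_simp
      ring
    rw [this]
    have : 0 < 1 / y := by positivity
    linarith
  have hs0 : 0 ≤ 1 - 1 / y := by
    rw [sub_nonneg, div_le_one hy0]
    linarith
  have hTS : (1 - 1 / y) ^ j ≤ (y / (y + 1)) ^ j := pow_le_pow_left₀ hs0 hst j
  have hT1 : (y / (y + 1)) ^ j ≤ 1 := by
    apply pow_le_one₀ (by positivity)
    rw [div_le_one (by linarith)]
    linarith
  have hT0 : 0 ≤ (y / (y + 1)) ^ j := by positivity
  have hκ1 := one_sub_two_div_le_genCoeff hδ0 hδ2 hy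
  have hpj : p ^ (j + 1) ≤ 1 := pow_le_one₀ hp0.le hp1.le
  have hpj0 : 0 ≤ p ^ (j + 1) := by positivity
  have hd : δ / (y - 1 - δ) * p ^ (j + 1) ≤ 3 / y := by
    have h2 : δ / (y - 1 - δ) ≤ 3 / y := by
      rw [div_le_div_iff₀ h1 hy0]
      nlinarith
    have h3 : 0 ≤ δ / (y - 1 - δ) := by positivity
    nlinarith
  have hlast : -(1 / y) ≤ (1 - δ + δ * p ^ (j + 1)) / y := by
    rw [← neg_div]
    gcongr
    nlinarith
  have hmain : -(6 / y) ≤ excess p δ y j := by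
    rw [excess, genFun_eq]
    have h2 : -(2 / y) * (y / (y + 1)) ^ j ≤ (genCoeff δ y - 1) * (y / (y + 1)) ^ j := by
      gcongr
      linarith
    have h3 : 2 / y * (y / (y + 1)) ^ j ≤ 2 / y := by
      apply mul_le_of_le_one_right (by positivity) hT1
    have h4 : 6 / y = 2 / y + 3 / y + 1 / y := by ring
    linarith
  calc -(6 * y) = y ^ 2 * -(6 / y) := by field_simp
    _ ≤ _ := by gcongr

lemma mul_genFun_sub_pow_le {p δ y : ℝ} (hp0 : 0 < p)
    (hδ0 : 0 < δ) (hδ2 : δ < 2) (hy : 10 ≤ y) (j : ℕ) :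
    y * (genFun p δ y j - (1 - 1 / y) ^ j) ≤
      δ - 1 - δ * p ^ (j + 1) + 10 / y + 3 * (1 - (1 - 1 / y) ^ j) := by
  have hy0 : 0 < y := by linarith
  have h1 : 0 < y - 1 - δ := by linarith
  have hst : y / (y + 1) - (1 - 1 / y) = 1 / (y * (y + 1)) := by
    field_simp
    ring
  have hst' : 1 - 1 / y ≤ y / (y + 1) := by
    have : 0 < 1 / (y * (y + 1)) := by positivity
    linarith
  have hs0 : 0 ≤ 1 - 1 / y := by
    rw [sub_nonneg, div_le_one hy0]
    linarith
  have hTS : (1 - 1 / y) ^ j ≤ (y / (y + 1)) ^ j := pow_le_pow_left₀ hs0 hst' j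
  have ht1 : 1 - y / (y + 1) = 1 / (y + 1) := by
    field_simp
    ring
  have hT1 : (y / (y + 1)) ^ j ≤ 1 := by
    apply pow_le_one₀ (by positivity)
    have : 0 < 1 / (y + 1) := by positivity
    linarith
  have hdiff : y * ((y / (y + 1)) ^ j - (1 - 1 / y) ^ j) ≤ 1 - (y / (y + 1)) ^ j := by
    induction j with
    | zero => simp
    | succ j ih =>
      have ih := ih (pow_le_pow_left₀ hs0 hst' j) (by
        apply pow_le_one₀ (by positivity)
        have : 0 < 1 / (y + 1) := by positivity
        linarith)
      have hS1 : (1 - 1 / y) ^ j ≤ 1 := by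
        apply pow_le_one₀ hs0
        have : 0 < 1 / y := by positivity
        linarith
      have h2 : y * (y / (y + 1) - (1 - 1 / y)) = 1 / (y + 1) := by
        rw [hst]
        field_simp
      have h3 := mul_le_mul_of_nonneg_left ih (by positivity : 0 ≤ y / (y + 1))
      have h4 : y * (y / (y + 1) - (1 - 1 / y)) * (1 - 1 / y) ^ j ≤ 1 - y / (y + 1) := by
        rw [h2, ht1]
        exact mul_le_of_le_one_right (by positivity) hS1
      rw [pow_succ, pow_succ]
      linarith
  have hκ1 := one_sub_two_div_le_genCoeff hδ0 hδ2 hy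
  have hκ2 := genCoeff_sub_one_le_of_large hδ0 hδ2 hy
  have hκ3 : y * (genCoeff δ y - 1) ≤ δ - 1 + 10 / y := by
    calc y * (genCoeff δ y - 1) ≤ y * ((δ - 1) / y + 10 / y ^ 2) := by gcongr
      _ = _ := by field_simp
  have hκ4 : -2 ≤ y * (genCoeff δ y - 1) := by
    calc -2 = y * (-(2 / y)) := by field_simp
      _ ≤ _ := by
        gcongr
        linarith
  have hd : δ * p ^ (j + 1) ≤ y * (δ / (y - 1 - δ) * p ^ (j + 1)) := by
    have h2 : δ ≤ y * (δ / (y - 1 - δ)) := by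
      rw [← mul_div_assoc, le_div_iff₀ h1]
      nlinarith
    calc _ ≤ y * (δ / (y - 1 - δ)) * p ^ (j + 1) := by gcongr
      _ = _ := by ring
  rw [genFun_eq]
  nlinarith

lemma neg_le_sum_of_dyadic {h : ℕ → ℝ} {y₀ ε x : ℝ} (hy₀ : 0 < y₀) (hε : 0 < ε) (hx : 0 ≤ x)
    (hneg : ∀ i, -(6 * (2 ^ i * y₀)) ≤ h i) (hpos : ∀ i, x ≤ ε * (2 ^ i * y₀) → 0 ≤ h i)
    (R : ℕ) : -(12 * x / ε) ≤ ∑ i ∈ Finset.range R, h i := by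
  induction R with
  | zero =>
    have : 0 ≤ 12 * x / ε := by positivity
    simpa using this
  | succ R ih =>
    rcases le_or_gt x (ε * (2 ^ R * y₀)) with hR | hR
    · rw [Finset.sum_range_succ]
      linarith [hpos R hR]
    · have h1 : ∑ i ∈ Finset.range (R + 1), -(6 * (2 ^ i * y₀)) ≤
          ∑ i ∈ Finset.range (R + 1), h i := Finset.sum_le_sum fun i _ => hneg i
      have h2 : ∑ i ∈ Finset.range (R + 1), -(6 * ((2 : ℝ) ^ i * y₀)) =
          -(6 * (2 ^ (R + 1) - 1) * y₀) := by
        have h3 := geom_sum_eq (by norm_num : (2 : ℝ) ≠ 1) (R + 1)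
        rw [Finset.sum_neg_distrib, ← Finset.mul_sum, ← Finset.sum_mul, h3]
        norm_num
        ring
      have h3 : 2 ^ R * y₀ ≤ x / ε := by
        rw [le_div_iff₀ hε]
        linarith
      have h4 : 12 * x / ε = 12 * (x / ε) := by ring
      rw [pow_succ] at h2
      rw [h4]
      linarith

lemma min_le_mul_one_sub_pow {Y : ℝ} (hY : 1 ≤ Y) (j : ℕ) :
    min (j : ℝ) Y / 2 ≤ Y * (1 - (1 - 1 / Y) ^ j) := by
  have hY0 : 0 < Y := by linarith
  have hs0 : 0 ≤ 1 - 1 / Y := by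
    rw [sub_nonneg, div_le_one hY0]
    exact hY
  have h1 : (1 - 1 / Y) ^ j * (1 + j / Y) ≤ 1 := by
    calc (1 - 1 / Y) ^ j * (1 + j / Y) ≤ (1 - 1 / Y) ^ j * (1 + 1 / Y) ^ j := by
          gcongr
          have h2 : -2 ≤ 1 / Y := by
            have : 0 < 1 / Y := by positivity
            linarith
          calc 1 + (j : ℝ) / Y = 1 + j * (1 / Y) := by ring
            _ ≤ _ := one_add_mul_le_pow h2 j
      _ = (1 - (1 / Y) ^ 2) ^ j := by
          rw [← mul_pow]
          ring
      _ ≤ 1 := by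
          apply pow_le_one₀
          · have h2 : 1 / Y ≤ 1 := by linarith
            have h3 : 0 ≤ 1 / Y := by positivity
            nlinarith
          · have : 0 ≤ (1 / Y) ^ 2 := by positivity
            linarith
  have h2 : (1 - 1 / Y) ^ j * (Y + j) ≤ Y := by
    have : (1 - 1 / Y) ^ j * (Y + j) = Y * ((1 - 1 / Y) ^ j * (1 + j / Y)) := by
      field_simp
    rw [this]
    exact mul_le_of_le_one_right hY0.le h1
  have h3 : 0 ≤ (1 - 1 / Y) ^ j := by positivity
  have hj : (0 : ℝ) ≤ j := Nat.cast_nonneg j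
  rcases le_total (j : ℝ) Y with h | h
  · rw [min_eq_left h]
    have h4 : (1 - 1 / Y) ^ j ≤ Y / (Y + j) := by
      rw [le_div_iff₀ (by linarith)]
      exact h2
    have h5 : Y / (Y + j) ≤ 1 - j / Y / 2 := by
      rw [div_le_iff₀ (by linarith)]
      have h6 : (j : ℝ) / Y ≤ 1 := by
        rw [div_le_one hY0]
        exact h
      have h7 : (1 - (j : ℝ) / Y / 2) * (Y + j) = Y + j / 2 - j / Y * j / 2 := by
        field_simp
        ring
      rw [h7]
      nlinarith
    have h8 : Y * (1 - (1 - j / Y / 2)) = j / 2 := by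
      field_simp
      ring
    rw [← h8]
    gcongr
    linarith
  · rw [min_eq_right h]
    nlinarith

lemma exists_drift_of_pos {p K : ℝ} (hp : p ∈ Set.Ioo (1 / 2 : ℝ) (3 / 4)) (hK : 0 < K) :
    ∃ (f ψ Pf Pψ : ℕ → ℝ) (A : ℝ), (∀ z, |f z| ≤ A) ∧
      (∀ z, 0 ≤ ψ z ∧ ψ z ≤ z ∧ ψ z ≤ A) ∧
      (∀ j, HasSum (fun z => freshProb p (j + 1) z * f z) (Pf j)) ∧
      (∀ j, HasSum (fun z => freshProb p (j + 1) z * ψ z) (Pψ j)) ∧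
      ∀ j, K ≤ Pf j - f j + Pψ j := by
  obtain ⟨hp1, hp2⟩ := hp
  have hp3 : 0 < 1 - p := by linarith
  obtain ⟨δ, hδ⟩ : ∃ δ, δ = (2 * p - 1) / (1 - p) := ⟨_, rfl⟩
  have hδ0 : 0 < δ := by
    rw [hδ]
    exact div_pos (by linarith) hp3
  have hδ2 : δ < 2 := by
    rw [hδ, div_lt_iff₀ hp3]
    linarith
  have hpδ : p * (δ + 2) = δ + 1 := by
    rw [hδ]
    field_simp
    ring
  obtain ⟨ε, hε⟩ : ∃ ε : ℝ, 4 * ε = 2 - δ := ⟨(2 - δ) / 4, by ring⟩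
  have hε0 : 0 < ε := by linarith
  obtain ⟨y₀, hy₀⟩ : ∃ y₀, y₀ = 10 + 5 / ε + 8 * (K + 2) / ε := ⟨_, rfl⟩
  have hy₀1 : 10 ≤ y₀ := by
    have : 0 < 5 / ε := by positivity
    have : 0 < 8 * (K + 2) / ε := by positivity
    linarith
  have hy₀2 : ε * y₀ = 10 * ε + 5 + 8 * (K + 2) := by
    rw [hy₀]
    field_simp
  obtain ⟨a, ha⟩ : ∃ a, a = ε / 96 := ⟨_, rfl⟩
  have ha0 : 0 < a := by
    rw [ha]
    positivity
  obtain ⟨R, hR⟩ := exists_nat_ge (4 * (K + 2) / a)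
  rw [div_le_iff₀ ha0] at hR
  have hypow : ∀ i : ℕ, y₀ ≤ 2 ^ i * y₀ := fun i =>
    le_mul_of_one_le_left (by linarith) (one_le_pow₀ one_le_two)
  obtain ⟨Λ, hΛ⟩ : ∃ Λ, Λ = a * ∑ i ∈ Finset.range R, 2 ^ i * y₀ := ⟨_, rfl⟩
  have hΛ0 : 0 ≤ Λ := by
    rw [hΛ]
    apply mul_nonneg ha0.le
    apply Finset.sum_nonneg
    intro i _
    linarith [hypow i]
  obtain ⟨Y, hY⟩ : ∃ Y, Y = 10 * (Λ + 1) + 4 * (6 * Λ + 2 + K) := ⟨_, rfl⟩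
  have hY10 : 10 ≤ Y := by linarith
  have hpow01 : ∀ {y : ℝ}, 10 ≤ y → ∀ z : ℕ, 0 ≤ (1 - 1 / y) ^ z ∧ (1 - 1 / y) ^ z ≤ 1 := by
    intro y hy z
    have h1 : 0 < 1 / y := by positivity
    have h2 : 1 / y ≤ 1 := by
      rw [div_le_one (by linarith)]
      linarith
    exact ⟨pow_nonneg (by linarith) z, pow_le_one₀ (by linarith) (by linarith)⟩
  set ψ : ℕ → ℝ := fun z => Y * (1 - (1 - 1 / Y) ^ z) with hψ
  set Pψ : ℕ → ℝ := fun j => Y * (1 - genFun p δ Y j) with hPψ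
  have hψ0 : ∀ z, 0 ≤ ψ z := fun z =>
    mul_nonneg (by linarith) (by linarith [(hpow01 hY10 z).2])
  have hψY : ∀ z, ψ z ≤ Y := fun z =>
    mul_le_of_le_one_right (by linarith) (by linarith [(hpow01 hY10 z).1])
  have hψz : ∀ z : ℕ, ψ z ≤ z := by
    intro z
    have h1 := one_sub_div_le_pow (by linarith : 1 ≤ Y) z
    calc ψ z ≤ Y * (z / Y) := by
          apply mul_le_mul_of_nonneg_left _ (by linarith)
          linarith
      _ = z := by field_simp
  have hPψs : ∀ j, HasSum (fun z => freshProb p (j + 1) z * ψ z) (Pψ j) := by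
    intro j
    have := ((hasSum_freshProb_one p (j + 1)).sub
      (hasSum_freshProb_geom hpδ hδ0 (by linarith : 1 + δ < Y) j)).mul_left Y
    have heq : (fun z => freshProb p (j + 1) z * ψ z) = fun z =>
        Y * (freshProb p (j + 1) z - freshProb p (j + 1) z * (1 - 1 / Y) ^ z) := by
      funext z
      simp only [hψ]
      ring
    rw [heq]
    exact this
  set f : ℕ → ℝ := fun z =>
    (∑ i ∈ Finset.range R, a * (2 ^ i * y₀) ^ 2 * (1 - 1 / (2 ^ i * y₀)) ^ z) + Λ * ψ z with hf
  set Pf : ℕ → ℝ := fun j =>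
    (∑ i ∈ Finset.range R, a * (2 ^ i * y₀) ^ 2 * genFun p δ (2 ^ i * y₀) j) + Λ * Pψ j with hPf
  have hPfs : ∀ j, HasSum (fun z => freshProb p (j + 1) z * f z) (Pf j) := by
    intro j
    have h1 := hasSum_sum (s := Finset.range R) fun i _ =>
      (hasSum_freshProb_geom hpδ hδ0 (by linarith [hypow i] : 1 + δ < 2 ^ i * y₀) j).mul_left
        (a * (2 ^ i * y₀) ^ 2)
    have heq : (fun z => freshProb p (j + 1) z * f z) = fun z =>
        (∑ i ∈ Finset.range R, a * (2 ^ i * y₀) ^ 2 *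
          (freshProb p (j + 1) z * (1 - 1 / (2 ^ i * y₀)) ^ z)) +
            Λ * (freshProb p (j + 1) z * ψ z) := by
      funext z
      simp only [hf]
      rw [mul_add, Finset.mul_sum]
      congr 1
      · exact Finset.sum_congr rfl fun i _ => by ring
      · ring
    rw [heq]
    exact h1.add ((hPψs j).mul_left Λ)
  have hfA : ∀ z, |f z| ≤ (∑ i ∈ Finset.range R, a * (2 ^ i * y₀) ^ 2) + Λ * Y := by
    intro z
    rw [abs_of_nonneg]
    · apply add_le_add
      · apply Finset.sum_le_sum
        intro i _
        exact mul_le_of_le_one_right (by positivity) (hpow01 (by linarith [hypow i]) z).2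
      · exact mul_le_mul_of_nonneg_left (hψY z) hΛ0
    · apply add_nonneg
      · apply Finset.sum_nonneg
        intro i _
        exact mul_nonneg (by positivity) (hpow01 (by linarith [hypow i]) z).1
      · exact mul_nonneg hΛ0 (hψ0 z)
  refine ⟨f, ψ, Pf, Pψ, max ((∑ i ∈ Finset.range R, a * (2 ^ i * y₀) ^ 2) + Λ * Y) Y,
    fun z => (hfA z).trans (le_max_left _ _),
    fun z => ⟨hψ0 z, hψz z, (hψY z).trans (le_max_right _ _)⟩, hPfs, hPψs, fun j => ?_⟩
  have hsplit : Pf j - f j + Pψ j =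
      a * (∑ i ∈ Finset.range R, (2 ^ i * y₀) ^ 2 * excess p δ (2 ^ i * y₀) j) -
        Λ * (1 - δ + δ * p ^ (j + 1)) + (Λ + 1) * (Pψ j - ψ j) + ψ j := by
    have h1 : ∑ i ∈ Finset.range R, a * (2 ^ i * y₀) ^ 2 * genFun p δ (2 ^ i * y₀) j -
        ∑ i ∈ Finset.range R, a * (2 ^ i * y₀) ^ 2 * (1 - 1 / (2 ^ i * y₀)) ^ j =
        a * (∑ i ∈ Finset.range R, (2 ^ i * y₀) ^ 2 * excess p δ (2 ^ i * y₀) j) -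
          Λ * (1 - δ + δ * p ^ (j + 1)) := by
      rw [hΛ, ← Finset.sum_sub_distrib, mul_assoc, Finset.sum_mul, ← mul_sub,
        ← Finset.sum_sub_distrib, Finset.mul_sum]
      refine Finset.sum_congr rfl fun i _ => ?_
      have : 2 ^ i * y₀ ≠ 0 := by linarith [hypow i]
      rw [excess]
      field_simp
      ring
    simp only [hPf, hf]
    linarith
  have hpj : 0 < p ^ (j + 1) := by positivity
  have hLψ : Pψ j - ψ j ≥ -(δ - 1 - δ * p ^ (j + 1)) - (10 + 3 * ψ j) / Y := by
    have h1 := mul_genFun_sub_pow_le (by linarith : 0 < p) hδ0 hδ2 hY10 j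
    have h2 : 3 * (1 - (1 - 1 / Y) ^ j) = 3 * ψ j / Y := by
      simp only [hψ]
      field_simp
    rw [h2] at h1
    have h3 : Pψ j - ψ j = -(Y * (genFun p δ Y j - (1 - 1 / Y) ^ j)) := by
      simp only [hψ, hPψ]
      ring
    rw [h3, add_div]
    linarith
  have herr : (Λ + 1) * ((10 + 3 * ψ j) / Y) ≤ 1 + ψ j / 2 := by
    rw [← mul_div_assoc, div_le_iff₀ (by linarith)]
    have h1 : (1 + ψ j / 2) * (10 * (Λ + 1)) ≤ (1 + ψ j / 2) * Y := by
      apply mul_le_mul_of_nonneg_left _ (by linarith [hψ0 j])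
      linarith
    nlinarith [mul_nonneg (hψ0 j) hΛ0, hψ0 j]
  have hbound : a * (∑ i ∈ Finset.range R, (2 ^ i * y₀) ^ 2 * excess p δ (2 ^ i * y₀) j) +
      ψ j / 2 - 2 ≤ Pf j - f j + Pψ j := by
    rw [hsplit]
    have h1 := mul_le_mul_of_nonneg_left hLψ (by linarith : 0 ≤ Λ + 1)
    nlinarith
  refine le_trans ?_ hbound
  have hlow : ∀ i, (j : ℝ) ≤ ε * (2 ^ i * y₀) →
      1 / 4 ≤ (2 ^ i * y₀) ^ 2 * excess p δ (2 ^ i * y₀) j := by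
    intro i hi
    refine excess_ge_of_le hpδ (by linarith) (by linarith) hδ0 hδ2 hε (by linarith [hypow i])
      ?_ hi
    have := mul_le_mul_of_nonneg_left (hypow i) hε0.le
    linarith
  have hhigh : ∀ i, -(6 * (2 ^ i * y₀)) ≤ (2 ^ i * y₀) ^ 2 * excess p δ (2 ^ i * y₀) j :=
    fun i => excess_ge (by linarith) (by linarith) hδ0 hδ2 (by linarith [hypow i]) j
  rcases le_or_gt (j : ℝ) (ε * y₀) with hj | hj
  · have h1 : (R : ℝ) * (1 / 4) ≤
        ∑ i ∈ Finset.range R, (2 ^ i * y₀) ^ 2 * excess p δ (2 ^ i * y₀) j := by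
      have := Finset.card_nsmul_le_sum (Finset.range R)
        (fun i => (2 ^ i * y₀) ^ 2 * excess p δ (2 ^ i * y₀) j) (1 / 4) fun i _ =>
          hlow i (hj.trans (mul_le_mul_of_nonneg_left (hypow i) hε0.le))
      simpa using this
    have h2 := mul_le_mul_of_nonneg_left h1 ha0.le
    linarith [hψ0 j]
  · have hmin := min_le_mul_one_sub_pow (by linarith : 1 ≤ Y) j
    rcases le_total (j : ℝ) Y with hjY | hjY
    · rw [min_eq_left hjY] at hmin
      have h1 := neg_le_sum_of_dyadic (by linarith) hε0 (Nat.cast_nonneg j) hhigh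
        (fun i hi => by linarith [hlow i hi]) R
      have h2 := mul_le_mul_of_nonneg_left h1 ha0.le
      have h3 : a * -(12 * j / ε) = -(j / 8) := by
        rw [ha]
        field_simp
        ring
      rw [h3] at h2
      have h4 : (j : ℝ) / 2 ≤ ψ j := hmin
      linarith
    · rw [min_eq_right hjY] at hmin
      have h1 : -(6 * Λ) ≤
          a * ∑ i ∈ Finset.range R, (2 ^ i * y₀) ^ 2 * excess p δ (2 ^ i * y₀) j := by
        have : -(6 * Λ) = a * ∑ i ∈ Finset.range R, -(6 * (2 ^ i * y₀)) := by
          rw [hΛ, Finset.sum_neg_distrib, ← Finset.mul_sum]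
          ring
        rw [this]
        exact mul_le_mul_of_nonneg_left (Finset.sum_le_sum fun i _ => hhigh i) ha0.le
      have h4 : Y / 2 ≤ ψ j := hmin
      linarith

lemma exists_weight {p : ℝ} (hp : p ∈ Set.Ioo (1 / 2 : ℝ) (3 / 4)) {K : ℝ} (hK : 0 < K) :
    ∃ (θ : ℝ) (V : ℕ → ℝ), 0 < θ ∧ (∀ z, 1 / 2 ≤ V z ∧ V z ≤ 2) ∧
      ∀ j B, ∑ z ∈ Finset.range B, freshProb p (j + 1) z * (Real.exp (-(θ * z)) * V z) ≤
        Real.exp (-(K * θ)) * V j := by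
  obtain ⟨f, ψ, Pf, Pψ, A, hf, hψ, hPf, hPψ, hdrift⟩ :=
    exists_drift_of_pos hp (by linarith : 0 < K + 1)
  have hA : 0 ≤ A := (abs_nonneg _).trans (hf 0)
  obtain ⟨c, hc⟩ : ∃ c, c = A ^ 2 + 2 * A ^ 2 + K * A := ⟨_, rfl⟩
  have hc0 : 0 ≤ c := by
    rw [hc]
    positivity
  obtain ⟨θ, hθ⟩ : ∃ θ, θ = 1 / (c + 2 * A + 1) := ⟨_, rfl⟩
  have hθ0 : 0 < θ := by
    rw [hθ]
    positivity
  have hθc : θ * (c + 2 * A + 1) = 1 := by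
    rw [hθ]
    field_simp
  have hV : ∀ z, 1 / 2 ≤ 1 - θ * f z ∧ 1 - θ * f z ≤ 2 := by
    intro z
    have h1 : |θ * f z| ≤ θ * A := by
      rw [abs_mul, abs_of_pos hθ0]
      exact mul_le_mul_of_nonneg_left (hf z) hθ0.le
    have h2 : θ * A ≤ 1 / 2 := by
      have := mul_nonneg hθ0.le hc0
      linarith
    rw [abs_le] at h1
    constructor <;> linarith
  refine ⟨θ, fun z => 1 - θ * f z, hθ0, hV, fun j B => ?_⟩
  have hq : ∀ z, 0 ≤ freshProb p (j + 1) z := fun z =>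
    freshProb_nonneg (by linarith [hp.1]) (by linarith [hp.2]) _ z
  have hpt : ∀ z : ℕ, Real.exp (-(θ * z)) * (1 - θ * f z) ≤
      1 + θ ^ 2 * (A ^ 2 + 2 * A ^ 2) - θ * ψ z - θ * f z := by
    intro z
    obtain ⟨h1, h2, h3⟩ := hψ z
    have h4 : Real.exp (-(θ * z)) ≤ 1 - θ * ψ z + (θ * ψ z) ^ 2 := by
      have hx : 0 ≤ θ * ψ z := mul_nonneg hθ0.le h1
      calc Real.exp (-(θ * z)) ≤ Real.exp (-(θ * ψ z)) := by
            apply Real.exp_le_exp.2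
            nlinarith
        _ ≤ 1 / (1 + θ * ψ z) := by
            rw [Real.exp_neg, ← one_div]
            apply one_div_le_one_div_of_le (by linarith)
            linarith [Real.add_one_le_exp (θ * ψ z)]
        _ ≤ _ := by
            rw [div_le_iff₀ (by linarith)]
            nlinarith [pow_nonneg hx 3]
    have h5 := mul_le_mul_of_nonneg_right h4 (by linarith [(hV z).1] : 0 ≤ 1 - θ * f z)
    have h6 : (θ * ψ z) ^ 2 * (1 - θ * f z) ≤ θ ^ 2 * A ^ 2 * 2 := by
      rw [mul_pow]
      apply mul_le_mul _ (hV z).2 (by linarith [(hV z).1]) (by positivity)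
      gcongr
    have h7 : ψ z * f z ≤ A * A := by
      calc ψ z * f z ≤ ψ z * A := mul_le_mul_of_nonneg_left (abs_le.1 (hf z)).2 h1
        _ ≤ A * A := mul_le_mul_of_nonneg_right h3 hA
    have h8 := mul_le_mul_of_nonneg_left h7 (by positivity : 0 ≤ θ ^ 2)
    linarith
  have hsum : HasSum (fun z => freshProb p (j + 1) z *
      (1 + θ ^ 2 * (A ^ 2 + 2 * A ^ 2) - θ * ψ z - θ * f z))
      (1 + θ ^ 2 * (A ^ 2 + 2 * A ^ 2) - θ * Pψ j - θ * Pf j) := by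
    have h := (((hasSum_freshProb_one p (j + 1)).mul_left
      (1 + θ ^ 2 * (A ^ 2 + 2 * A ^ 2))).sub ((hPψ j).mul_left θ)).sub ((hPf j).mul_left θ)
    have heq : (fun z => freshProb p (j + 1) z *
        (1 + θ ^ 2 * (A ^ 2 + 2 * A ^ 2) - θ * ψ z - θ * f z)) = fun z =>
        (1 + θ ^ 2 * (A ^ 2 + 2 * A ^ 2)) * freshProb p (j + 1) z -
          θ * (freshProb p (j + 1) z * ψ z) - θ * (freshProb p (j + 1) z * f z) := by
      funext z
      ring
    rw [heq]
    simpa only [mul_one] using h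
  have hnn : ∀ z : ℕ, 0 ≤ Real.exp (-(θ * z)) * (1 - θ * f z) := fun z =>
    mul_nonneg (Real.exp_pos _).le (by linarith [(hV z).1])
  calc ∑ z ∈ Finset.range B, freshProb p (j + 1) z * (Real.exp (-(θ * z)) * (1 - θ * f z))
      ≤ ∑ z ∈ Finset.range B, freshProb p (j + 1) z *
          (1 + θ ^ 2 * (A ^ 2 + 2 * A ^ 2) - θ * ψ z - θ * f z) :=
        Finset.sum_le_sum fun z _ => mul_le_mul_of_nonneg_left (hpt z) (hq z)
    _ ≤ 1 + θ ^ 2 * (A ^ 2 + 2 * A ^ 2) - θ * Pψ j - θ * Pf j :=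
        sum_le_hasSum _ (fun z _ => mul_nonneg (hq z) ((hnn z).trans (hpt z))) hsum
    _ ≤ (1 - K * θ) * (1 - θ * f j) := by
        have h1 := mul_le_mul_of_nonneg_left (hdrift j) hθ0.le
        have h2 : -(K * A) ≤ K * f j := by
          have := mul_le_mul_of_nonneg_left (abs_le.1 (hf j)).1 hK.le
          linarith
        have h3 := mul_le_mul_of_nonneg_left h2 (by positivity : 0 ≤ θ ^ 2)
        have h4 : θ ^ 2 * c ≤ θ := by
          have : θ * c ≤ 1 := by
            have := mul_nonneg hθ0.le hA
            linarith
          calc θ ^ 2 * c = θ * (θ * c) := by ring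
            _ ≤ θ := mul_le_of_le_one_right hθ0.le this
        rw [hc] at h4
        linarith
    _ ≤ Real.exp (-(K * θ)) * (1 - θ * f j) := by
        apply mul_le_mul_of_nonneg_right _ (by linarith [(hV j).1])
        linarith [Real.add_one_le_exp (-(K * θ))]

open Classical in
/-- The profiles `z` with `z 0 = 0`, with `z k < B` for `1 ≤ k ≤ N` and with `z k = 0` for
`k > N`. -/
def profiles (B : ℕ) : ℕ → Finset (ℕ → ℕ)
  | 0 => {fun _ => 0}
  | N + 1 => (profiles B N ×ˢ Finset.range B).image fun x => Function.update x.1 (N + 1) x.2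

open Classical in
lemma mem_profiles {B : ℕ} (N : ℕ) {z : ℕ → ℕ} (h0 : z 0 = 0)
    (hB : ∀ k, 1 ≤ k → k ≤ N → z k < B) (hN : ∀ k, N < k → z k = 0) : z ∈ profiles B N := by
  induction N generalizing z with
  | zero =>
    rw [profiles, Finset.mem_singleton]
    funext k
    rcases Nat.eq_zero_or_pos k with rfl | hk
    · exact h0
    · exact hN k hk
  | succ N ih =>
    rw [profiles, Finset.mem_image]
    refine ⟨(Function.update z (N + 1) 0, z (N + 1)), ?_, by simp⟩
    rw [Finset.mem_product]
    refine ⟨ih (z := Function.update z (N + 1) 0) ?_ ?_ ?_, ?_⟩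
    · rw [Function.update_of_ne (by omega)]
      exact h0
    · intro k hk1 hk2
      rw [Function.update_of_ne (by omega)]
      exact hB k hk1 (by omega)
    · intro k hk
      rcases eq_or_ne k (N + 1) with rfl | hne
      · simp
      · rw [Function.update_of_ne hne]
        exact hN k (by omega)
    · exact Finset.mem_range.2 (hB (N + 1) (by omega) le_rfl)

open Classical in
lemma sum_image_le_sum {ι κ : Type*} (s : Finset ι) (g : ι → κ) {f : κ → ℝ}
    (hf : ∀ k, 0 ≤ f k) : ∑ k ∈ s.image g, f k ≤ ∑ i ∈ s, f (g i) := by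
  induction s using Finset.induction_on with
  | empty => simp
  | insert a s ha ih =>
    rw [Finset.image_insert, Finset.sum_insert ha]
    by_cases h : g a ∈ s.image g
    · rw [Finset.insert_eq_of_mem h]
      linarith [hf (g a)]
    · rw [Finset.sum_insert h]
      linarith

lemma sum_profiles_le {p : ℝ} (hp0 : 0 ≤ p) (hp1 : p ≤ 1) {θ ρ : ℝ} (hρ : 0 ≤ ρ) {V : ℕ → ℝ}
    (hV : ∀ z, 0 ≤ V z)
    (h : ∀ j B, ∑ z ∈ Finset.range B, freshProb p (j + 1) z * (Real.exp (-(θ * z)) * V z) ≤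
      ρ * V j) (B N : ℕ) :
    ∑ z ∈ profiles B N,
      (∏ k ∈ Finset.range N, freshProb p (z k + 1) (z (k + 1)) * Real.exp (-(θ * z (k + 1)))) *
        V (z N) ≤ ρ ^ N * V 0 := by
  have hnn : ∀ (z : ℕ → ℕ) N, 0 ≤ ∏ k ∈ Finset.range N,
      freshProb p (z k + 1) (z (k + 1)) * Real.exp (-(θ * z (k + 1))) := fun z N =>
    Finset.prod_nonneg fun k _ =>
      mul_nonneg (freshProb_nonneg hp0 hp1 _ _) (Real.exp_pos _).le
  induction N with
  | zero => simp [profiles]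
  | succ N ih =>
    rw [profiles]
    refine (sum_image_le_sum _ _ fun z => ?_).trans ?_
    · exact mul_nonneg (hnn z (N + 1)) (hV _)
    · rw [Finset.sum_product]
      calc _ ≤ ∑ z ∈ profiles B N, (∏ k ∈ Finset.range N,
            freshProb p (z k + 1) (z (k + 1)) * Real.exp (-(θ * z (k + 1)))) *
              (ρ * V (z N)) := by
            refine Finset.sum_le_sum fun z _ => ?_
            refine le_trans (le_of_eq ?_)
              (mul_le_mul_of_nonneg_left (h (z N) B) (hnn z N))
            rw [Finset.mul_sum]
            refine Finset.sum_congr rfl fun v _ => ?_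
            rw [Finset.prod_range_succ, Function.update_self,
              Function.update_of_ne (Nat.lt_succ_self N).ne]
            have : ∏ k ∈ Finset.range N,
                freshProb p (Function.update z (N + 1) v k + 1)
                  (Function.update z (N + 1) v (k + 1)) *
                    Real.exp (-(θ * Function.update z (N + 1) v (k + 1))) =
                ∏ k ∈ Finset.range N,
                  freshProb p (z k + 1) (z (k + 1)) * Real.exp (-(θ * z (k + 1))) := by
              refine Finset.prod_congr rfl fun k hk => ?_
              rw [Finset.mem_range] at hk
              rw [Function.update_of_ne (by omega), Function.update_of_ne (by omega)]
            rw [this]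
            ring
        _ = ρ * ∑ z ∈ profiles B N, (∏ k ∈ Finset.range N,
            freshProb p (z k + 1) (z (k + 1)) * Real.exp (-(θ * z (k + 1)))) * V (z N) := by
            rw [Finset.mul_sum]
            exact Finset.sum_congr rfl fun z _ => by ring
        _ ≤ ρ ^ (N + 1) * V 0 := by
            rw [pow_succ']
            linarith [mul_le_mul_of_nonneg_left ih hρ]

open Classical in
/-- The total weight of the profiles of sum at most `c * N` decays exponentially in `N`. -/
lemma exists_sum_profiles_le {p : ℝ} (hp : p ∈ Set.Ioo (1 / 2 : ℝ) (3 / 4)) {c : ℝ}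
    (hc : 0 ≤ c) : ∃ θ : ℝ, 0 < θ ∧ ∀ B N : ℕ,
      ∑ z ∈ profiles B N with (∑ k ∈ Finset.range N, z (k + 1) : ℕ) ≤ c * N,
        ∏ k ∈ Finset.range N, freshProb p (z k + 1) (z (k + 1)) ≤ 4 * Real.exp (-(θ * N)) := by
  obtain ⟨θ, V, hθ, hV, h⟩ := exists_weight hp (by linarith : 0 < c + 1)
  have hp0 : 0 ≤ p := by linarith [hp.1]
  have hp1 : p ≤ 1 := by linarith [hp.2]
  refine ⟨θ, hθ, fun B N => ?_⟩
  have hV0 : ∀ z, 0 ≤ V z := fun z => by linarith [(hV z).1]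
  have hmain := sum_profiles_le hp0 hp1 (Real.exp_pos _).le hV0 h B N
  have hpt : ∀ z : ℕ → ℕ, ((∑ k ∈ Finset.range N, z (k + 1) : ℕ) : ℝ) ≤ c * N →
      ∏ k ∈ Finset.range N, freshProb p (z k + 1) (z (k + 1)) ≤
        2 * Real.exp (θ * (c * N)) * ((∏ k ∈ Finset.range N,
          freshProb p (z k + 1) (z (k + 1)) * Real.exp (-(θ * z (k + 1)))) * V (z N)) := by
    intro z hz
    have hq : 0 ≤ ∏ k ∈ Finset.range N, freshProb p (z k + 1) (z (k + 1)) :=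
      Finset.prod_nonneg fun k _ => freshProb_nonneg hp0 hp1 _ _
    rw [Finset.prod_mul_distrib, ← Real.exp_sum]
    have h1 : ∑ k ∈ Finset.range N, -(θ * (z (k + 1) : ℝ)) =
        -(θ * ((∑ k ∈ Finset.range N, z (k + 1) : ℕ) : ℝ)) := by
      rw [Finset.sum_neg_distrib, ← Finset.mul_sum, Nat.cast_sum]
    have h2 : 1 ≤ Real.exp (θ * (c * N)) * Real.exp (∑ k ∈ Finset.range N,
        -(θ * (z (k + 1) : ℝ))) := by
      rw [← Real.exp_add, h1]
      apply Real.one_le_exp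
      nlinarith
    have h3 : 1 ≤ 2 * V (z N) := by linarith [(hV (z N)).1]
    have h4 := one_le_mul_of_one_le_of_one_le h2 h3
    calc _ ≤ (∏ k ∈ Finset.range N, freshProb p (z k + 1) (z (k + 1))) *
          (Real.exp (θ * (c * N)) * Real.exp (∑ k ∈ Finset.range N,
            -(θ * (z (k + 1) : ℝ))) * (2 * V (z N))) := le_mul_of_one_le_right hq h4
      _ = _ := by ring
  have hnn : ∀ z : ℕ → ℕ, 0 ≤ (∏ k ∈ Finset.range N,
      freshProb p (z k + 1) (z (k + 1)) * Real.exp (-(θ * z (k + 1)))) * V (z N) := fun z =>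
    mul_nonneg (Finset.prod_nonneg fun k _ =>
      mul_nonneg (freshProb_nonneg hp0 hp1 _ _) (Real.exp_pos _).le) (hV0 _)
  calc _ ≤ ∑ z ∈ profiles B N with ((∑ k ∈ Finset.range N, z (k + 1) : ℕ) : ℝ) ≤ c * N,
        2 * Real.exp (θ * (c * N)) * ((∏ k ∈ Finset.range N,
          freshProb p (z k + 1) (z (k + 1)) * Real.exp (-(θ * z (k + 1)))) * V (z N)) :=
        Finset.sum_le_sum fun z hz => hpt z (Finset.mem_filter.1 hz).2
    _ ≤ ∑ z ∈ profiles B N, 2 * Real.exp (θ * (c * N)) * ((∏ k ∈ Finset.range N,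
          freshProb p (z k + 1) (z (k + 1)) * Real.exp (-(θ * z (k + 1)))) * V (z N)) :=
        Finset.sum_le_sum_of_subset_of_nonneg (Finset.filter_subset _ _) fun z _ _ =>
          mul_nonneg (by positivity) (hnn z)
    _ ≤ 2 * Real.exp (θ * (c * N)) * (Real.exp (-((c + 1) * θ)) ^ N * 2) := by
        rw [← Finset.mul_sum]
        apply mul_le_mul_of_nonneg_left _ (by positivity)
        exact hmain.trans (mul_le_mul_of_nonneg_left (hV 0).2 (by positivity))
    _ = 4 * (Real.exp (θ * (c * N)) * Real.exp (-((c + 1) * θ)) ^ N) := by ring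
    _ = 4 * Real.exp (-(θ * N)) := by
        rw [← Real.exp_nat_mul, ← Real.exp_add]
        congr 2
        ring

/-- The number of right jumps of the path `w` from `x` before time `n`. -/
def upCount (w : ℕ → ℤ) (n : ℕ) (x : ℤ) : ℕ :=
  ∑ m ∈ Finset.range n, if w m = x ∧ w (m + 1) = x + 1 then 1 else 0

/-- The number of left jumps of the path `w` from `x` before time `n`. -/
def downCount (w : ℕ → ℤ) (n : ℕ) (x : ℤ) : ℕ :=
  ∑ m ∈ Finset.range n, if w m = x ∧ w (m + 1) = x - 1 then 1 else 0

/-- The number of left jumps of the path `w` from `x` before time `n` and before the `u`-th right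
jump from `x`. -/
def downCountBefore (w : ℕ → ℤ) (u n : ℕ) (x : ℤ) : ℕ :=
  ∑ m ∈ Finset.range n, if w m = x ∧ w (m + 1) = x - 1 ∧ upCount w m x < u then 1 else 0

lemma upCount_succ (w : ℕ → ℤ) (n : ℕ) (x : ℤ) : upCount w (n + 1) x =
    upCount w n x + if w n = x ∧ w (n + 1) = x + 1 then 1 else 0 :=
  Finset.sum_range_succ _ _

lemma downCount_succ (w : ℕ → ℤ) (n : ℕ) (x : ℤ) : downCount w (n + 1) x =
    downCount w n x + if w n = x ∧ w (n + 1) = x - 1 then 1 else 0 :=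
  Finset.sum_range_succ _ _

lemma downCountBefore_succ (w : ℕ → ℤ) (u n : ℕ) (x : ℤ) : downCountBefore w u (n + 1) x =
    downCountBefore w u n x +
      if w n = x ∧ w (n + 1) = x - 1 ∧ upCount w n x < u then 1 else 0 :=
  Finset.sum_range_succ _ _

lemma upCount_congr {w w' : ℕ → ℤ} {n : ℕ} (h : ∀ i ≤ n, w i = w' i) (x : ℤ) :
    upCount w n x = upCount w' n x := by
  refine Finset.sum_congr rfl fun m hm => ?_
  rw [Finset.mem_range] at hm
  rw [h m (by omega), h (m + 1) (by omega)]

lemma downCount_congr {w w' : ℕ → ℤ} {n : ℕ} (h : ∀ i ≤ n, w i = w' i) (x : ℤ) :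
    downCount w n x = downCount w' n x := by
  refine Finset.sum_congr rfl fun m hm => ?_
  rw [Finset.mem_range] at hm
  rw [h m (by omega), h (m + 1) (by omega)]

lemma downCountBefore_congr {w w' : ℕ → ℤ} {n : ℕ} (h : ∀ i ≤ n, w i = w' i) (u : ℕ) (x : ℤ) :
    downCountBefore w u n x = downCountBefore w' u n x := by
  refine Finset.sum_congr rfl fun m hm => ?_
  rw [Finset.mem_range] at hm
  rw [h m (by omega), h (m + 1) (by omega),
    upCount_congr (fun i hi => h i (by omega) : ∀ i ≤ m, w i = w' i)]

lemma downCountBefore_eq_downCount {w : ℕ → ℤ} {u n : ℕ} {x : ℤ} (h : upCount w n x < u) :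
    downCountBefore w u n x = downCount w n x := by
  induction n with
  | zero => rfl
  | succ n ih =>
    rw [upCount_succ] at h
    have hu : upCount w n x < u := by omega
    rw [downCountBefore_succ, downCount_succ, ih hu]
    simp only [hu, and_true]

lemma upCount_eq_downCount_add {w : ℕ → ℤ} (h0 : w 0 = 0)
    (hw : ∀ n, w (n + 1) = w n + 1 ∨ w (n + 1) = w n - 1) (n : ℕ) {x : ℤ} (hx : 0 ≤ x) :
    upCount w n x = downCount w n (x + 1) + if x < w n then 1 else 0 := by
  induction n with
  | zero =>
    rw [h0, if_neg (by omega)]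
    rfl
  | succ n ih =>
    rw [upCount_succ, downCount_succ, ih]
    rcases hw n with h | h <;> rw [h] <;> split_ifs <;> omega

lemma downCountBefore_upCount {w : ℕ → ℤ} (h0 : w 0 = 0)
    (hw : ∀ n, w (n + 1) = w n + 1 ∨ w (n + 1) = w n - 1) (n : ℕ) {x : ℤ} (hx : 0 ≤ x) (hn : x < w n) :
    downCountBefore w (upCount w n x) n x = downCount w n x := by
  induction n with
  | zero => omega
  | succ n ih =>
    rw [downCountBefore_succ, downCount_succ]
    rcases eq_or_ne (w n) x with h | h
    · have hup : w (n + 1) = x + 1 := by rcases hw n with h' | h' <;> omega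
      rw [downCountBefore_eq_downCount (by rw [upCount_succ, if_pos ⟨h, hup⟩]; omega),
        if_neg (by omega), if_neg (by omega)]
    · have hlt : x < w n := by rcases hw n with h' | h' <;> omega
      rw [upCount_succ, if_neg (by tauto), if_neg (by tauto), if_neg (by tauto), add_zero,
        add_zero, add_zero, ih hlt]

lemma downCount_eq_zero {w : ℕ → ℤ} {n : ℕ} {x : ℤ} (h : ∀ m < n, w m ≠ x) :
    downCount w n x = 0 :=
  Finset.sum_eq_zero fun m hm => if_neg fun h' => h m (Finset.mem_range.1 hm) h'.1

lemma sum_downCount_le (w : ℕ → ℤ) (n N : ℕ) (a : ℤ) :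
    ∑ k ∈ Finset.range N, downCount w n (a - k) ≤ n := by
  induction n with
  | zero => simp [downCount]
  | succ n ih =>
    simp only [downCount_succ, Finset.sum_add_distrib]
    have : ∑ k ∈ Finset.range N,
        (if w n = a - k ∧ w (n + 1) = a - k - 1 then 1 else 0) ≤ 1 := by
      rw [← Finset.sum_filter, ← Finset.card_eq_sum_ones, Finset.card_le_one]
      intro i hi j hj
      rw [Finset.mem_filter] at hi hj
      omega
    omega

/-- The probability that `z` left jumps occur before the `u`-th right jump from a site, given that
so far `U` right jumps and `D` left jumps have occurred. -/
def siteProb (p : ℝ) (u z U D : ℕ) : ℝ :=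
  if D = 0 then freshProb p (u - U) z else if D ≤ z then eatenProb (u - U) (z - D) else 0

lemma siteProb_self (p : ℝ) (u z : ℕ) : siteProb p u z u z = 1 := by
  rcases Nat.eq_zero_or_pos z with rfl | hz
  · simp [siteProb, freshProb]
  · simp [siteProb, hz.ne', eatenProb]

lemma siteProb_step (p : ℝ) {u U : ℕ} (h : U < u) (z D : ℕ) :
    siteProb p u z U D = (if D = 0 then p else 1 / 2) * siteProb p u z (U + 1) D +
      (1 - if D = 0 then p else 1 / 2) * siteProb p u z U (D + 1) := by
  obtain ⟨r, rfl⟩ : ∃ r, u = U + (r + 1) := ⟨u - U - 1, by omega⟩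
  have h1 : U + (r + 1) - U = r + 1 := by omega
  have h2 : U + (r + 1) - (U + 1) = r := by omega
  simp only [siteProb, h1, h2]
  rcases Nat.eq_zero_or_pos D with rfl | hD
  · cases z <;> simp [freshProb]
  · simp only [hD.ne', if_false, Nat.add_eq_zero_iff, and_false, one_ne_zero]
    rcases lt_trichotomy D z with hz | rfl | hz
    · obtain ⟨l, rfl⟩ : ∃ l, z = D + (l + 1) := ⟨z - D - 1, by omega⟩
      have h3 : D + (l + 1) - D = l + 1 := by omega
      have h4 : D + (l + 1) - (D + 1) = l := by omega
      rw [if_pos hz.le, if_pos hz.le, if_pos (by omega), h3, h4, eatenProb]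
      norm_num
    · rw [if_pos le_rfl, if_pos le_rfl, if_neg (by omega), Nat.sub_self, eatenProb]
      norm_num
    · rw [if_neg (by omega), if_neg (by omega), if_neg (by omega)]
      norm_num

lemma siteProb_frozen (p : ℝ) {u U : ℕ} (h : u ≤ U) (z D : ℕ) :
    siteProb p u z (U + 1) D = siteProb p u z U D := by
  have h1 : u - (U + 1) = u - U := by omega
  simp only [siteProb, h1]

lemma siteProb_nonneg {p : ℝ} (hp0 : 0 ≤ p) (hp1 : p ≤ 1) (u z U D : ℕ) :
    0 ≤ siteProb p u z U D := by
  rw [siteProb]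
  split_ifs
  exacts [freshProb_nonneg hp0 hp1 _ _, eatenProb_nonneg _ _, le_rfl]

lemma siteProb_le_one {p : ℝ} (hp0 : 0 ≤ p) (hp1 : p ≤ 1) (u z U D : ℕ) :
    siteProb p u z U D ≤ 1 := by
  have h : HasSum (fun l => eatenProb (u - U) l) 1 := by
    have := hasSum_eatenProb zero_le_one le_rfl (u - U)
    norm_num at this
    exact this
  rw [siteProb]
  split_ifs
  · exact le_hasSum (hasSum_freshProb_one p _) z fun l _ => freshProb_nonneg hp0 hp1 _ l
  · exact le_hasSum h (z - D) fun l _ => eatenProb_nonneg _ l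
  · exact zero_le_one

/-- The probability that the path `w`, stopped at time `n`, jumps right next. -/
def rightProb (p : ℝ) (w : ℕ → ℤ) (n : ℕ) : ℝ :=
  if downCount w n (w n) = 0 then p else 1 / 2

/-- The factor of `profileProb` belonging to the site `x`. -/
def siteFactor (p : ℝ) (u z n : ℕ) (x : ℤ) (w : ℕ → ℤ) : ℝ :=
  siteProb p u z (upCount w n x) (downCountBefore w u n x)

/-- The value of `siteFactor` at time `n + 1` in case of a right jump. -/
def siteFactorRight (p : ℝ) (u z n : ℕ) (x : ℤ) (w : ℕ → ℤ) : ℝ :=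
  siteProb p u z (upCount w n x + if w n = x then 1 else 0) (downCountBefore w u n x)

/-- The value of `siteFactor` at time `n + 1` in case of a left jump. -/
def siteFactorLeft (p : ℝ) (u z n : ℕ) (x : ℤ) (w : ℕ → ℤ) : ℝ :=
  siteProb p u z (upCount w n x)
    (downCountBefore w u n x + if w n = x ∧ upCount w n x < u then 1 else 0)

lemma siteFactor_succ_right {w : ℕ → ℤ} {n : ℕ} (h : w (n + 1) = w n + 1) (p : ℝ) (u z : ℕ)
    (x : ℤ) : siteFactor p u z (n + 1) x w = siteFactorRight p u z n x w := by
  rw [siteFactor, siteFactorRight, upCount_succ, downCountBefore_succ, h]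
  have h1 : (w n = x ∧ w n + 1 = x + 1) ↔ w n = x := by omega
  simp only [h1]
  rw [if_neg (by omega : ¬(w n = x ∧ w n + 1 = x - 1 ∧ upCount w n x < u)), add_zero]

lemma siteFactor_succ_left {w : ℕ → ℤ} {n : ℕ} (h : w (n + 1) = w n - 1) (p : ℝ) (u z : ℕ)
    (x : ℤ) : siteFactor p u z (n + 1) x w = siteFactorLeft p u z n x w := by
  rw [siteFactor, siteFactorLeft, upCount_succ, downCountBefore_succ, h]
  have h1 : (w n = x ∧ w n - 1 = x - 1 ∧ upCount w n x < u) ↔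
      (w n = x ∧ upCount w n x < u) := by omega
  simp only [h1]
  rw [if_neg (by omega : ¬(w n = x ∧ w n - 1 = x + 1)), add_zero]

lemma siteFactorRight_of_ne {w : ℕ → ℤ} {n : ℕ} {x : ℤ} (h : w n ≠ x) (p : ℝ) (u z : ℕ) :
    siteFactorRight p u z n x w = siteFactor p u z n x w := by
  rw [siteFactor, siteFactorRight, if_neg h, add_zero]

lemma siteFactorLeft_of_ne {w : ℕ → ℤ} {n : ℕ} {x : ℤ} (h : w n ≠ x) (p : ℝ) (u z : ℕ) :
    siteFactorLeft p u z n x w = siteFactor p u z n x w := by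
  rw [siteFactor, siteFactorLeft, if_neg (by tauto), add_zero]

lemma siteFactor_eq {w : ℕ → ℤ} {n : ℕ} {x : ℤ} (h : w n = x) (p : ℝ) (u z : ℕ) :
    siteFactor p u z n x w = rightProb p w n * siteFactorRight p u z n x w +
      (1 - rightProb p w n) * siteFactorLeft p u z n x w := by
  simp only [siteFactor, siteFactorRight, siteFactorLeft, rightProb, h, if_true, true_and]
  rcases lt_or_ge (upCount w n x) u with hu | hu
  · rw [if_pos hu, downCountBefore_eq_downCount hu]
    exact siteProb_step p hu z _
  · rw [siteProb_frozen p hu, if_neg (not_lt.2 hu : ¬upCount w n x < u), add_zero]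
    ring

/-- The conditional probability, given the path `w` up to time `n`, that the walk has `z k` left
jumps from `N - k` before its `z (k - 1) + 1`-st right jump from there, for `1 ≤ k ≤ N`. -/
def profileProb (p : ℝ) (N : ℕ) (z : ℕ → ℕ) (n : ℕ) (w : ℕ → ℤ) : ℝ :=
  ∏ k ∈ Finset.range N, siteFactor p (z k + 1) (z (k + 1)) n (N - 1 - k) w

/-- The value of `profileProb` at time `n + 1` in case of a right jump. -/
def profileProbRight (p : ℝ) (N : ℕ) (z : ℕ → ℕ) (n : ℕ) (w : ℕ → ℤ) : ℝ :=
  ∏ k ∈ Finset.range N, siteFactorRight p (z k + 1) (z (k + 1)) n (N - 1 - k) w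

/-- The value of `profileProb` at time `n + 1` in case of a left jump. -/
def profileProbLeft (p : ℝ) (N : ℕ) (z : ℕ → ℕ) (n : ℕ) (w : ℕ → ℤ) : ℝ :=
  ∏ k ∈ Finset.range N, siteFactorLeft p (z k + 1) (z (k + 1)) n (N - 1 - k) w

lemma profileProb_eq (p : ℝ) (N : ℕ) (z : ℕ → ℕ) (n : ℕ) (w : ℕ → ℤ) :
    profileProb p N z n w = rightProb p w n * profileProbRight p N z n w +
      (1 - rightProb p w n) * profileProbLeft p N z n w := by
  simp only [profileProb, profileProbRight, profileProbLeft]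
  by_cases h : ∃ k ∈ Finset.range N, w n = N - 1 - k
  · obtain ⟨k, hk, hwk⟩ := h
    have hne : ∀ i ∈ (Finset.range N).erase k, w n ≠ N - 1 - i := by
      intro i hi
      have := Finset.ne_of_mem_erase hi
      omega
    rw [← Finset.mul_prod_erase _ _ hk, ← Finset.mul_prod_erase _ _ hk,
      ← Finset.mul_prod_erase _ _ hk,
      Finset.prod_congr rfl fun i hi => siteFactorRight_of_ne (hne i hi) p (z i + 1) (z (i + 1)),
      Finset.prod_congr rfl fun i hi => siteFactorLeft_of_ne (hne i hi) p (z i + 1) (z (i + 1)),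
      siteFactor_eq hwk]
    ring
  · have hne : ∀ i ∈ Finset.range N, w n ≠ N - 1 - i := fun i hi hi' => h ⟨i, hi, hi'⟩
    rw [Finset.prod_congr rfl fun i hi => siteFactorRight_of_ne (hne i hi) p (z i + 1) (z (i + 1)),
      Finset.prod_congr rfl fun i hi => siteFactorLeft_of_ne (hne i hi) p (z i + 1) (z (i + 1))]
    ring

lemma profileProb_zero (p : ℝ) (N : ℕ) (z : ℕ → ℕ) (w : ℕ → ℤ) :
    profileProb p N z 0 w = ∏ k ∈ Finset.range N, freshProb p (z k + 1) (z (k + 1)) := by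
  simp [profileProb, siteFactor, siteProb, upCount, downCountBefore]

lemma profileProb_eq_one (p : ℝ) {N n : ℕ} {z : ℕ → ℕ} {w : ℕ → ℤ} (h0 : w 0 = 0)
    (hw : ∀ n, w (n + 1) = w n + 1 ∨ w (n + 1) = w n - 1) (hN : w n = N)
    (hz : ∀ k ≤ N, downCount w n (N - k) = z k) : profileProb p N z n w = 1 := by
  refine Finset.prod_eq_one fun k hk => ?_
  rw [Finset.mem_range] at hk
  have hx : (0 : ℤ) ≤ N - 1 - k := by omega
  have hlt : (N : ℤ) - 1 - k < w n := by omega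
  have hu : upCount w n (N - 1 - k) = z k + 1 := by
    rw [upCount_eq_downCount_add h0 hw n hx, if_pos hlt, ← hz k hk.le]
    congr 2
    ring
  have hd := downCountBefore_upCount h0 hw n hx hlt
  have hz' := hz (k + 1) hk
  rw [show (N : ℤ) - (k + 1 : ℕ) = N - 1 - k by push_cast; ring] at hz'
  rw [hu, hz'] at hd
  rw [siteFactor, hu, hd, siteProb_self]

lemma rightProb_mem {p : ℝ} (hp : p ∈ Set.Ioo (1 / 2 : ℝ) (3 / 4)) (w : ℕ → ℤ) (n : ℕ) :
    1 / 2 ≤ rightProb p w n ∧ rightProb p w n ≤ 1 := by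
  rw [rightProb]
  split_ifs
  · exact ⟨hp.1.le, by linarith [hp.2]⟩
  · norm_num

section Congr

variable {w w' : ℕ → ℤ} {n : ℕ}

lemma rightProb_congr (h : ∀ i ≤ n, w i = w' i) (p : ℝ) : rightProb p w n = rightProb p w' n := by
  rw [rightProb, rightProb, downCount_congr h, h n le_rfl]

lemma profileProbRight_congr (h : ∀ i ≤ n, w i = w' i) (p : ℝ) (N : ℕ) (z : ℕ → ℕ) :
    profileProbRight p N z n w = profileProbRight p N z n w' := by
  refine Finset.prod_congr rfl fun k _ => ?_
  rw [siteFactorRight, siteFactorRight, upCount_congr h, downCountBefore_congr h, h n le_rfl]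

lemma profileProbLeft_congr (h : ∀ i ≤ n, w i = w' i) (p : ℝ) (N : ℕ) (z : ℕ → ℕ) :
    profileProbLeft p N z n w = profileProbLeft p N z n w' := by
  refine Finset.prod_congr rfl fun k _ => ?_
  rw [siteFactorLeft, siteFactorLeft, upCount_congr h, downCountBefore_congr h, h n le_rfl]

lemma profileProb_congr (h : ∀ i ≤ n, w i = w' i) (p : ℝ) (N : ℕ) (z : ℕ → ℕ) :
    profileProb p N z n w = profileProb p N z n w' := by
  refine Finset.prod_congr rfl fun k _ => ?_
  rw [siteFactor, siteFactor, upCount_congr h, downCountBefore_congr h]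

end Congr

lemma prod_mem_Icc {ι : Type*} (s : Finset ι) {f : ι → ℝ} (h0 : ∀ i ∈ s, 0 ≤ f i)
    (h1 : ∀ i ∈ s, f i ≤ 1) : ∏ i ∈ s, f i ∈ Set.Icc (0 : ℝ) 1 :=
  ⟨Finset.prod_nonneg h0, Finset.prod_le_one h0 h1⟩

lemma profileProb_mem {p : ℝ} (hp0 : 0 ≤ p) (hp1 : p ≤ 1) (N : ℕ) (z : ℕ → ℕ) (n : ℕ)
    (w : ℕ → ℤ) : profileProb p N z n w ∈ Set.Icc (0 : ℝ) 1 :=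
  prod_mem_Icc _ (fun _ _ => siteProb_nonneg hp0 hp1 _ _ _ _)
    fun _ _ => siteProb_le_one hp0 hp1 _ _ _ _

lemma profileProbRight_mem {p : ℝ} (hp0 : 0 ≤ p) (hp1 : p ≤ 1) (N : ℕ) (z : ℕ → ℕ) (n : ℕ)
    (w : ℕ → ℤ) : profileProbRight p N z n w ∈ Set.Icc (0 : ℝ) 1 :=
  prod_mem_Icc _ (fun _ _ => siteProb_nonneg hp0 hp1 _ _ _ _)
    fun _ _ => siteProb_le_one hp0 hp1 _ _ _ _

lemma profileProbLeft_mem {p : ℝ} (hp0 : 0 ≤ p) (hp1 : p ≤ 1) (N : ℕ) (z : ℕ → ℕ) (n : ℕ)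
    (w : ℕ → ℤ) : profileProbLeft p N z n w ∈ Set.Icc (0 : ℝ) 1 :=
  prod_mem_Icc _ (fun _ _ => siteProb_nonneg hp0 hp1 _ _ _ _)
    fun _ _ => siteProb_le_one hp0 hp1 _ _ _ _

lemma natSA_le {Ω : Type*} [m : MeasurableSpace Ω] {X : ℕ → Ω → ℤ} (hX : ∀ n, Measurable (X n))
    (n : ℕ) : natSA X n ≤ m :=
  iSup₂_le fun i _ => (hX i).comap_le

lemma measurable_natSA {Ω : Type*} (X : ℕ → Ω → ℤ) {i n : ℕ} (hi : i ≤ n) :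
    Measurable[natSA X n] (X i) := by
  refine Measurable.mono (comap_measurable (X i)) ?_ le_rfl
  exact le_iSup₂_of_le i (Finset.mem_range.2 (by omega)) le_rfl

lemma measurable_natSA_comp {Ω : Type*} (X : ℕ → Ω → ℤ) {n : ℕ} {G : (ℕ → ℤ) → ℝ}
    (hG : ∀ w w' : ℕ → ℤ, (∀ i ≤ n, w i = w' i) → G w = G w') :
    Measurable[natSA X n] fun ω => G fun i => X i ω := by
  have h1 : Measurable[natSA X n] fun ω (i : Fin (n + 1)) => X i ω :=
    @measurable_pi_lambda _ _ _ (natSA X n) _ _ fun i =>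
      measurable_natSA X (Nat.le_of_lt_succ i.isLt)
  have h2 : Measurable fun v : Fin (n + 1) → ℤ =>
      G fun i => if h : i < n + 1 then v ⟨i, h⟩ else 0 := measurable_of_countable _
  have h3 := h2.comp h1
  convert h3 using 2 with ω
  refine hG _ _ fun i hi => ?_
  simp only [dif_pos (Nat.lt_succ_of_le hi)]

lemma integrable_mul_indicator_one {Ω : Type*} [MeasurableSpace Ω] {P : Measure Ω} {f : Ω → ℝ}
    (hf : Integrable f P) {S : Set Ω} (hS : MeasurableSet S) :
    Integrable (fun ω => f ω * S.indicator (fun _ => (1 : ℝ)) ω) P := by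
  refine (hf.indicator hS).congr (ae_of_all _ fun ω => ?_)
  by_cases h : ω ∈ S
  · simp only [Set.indicator_of_mem h, mul_one]
  · simp only [Set.indicator_of_notMem h, mul_zero]

lemma IsCookieRW.condExp_eq {Ω : Type*} [MeasurableSpace Ω] {P : Measure Ω} {p : ℝ}
    {X : ℕ → Ω → ℤ} (hX : IsCookieRW P (fun _ => p) X) (n : ℕ) :
    P[Set.indicator {ω | X (n + 1) ω = X n ω + 1} (fun _ => (1 : ℝ)) | natSA X n] =ᵐ[P]
      fun ω => rightProb p (fun i => X i ω) n := by
  filter_upwards [hX.cond n] with ω hω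
  rw [hω, rightProb]
  have h : downCount (fun i => X i ω) n (X n ω) = 0 ↔ ω ∈ freshEvent X n := by
    simp only [downCount, Finset.sum_eq_zero_iff, Finset.mem_range, ite_eq_right_iff,
      one_ne_zero, imp_false, freshEvent, Set.mem_ofPred_eq]
    refine forall₂_congr fun m _ => not_congr ?_
    constructor <;> rintro ⟨h1, h2⟩ <;> refine ⟨h1, ?_⟩ <;> omega
  by_cases hf : ω ∈ freshEvent X n
  · rw [if_pos (h.2 hf), Set.indicator_of_mem hf, Set.indicator_of_notMem (by simpa using hf)]
    ring
  · rw [if_neg (mt h.1 hf), Set.indicator_of_notMem hf, Set.indicator_of_mem (by simpa using hf)]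
    ring

lemma exists_one_le_profileProb (p : ℝ) {w : ℕ → ℤ} (h0 : w 0 = 0)
    (hw : ∀ n, w (n + 1) = w n + 1 ∨ w (n + 1) = w n - 1) {N n B : ℕ} (hn : w n = N)
    (hfirst : ∀ m < n, w m ≠ N) (hB : n < B) : ∃ z ∈ profiles B N,
      ∑ k ∈ Finset.range N, z (k + 1) ≤ n ∧ 1 ≤ profileProb p N z n w := by
  have hd : ∀ x, downCount w n x ≤ n := fun x => by simpa using sum_downCount_le w n 1 x
  refine ⟨fun k => if k ≤ N then downCount w n (N - k) else 0, mem_profiles N ?_ ?_ ?_, ?_, ?_⟩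
  · simpa using downCount_eq_zero hfirst
  · intro k _ hk
    rw [if_pos hk]
    exact (hd _).trans_lt hB
  · intro k hk
    rw [if_neg (by omega)]
  · refine le_trans (le_of_eq (Finset.sum_congr rfl fun k hk => ?_))
      (sum_downCount_le w n N (N - 1))
    have hk' : k + 1 ≤ N := Nat.succ_le_of_lt (Finset.mem_range.1 hk)
    dsimp only
    rw [if_pos hk']
    congr 1
    push_cast
    ring
  · refine (profileProb_eq_one p h0 hw hn fun k hk => ?_).ge
    rw [if_pos hk]

lemma IsCookieRW.ae_path {Ω : Type*} [MeasurableSpace Ω] {P : Measure Ω} {p : ℝ} {X : ℕ → Ω → ℤ}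
    (hX : IsCookieRW P (fun _ => p) X) (hX0 : ∀ᵐ ω ∂P, X 0 ω = 0) :
    ∀ᵐ ω ∂P, X 0 ω = 0 ∧ ∀ n, X (n + 1) ω = X n ω + 1 ∨ X (n + 1) ω = X n ω - 1 := by
  filter_upwards [hX0, ae_all_iff.2 hX.steps] with ω h0 h
  refine ⟨h0, fun n => ?_⟩
  rcases abs_eq zero_le_one |>.1 (h n) with h' | h' <;> omega

section Walk

variable {Ω : Type*} [MeasurableSpace Ω] {P : Measure Ω} [IsProbabilityMeasure P] {p : ℝ}
  {X : ℕ → Ω → ℤ}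

lemma IsCookieRW.integral_right (hX : IsCookieRW P (fun _ => p) X) {n : ℕ} {G : (ℕ → ℤ) → ℝ}
    (hG : ∀ w w' : ℕ → ℤ, (∀ i ≤ n, w i = w' i) → G w = G w')
    (hint : Integrable (fun ω => G fun i => X i ω) P) :
    ∫ ω, (G fun i => X i ω) *
        Set.indicator {ω | X (n + 1) ω = X n ω + 1} (fun _ => (1 : ℝ)) ω ∂P =
      ∫ ω, (G fun i => X i ω) * rightProb p (fun i => X i ω) n ∂P := by
  have hm := natSA_le hX.meas n
  have hR : MeasurableSet {ω | X (n + 1) ω = X n ω + 1} :=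
    measurableSet_eq_fun (hX.meas _) ((hX.meas n).add_const 1)
  have hi : Integrable (Set.indicator {ω | X (n + 1) ω = X n ω + 1} (fun _ => (1 : ℝ))) P :=
    (integrable_const _).indicator hR
  have hprod : Integrable ((fun ω => G fun i => X i ω) *
      Set.indicator {ω | X (n + 1) ω = X n ω + 1} (fun _ => (1 : ℝ))) P :=
    integrable_mul_indicator_one hint hR
  have h1 := condExp_mul_of_stronglyMeasurable_left
    (measurable_natSA_comp X hG).stronglyMeasurable hprod hi
  have h2 := integral_condExp (μ := P) (f := (fun ω => G fun i => X i ω) *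
      Set.indicator {ω | X (n + 1) ω = X n ω + 1} (fun _ => (1 : ℝ))) hm
  change ∫ ω, ((fun ω => G fun i => X i ω) *
      Set.indicator {ω | X (n + 1) ω = X n ω + 1} (fun _ => (1 : ℝ))) ω ∂P = _
  rw [← h2]
  refine integral_congr_ae ?_
  filter_upwards [h1, hX.condExp_eq n] with ω hω1 hω2
  rw [hω1, Pi.mul_apply, hω2]

/-- The one-step formula for expectations along the walk. -/
lemma IsCookieRW.integral_succ (hX : IsCookieRW P (fun _ => p) X) {n : ℕ}
    {H R L : (ℕ → ℤ) → ℝ} (hHR : ∀ w : ℕ → ℤ, w (n + 1) = w n + 1 → H w = R w)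
    (hHL : ∀ w : ℕ → ℤ, w (n + 1) = w n - 1 → H w = L w)
    (hR : ∀ w w' : ℕ → ℤ, (∀ i ≤ n, w i = w' i) → R w = R w')
    (hL : ∀ w w' : ℕ → ℤ, (∀ i ≤ n, w i = w' i) → L w = L w')
    (hRi : Integrable (fun ω => R fun i => X i ω) P)
    (hLi : Integrable (fun ω => L fun i => X i ω) P) :
    ∫ ω, (H fun i => X i ω) ∂P = ∫ ω, (rightProb p (fun i => X i ω) n * (R fun i => X i ω) +
      (1 - rightProb p (fun i => X i ω) n) * L fun i => X i ω) ∂P := by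
  have hS : MeasurableSet {ω | X (n + 1) ω = X n ω + 1} :=
    measurableSet_eq_fun (hX.meas _) ((hX.meas n).add_const 1)
  have hD : ∀ w w' : ℕ → ℤ, (∀ i ≤ n, w i = w' i) → (R w - L w) = (R w' - L w') :=
    fun w w' h => by rw [hR w w' h, hL w w' h]
  have hDi : Integrable (fun ω => (R fun i => X i ω) - L fun i => X i ω) P := hRi.sub hLi
  have hkey := hX.integral_right (G := fun w => R w - L w) hD hDi
  have hae : (fun ω => H fun i => X i ω) =ᵐ[P] fun ω =>
      ((R fun i => X i ω) - L fun i => X i ω) *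
        Set.indicator {ω | X (n + 1) ω = X n ω + 1} (fun _ => (1 : ℝ)) ω +
      L fun i => X i ω := by
    filter_upwards [hX.steps n] with ω hω
    by_cases h : ω ∈ {ω | X (n + 1) ω = X n ω + 1}
    · rw [Set.indicator_of_mem h, hHR (fun i => X i ω) h]
      ring
    · rw [Set.indicator_of_notMem h, hHL]
      · ring
      · rw [Set.mem_ofPred_eq] at h
        rcases abs_eq (zero_le_one) |>.1 hω with h' | h' <;> omega
  have hI1 : Integrable (fun ω => ((R fun i => X i ω) - L fun i => X i ω) *
      Set.indicator {ω | X (n + 1) ω = X n ω + 1} (fun _ => (1 : ℝ)) ω) P :=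
    integrable_mul_indicator_one hDi hS
  have hI2 : Integrable (fun ω => ((R fun i => X i ω) - L fun i => X i ω) *
      rightProb p (fun i => X i ω) n) P := by
    refine hDi.mul_bdd (c := max |p| 1) ?_ ?_
    · exact ((measurable_natSA_comp X fun w w' h => rightProb_congr h p).mono
        (natSA_le hX.meas n) le_rfl).aestronglyMeasurable
    · refine ae_of_all _ fun ω => ?_
      rw [rightProb, Real.norm_eq_abs]
      split_ifs
      · exact le_max_left _ _
      · exact le_trans (by norm_num [abs_le]) (le_max_right _ _)
  rw [integral_congr_ae hae, integral_add hI1 hLi, hkey, ← integral_add hI2 hLi]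
  exact integral_congr_ae (ae_of_all _ fun ω => by ring)

lemma IsCookieRW.integrable_of_bounded (hX : IsCookieRW P (fun _ => p) X) {n : ℕ}
    {G : (ℕ → ℤ) → ℝ} (hG : ∀ w w' : ℕ → ℤ, (∀ i ≤ n, w i = w' i) → G w = G w') {C : ℝ}
    (hC : ∀ᵐ ω ∂P, |G fun i => X i ω| ≤ C) : Integrable (fun ω => G fun i => X i ω) P :=
  Integrable.of_bound ((measurable_natSA_comp X hG).mono
    (natSA_le hX.meas n) le_rfl).aestronglyMeasurable C hC

lemma IsCookieRW.integral_profileProb (hp0 : 0 ≤ p) (hp1 : p ≤ 1)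
    (hX : IsCookieRW P (fun _ => p) X) (N : ℕ) (z : ℕ → ℕ) (n : ℕ) :
    ∫ ω, profileProb p N z n (fun i => X i ω) ∂P =
      ∏ k ∈ Finset.range N, freshProb p (z k + 1) (z (k + 1)) := by
  have habs : ∀ {x : ℝ}, x ∈ Set.Icc (0 : ℝ) 1 → |x| ≤ 1 := fun h =>
    abs_le.2 ⟨by linarith [h.1], h.2⟩
  induction n with
  | zero => simp [profileProb_zero]
  | succ n ih =>
    rw [hX.integral_succ (n := n) (H := profileProb p N z (n + 1)) (R := profileProbRight p N z n)
      (L := profileProbLeft p N z n)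
      (fun w h => Finset.prod_congr rfl fun k _ => siteFactor_succ_right h p _ _ _)
      (fun w h => Finset.prod_congr rfl fun k _ => siteFactor_succ_left h p _ _ _)
      (fun w w' h => profileProbRight_congr h p N z)
      (fun w w' h => profileProbLeft_congr h p N z)
      (hX.integrable_of_bounded (fun w w' h => profileProbRight_congr h p N z)
        (ae_of_all _ fun ω => habs (profileProbRight_mem hp0 hp1 N z n _)))
      (hX.integrable_of_bounded (fun w w' h => profileProbLeft_congr h p N z)
        (ae_of_all _ fun ω => habs (profileProbLeft_mem hp0 hp1 N z n _))), ← ih]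
    exact integral_congr_ae (ae_of_all _ fun ω => (profileProb_eq p N z n _).symm)

lemma measureReal_one_le_profileProb_le (hp0 : 0 ≤ p) (hp1 : p ≤ 1)
    (hX : IsCookieRW P (fun _ => p) X) (N : ℕ) (z : ℕ → ℕ) (n : ℕ) :
    P.real {ω | 1 ≤ profileProb p N z n fun i => X i ω} ≤
      ∏ k ∈ Finset.range N, freshProb p (z k + 1) (z (k + 1)) := by
  have h := mul_meas_ge_le_integral_of_nonneg (μ := P)
    (f := fun ω => profileProb p N z n fun i => X i ω)
    (ae_of_all _ fun ω => (profileProb_mem hp0 hp1 N z n _).1)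
    (hX.integrable_of_bounded (n := n) (C := 1) (fun w w' h => profileProb_congr h p N z)
      (ae_of_all _ fun ω => abs_le.2 ⟨by linarith [(profileProb_mem hp0 hp1 N z n
        fun i => X i ω).1], (profileProb_mem hp0 hp1 N z n _).2⟩)) 1
  rwa [one_mul, hX.integral_profileProb hp0 hp1] at h

lemma ae_eventually_notMem_of_summable {S : ℕ → Set Ω} {b : ℕ → ℝ} (hb : Summable b)
    (h : ∀ n, P.real (S n) ≤ b n) : ∀ᵐ ω ∂P, ∀ᶠ n in atTop, ω ∉ S n := by
  refine ae_eventually_notMem (ne_top_of_le_ne_top hb.tsum_ofReal_ne_top ?_)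
  refine ENNReal.tsum_le_tsum fun n => ?_
  rw [← ofReal_measureReal]
  exact ENNReal.ofReal_le_ofReal (h n)

open Classical in
lemma IsCookieRW.ae_eventually_mul_lt (hp : p ∈ Set.Ioo (1 / 2 : ℝ) (3 / 4))
    (hX : IsCookieRW P (fun _ => p) X) (hX0 : ∀ᵐ ω ∂P, X 0 ω = 0) (K : ℕ) :
    ∀ᵐ ω ∂P, ∀ᶠ n : ℕ in atTop, K * X n ω < n := by
  have hp0 : 0 ≤ p := by linarith [hp.1]
  have hp1 : p ≤ 1 := by linarith [hp.2]
  obtain ⟨θ, hθ, h⟩ := exists_sum_profiles_le hp (Nat.cast_nonneg (α := ℝ) K)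
  have hb : Summable fun N : ℕ => ((K * N + 1 : ℕ) : ℝ) * (4 * Real.exp (-(θ * N))) := by
    have h1 := (Real.summable_pow_mul_exp_neg_nat_mul 1 hθ).mul_left (4 * K : ℝ)
    have h2 := (Real.summable_pow_mul_exp_neg_nat_mul 0 hθ).mul_left 4
    refine (h1.add h2).congr fun N => ?_
    push_cast
    rw [neg_mul]
    ring
  have hbound : ∀ N : ℕ, P.real (⋃ n ∈ Finset.range (K * N + 1),
      ⋃ z ∈ (profiles (K * N + 1) N).filter fun z =>
        ((∑ k ∈ Finset.range N, z (k + 1) : ℕ) : ℝ) ≤ K * N,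
        {ω | 1 ≤ profileProb p N z n fun i => X i ω}) ≤
      ((K * N + 1 : ℕ) : ℝ) * (4 * Real.exp (-(θ * N))) := by
    intro N
    refine (measureReal_biUnion_finset_le _ _).trans ?_
    refine (Finset.sum_le_card_nsmul _ _ _ fun n _ => ?_).trans_eq
      (by rw [Finset.card_range, nsmul_eq_mul])
    exact (measureReal_biUnion_finset_le _ _).trans ((Finset.sum_le_sum fun z _ =>
      measureReal_one_le_profileProb_le hp0 hp1 hX N z n).trans (h _ N))
  filter_upwards [hX.ae_path hX0, ae_eventually_notMem_of_summable hb hbound] with ω hω hev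
  obtain ⟨N₀, hN₀⟩ := eventually_atTop.1 hev
  refine eventually_atTop.2 ⟨K * N₀ + 1, fun n hn => ?_⟩
  by_contra! hlt
  have hpos : 0 < X n ω := by
    by_contra! hneg
    have : (K : ℤ) * X n ω ≤ 0 := mul_nonpos_of_nonneg_of_nonpos (by positivity) hneg
    omega
  obtain ⟨N, hN⟩ := Int.eq_ofNat_of_zero_le hpos.le
  rw [hN] at hlt
  have hnN : n ≤ K * N := by exact_mod_cast hlt
  have hNN : N₀ ≤ N := by
    by_contra! hc
    have := Nat.mul_le_mul_left K hc.le
    omega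
  have hex : ∃ m, X m ω = N := ⟨n, hN⟩
  have hfind : Nat.find hex ≤ n := Nat.find_le hN
  obtain ⟨z, hz, hsum, hprof⟩ := exists_one_le_profileProb p (w := fun i => X i ω) hω.1 hω.2
    (Nat.find_spec hex) (fun m hm => Nat.find_min hex hm)
    (show Nat.find hex < K * N + 1 by omega)
  refine hN₀ N hNN ?_
  simp only [Set.mem_iUnion]
  refine ⟨Nat.find hex, Finset.mem_range.2 (by omega), z, Finset.mem_filter.2 ⟨hz, ?_⟩, hprof⟩
  exact_mod_cast hsum.trans (hfind.trans hnN)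

lemma IsCookieRW.integrable_exp (hX : IsCookieRW P (fun _ => p) X) (hX0 : ∀ᵐ ω ∂P, X 0 ω = 0)
    (n : ℕ) (a b : ℝ) : Integrable (fun ω => Real.exp (-(a * (X n ω + b)))) P := by
  refine hX.integrable_of_bounded (n := n) (G := fun w => Real.exp (-(a * (w n + b))))
    (C := Real.exp (|a| * (n + |b|))) (fun w w' h => by rw [h n le_rfl]) ?_
  filter_upwards [hX.ae_path hX0] with ω hω
  have hbd : |(X n ω : ℝ)| ≤ n := by
    have : ∀ n : ℕ, |X n ω| ≤ n := by
      intro n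
      induction n with
      | zero => simp [hω.1]
      | succ n ih =>
        rw [abs_le] at ih ⊢
        push_cast
        rcases hω.2 n with h | h <;> rw [h] <;> constructor <;> linarith [ih.1, ih.2]
    exact_mod_cast this n
  rw [Real.abs_exp, Real.exp_le_exp]
  calc -(a * (X n ω + b)) ≤ |a * (X n ω + b)| := neg_le_abs _
    _ = |a| * |X n ω + b| := abs_mul _ _
    _ ≤ |a| * (n + |b|) := by
      gcongr
      exact (abs_add_le _ _).trans (by gcongr)

lemma IsCookieRW.integral_exp_le (hp : p ∈ Set.Ioo (1 / 2 : ℝ) (3 / 4))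
    (hX : IsCookieRW P (fun _ => p) X) (hX0 : ∀ᵐ ω ∂P, X 0 ω = 0) {a : ℝ} (ha : 0 ≤ a) (n : ℕ) :
    ∫ ω, Real.exp (-(a * X n ω)) ∂P ≤ Real.exp (a ^ 2 / 2) ^ n := by
  induction n with
  | zero =>
    have : (fun ω => Real.exp (-(a * X 0 ω))) =ᵐ[P] fun _ => 1 := by
      filter_upwards [hX0] with ω hω
      simp [hω]
    rw [integral_congr_ae this]
    simp
  | succ n ih =>
    rw [hX.integral_succ (n := n) (H := fun w => Real.exp (-(a * w (n + 1))))
      (R := fun w => Real.exp (-(a * (w n + 1)))) (L := fun w => Real.exp (-(a * (w n + (-1)))))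
      (fun w h => by rw [h]; push_cast; rfl)
      (fun w h => by rw [h]; push_cast; rw [sub_eq_add_neg])
      (fun w w' h => by rw [h n le_rfl]) (fun w w' h => by rw [h n le_rfl])
      (hX.integrable_exp hX0 n a 1) (hX.integrable_exp hX0 n a (-1))]
    have hi : Integrable (fun ω => Real.exp (-(a * X n ω))) P := by
      simpa using hX.integrable_exp hX0 n a 0
    calc _ ≤ ∫ ω, Real.exp (a ^ 2 / 2) * Real.exp (-(a * X n ω)) ∂P := by
          refine integral_mono_of_nonneg (ae_of_all _ fun ω => ?_) (hi.const_mul _)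
            (ae_of_all _ fun ω => ?_)
          · obtain ⟨h1, h2⟩ := rightProb_mem hp (fun i => X i ω) n
            have h3 : 0 ≤ rightProb p (fun i => X i ω) n := by linarith
            have h4 : 0 ≤ 1 - rightProb p (fun i => X i ω) n := by linarith
            simp only [Pi.zero_apply]
            positivity
          · obtain ⟨h1, h2⟩ := rightProb_mem hp (fun i => X i ω) n
            have h3 : Real.exp (-(a * (X n ω + 1))) = Real.exp (-a) * Real.exp (-(a * X n ω)) := by
              rw [← Real.exp_add]
              congr 1
              ring
            have h4 : Real.exp (-(a * (X n ω + (-1)))) =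
                Real.exp a * Real.exp (-(a * X n ω)) := by
              rw [← Real.exp_add]
              congr 1
              ring
            have h5 : Real.exp (-a) ≤ Real.exp a := Real.exp_le_exp.2 (by linarith)
            have h6 := Real.cosh_le_exp_half_sq a
            rw [Real.cosh_eq] at h6
            dsimp only
            rw [h3, h4]
            calc _ = (rightProb p (fun i => X i ω) n * Real.exp (-a) +
                  (1 - rightProb p (fun i => X i ω) n) * Real.exp a) *
                    Real.exp (-(a * X n ω)) := by ring
              _ ≤ _ := by
                  apply mul_le_mul_of_nonneg_right _ (Real.exp_pos _).le
                  nlinarith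
      _ ≤ _ := by
          rw [integral_const_mul, pow_succ' (Real.exp _)]
          exact mul_le_mul_of_nonneg_left ih (Real.exp_pos _).le

lemma IsCookieRW.ae_eventually_lt_mul (hp : p ∈ Set.Ioo (1 / 2 : ℝ) (3 / 4))
    (hX : IsCookieRW P (fun _ => p) X) (hX0 : ∀ᵐ ω ∂P, X 0 ω = 0) {ε : ℝ} (hε : 0 < ε) :
    ∀ᵐ ω ∂P, ∀ᶠ n : ℕ in atTop, -(ε * n) < X n ω := by
  have hb : Summable fun n : ℕ => Real.exp (-(ε ^ 2 / 2 * n)) := by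
    have h := Real.summable_pow_mul_exp_neg_nat_mul 0 (by positivity : 0 < ε ^ 2 / 2)
    refine h.congr fun n => ?_
    rw [pow_zero, one_mul, neg_mul]
  have hbound : ∀ n : ℕ, P.real {ω | Real.exp (ε ^ 2 * n) ≤ Real.exp (-(ε * X n ω))} ≤
      Real.exp (-(ε ^ 2 / 2 * n)) := by
    intro n
    have hi : Integrable (fun ω => Real.exp (-(ε * X n ω))) P := by
      simpa using hX.integrable_exp hX0 n ε 0
    have h := (mul_meas_ge_le_integral_of_nonneg (ae_of_all _ fun ω => (Real.exp_pos _).le) hi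
      (Real.exp (ε ^ 2 * n))).trans (hX.integral_exp_le hp hX0 hε.le n)
    rw [← Real.exp_nat_mul, ← le_div_iff₀' (Real.exp_pos _), ← Real.exp_sub] at h
    refine h.trans_eq ?_
    congr 1
    ring
  filter_upwards [ae_eventually_notMem_of_summable hb hbound] with ω hω
  filter_upwards [hω] with n hn
  by_contra! hle
  refine hn (Real.exp_le_exp.2 ?_)
  nlinarith

end Walk

/-- For `p ∈ (1/2, 3/4)` the homogeneous walk started at `0` has zero speed. -/
theorem stmt9 (p : ℝ) (hp : p ∈ Set.Ioo (1 / 2 : ℝ) (3 / 4))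
    {Ω : Type*} [MeasurableSpace Ω] (P : Measure Ω) [IsProbabilityMeasure P]
    (X : ℕ → Ω → ℤ) (hX : IsCookieRW P (fun _ => p) X) (hX0 : ∀ᵐ ω ∂P, X 0 ω = 0) :
    ∀ᵐ ω ∂P, Tendsto (fun n : ℕ => (X n ω : ℝ) / n) atTop (nhds 0) := by
  have hup : ∀ᵐ ω ∂P, ∀ K : ℕ, ∀ᶠ n : ℕ in atTop, K * X n ω < n :=
    ae_all_iff.2 fun K => hX.ae_eventually_mul_lt hp hX0 K
  have hlow : ∀ᵐ ω ∂P, ∀ K : ℕ, ∀ᶠ n : ℕ in atTop, -(1 / ((K : ℝ) + 1) * n) < X n ω :=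
    ae_all_iff.2 fun K => hX.ae_eventually_lt_mul hp hX0 (by positivity)
  filter_upwards [hup, hlow] with ω hu hl
  rw [Metric.tendsto_nhds]
  intro ε hε
  obtain ⟨K, hK⟩ := exists_nat_one_div_lt hε
  filter_upwards [hu (K + 1), hl K, eventually_gt_atTop 0] with n h1 h2 hn
  have hn' : (0 : ℝ) < n := by exact_mod_cast hn
  have hK' : (0 : ℝ) < (K : ℝ) + 1 := by positivity
  have h1' : ((K : ℝ) + 1) * X n ω < n := by exact_mod_cast h1
  have h3 : (X n ω : ℝ) < 1 / ((K : ℝ) + 1) * n := by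
    rw [one_div_mul_eq_div, lt_div_iff₀' hK']
    exact h1'
  rw [Real.dist_eq, sub_zero, abs_div, abs_of_pos hn', div_lt_iff₀ hn', abs_lt]
  have h4 := mul_lt_mul_of_pos_right hK hn'
  constructor <;> linarith
end
end

section
/- Let p ∈ (3/4, 1) and let X be a random walk in the homogeneous 'have your cookie and eat it' environment ω ≡ p with X_0 = 0 almost surely. Then the process is ballistic: there exists a real number v with v ≥ 4p − 3 > 0 such that lim_{n→∞} X_n/n = v almost surely. -/
open MeasureTheory Filter

noncomputable section

namespace CookieRW

/-! ### Resampling a coordinate of a product measure -/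

section Resampling

variable {ι A : Type*} [DecidableEq ι] [MeasurableSpace A]

theorem measurable_update_prod (i : ι) :
    Measurable fun z : (ι → A) × A => Function.update z.1 i z.2 := by
  refine measurable_pi_iff.2 fun j => ?_
  by_cases h : j = i
  · subst h; simpa using measurable_snd
  · simp only [Function.update_of_ne h]
    exact (measurable_pi_apply j).comp measurable_fst

theorem map_update_infinitePi (ν : Measure A) [IsProbabilityMeasure ν] (i : ι) :
    ((Measure.infinitePi fun _ : ι => ν).prod ν).map (fun z => Function.update z.1 i z.2) =
      Measure.infinitePi fun _ : ι => ν := by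
  refine Measure.eq_infinitePi _ fun S t ht => ?_
  rw [Measure.map_apply (measurable_update_prod i)
    (MeasurableSet.pi S.countable_toSet fun j _ => ht j)]
  have hpre : (fun z : (ι → A) × A => Function.update z.1 i z.2) ⁻¹' ((S : Set ι).pi t) =
      (((S.erase i : Finset ι) : Set ι).pi t) ×ˢ (if i ∈ S then t i else Set.univ) := by
    ext z
    simp only [Set.mem_preimage, Set.mem_pi, Set.mem_prod, Finset.mem_coe, Finset.mem_erase]
    constructor
    · refine fun h => ⟨fun j hj => by simpa [hj.1] using h j hj.2, ?_⟩
      split_ifs with hi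
      · simpa using h i hi
      · trivial
    · rintro ⟨h1, h2⟩ j hj
      by_cases hji : j = i
      · subst hji; simpa [hj] using h2
      · simpa [hji] using h1 j ⟨hji, hj⟩
  rw [hpre, Measure.prod_prod, Measure.infinitePi_pi _ fun j _ => ht j]
  split_ifs with hi
  · rw [Finset.prod_erase_mul S _ hi]
  · rw [Finset.erase_eq_of_notMem hi]; simp

theorem lintegral_resample (ν : Measure A) [IsProbabilityMeasure ν] (i : ι)
    {f : (ι → A) → ENNReal} (hf : Measurable f) :
    ∫⁻ s, f s ∂(Measure.infinitePi fun _ : ι => ν) =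
      ∫⁻ s, ∫⁻ a, f (Function.update s i a) ∂ν ∂(Measure.infinitePi fun _ : ι => ν) := by
  conv_lhs => rw [← map_update_infinitePi ν i]
  rw [lintegral_map hf (measurable_update_prod i), lintegral_prod]
  exact (hf.comp (measurable_update_prod i)).aemeasurable

end Resampling

/-! ### A single stack of arrows -/

/-- Probability of a right jump from a site after `l` left jumps from it. -/
def thr (p : ℝ) (l : ℕ) : ℝ := if l = 0 then p else 1 / 2

/-- Number of left arrows among the first `n` arrows of a stack. -/
def lefts (p : ℝ) (s : ℕ → ℝ) : ℕ → ℕ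
  | 0 => 0
  | n + 1 => if s n < thr p (lefts p s n) then lefts p s n else lefts p s n + 1

/-- Number of right arrows among the first `n` arrows of a stack. -/
def rights (p : ℝ) (s : ℕ → ℝ) : ℕ → ℕ
  | 0 => 0
  | n + 1 => if s n < thr p (lefts p s n) then rights p s n + 1 else rights p s n

/-- Number of left arrows before the `k`-th right arrow of a stack. -/
def leftsBefore (p : ℝ) (s : ℕ → ℝ) (k : ℕ∞) : ℕ∞ :=
  ⨆ (n : ℕ) (_ : (rights p s n : ℕ∞) < k), (lefts p s n : ℕ∞)

theorem lefts_mono (p : ℝ) (s : ℕ → ℝ) : Monotone (lefts p s) :=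
  monotone_nat_of_le_succ fun n => by rw [lefts]; split_ifs <;> omega

theorem rights_mono (p : ℝ) (s : ℕ → ℝ) : Monotone (rights p s) :=
  monotone_nat_of_le_succ fun n => by rw [rights]; split_ifs <;> omega

theorem le_leftsBefore {p : ℝ} {s : ℕ → ℝ} {k : ℕ∞} {n : ℕ} (h : (rights p s n : ℕ∞) < k) :
    (lefts p s n : ℕ∞) ≤ leftsBefore p s k :=
  le_iSup₂_of_le n h le_rfl

theorem leftsBefore_le {p : ℝ} {s : ℕ → ℝ} {k : ℕ∞} {n : ℕ} (h : k ≤ rights p s n) :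
    leftsBefore p s k ≤ lefts p s n := by
  refine iSup₂_le fun m hm => ?_
  have : rights p s m < rights p s n := by exact_mod_cast hm.trans_le h
  exact_mod_cast lefts_mono p s ((rights_mono p s).reflect_lt this).le

theorem leftsBefore_mono {p : ℝ} {s : ℕ → ℝ} : Monotone (leftsBefore p s) := fun _ _ h =>
  iSup₂_le fun _ hm => le_leftsBefore (hm.trans_le h)

theorem measurable_lefts (p : ℝ) (n : ℕ) : Measurable fun s => lefts p s n := by
  induction n with
  | zero => exact measurable_const
  | succ n ih =>
    have h2 : Measurable fun s => thr p (lefts p s n) := (measurable_of_countable (thr p)).comp ih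
    exact Measurable.ite (measurableSet_lt (measurable_pi_apply n) h2) ih (ih.add_const 1)

theorem measurable_rights (p : ℝ) (n : ℕ) : Measurable fun s => rights p s n := by
  induction n with
  | zero => exact measurable_const
  | succ n ih =>
    have h2 : Measurable fun s => thr p (lefts p s n) :=
      (measurable_of_countable (thr p)).comp (measurable_lefts p n)
    exact Measurable.ite (measurableSet_lt (measurable_pi_apply n) h2) (ih.add_const 1) ih

instance : BorelSpace ℕ∞ := by
  constructor
  symm
  refine eq_top_iff.2 fun s _ => ?_
  let : MeasurableSpace ℕ∞ := borel ℕ∞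
  have : BorelSpace ℕ∞ := ⟨rfl⟩
  exact (Set.to_countable s).measurableSet

theorem measurable_leftsBefore (p : ℝ) :
    Measurable fun z : (ℕ → ℝ) × ℕ∞ => leftsBefore p z.1 z.2 := by
  refine measurable_from_prod_countable_left fun k => ?_
  unfold leftsBefore
  refine Measurable.iSup fun n => ?_
  have : (fun s => ⨆ (_ : (rights p s n : ℕ∞) < k), (lefts p s n : ℕ∞)) =
      (fun z : ℕ × ℕ => ⨆ (_ : (z.1 : ℕ∞) < k), (z.2 : ℕ∞)) ∘
        fun s => (rights p s n, lefts p s n) := rfl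
  rw [this]
  exact (measurable_of_countable _).comp
    ((measurable_rights p n).prodMk (measurable_lefts p n))

/-- The law of a single variable of the stacks: uniform on `(0, 1]`. -/
def unif : Measure ℝ := volume.restrict (Set.Ioc 0 1)

instance : IsProbabilityMeasure unif := ⟨by simp [unif]⟩

theorem unif_Iio {t : ℝ} (h1 : t ≤ 1) : unif (Set.Iio t) = ENNReal.ofReal t := by
  rw [unif, Measure.restrict_apply measurableSet_Iio]
  have : Set.Iio t ∩ Set.Ioc 0 1 = Set.Ioo 0 t := by
    ext x
    simp only [Set.mem_inter_iff, Set.mem_Iio, Set.mem_Ioc, Set.mem_Ioo]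
    exact ⟨fun h => ⟨h.2.1, h.1⟩, fun h => ⟨h.2, h.1, by linarith [h.2]⟩⟩
  rw [this]; simp

theorem lintegral_unif_ite {t : ℝ} (h0 : 0 ≤ t) (h1 : t ≤ 1) {x y : ℝ} (hx : 0 ≤ x)
    (hy : 0 ≤ y) :
    ∫⁻ u, (if u < t then ENNReal.ofReal x else ENNReal.ofReal y) ∂unif =
      ENNReal.ofReal (t * x + (1 - t) * y) := by
  have hc : unif (Set.Iio t)ᶜ = ENNReal.ofReal (1 - t) := by
    rw [prob_compl_eq_one_sub measurableSet_Iio, unif_Iio h1, ENNReal.ofReal_sub _ h0]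
    simp
  have : (fun u : ℝ => if u < t then ENNReal.ofReal x else ENNReal.ofReal y) = fun u =>
      (Set.Iio t).indicator (fun _ => ENNReal.ofReal x) u +
        (Set.Iio t)ᶜ.indicator (fun _ => ENNReal.ofReal y) u := by
    ext u
    by_cases h : u < t <;> simp [h, Set.indicator, ← not_lt]
  rw [this, lintegral_add_left (measurable_const.indicator measurableSet_Iio),
    lintegral_indicator_const measurableSet_Iio, lintegral_indicator_const measurableSet_Iio.compl,
    hc, unif_Iio h1, ← ENNReal.ofReal_mul hx, ← ENNReal.ofReal_mul hy,
    ← ENNReal.ofReal_add (by positivity) (mul_nonneg hy (by linarith))]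
  ring_nf

/-- The law of a stack. -/
def stackLaw : Measure (ℕ → ℝ) := Measure.infinitePi fun _ => unif

instance : IsProbabilityMeasure stackLaw := by unfold stackLaw; infer_instance

/-- The number of left arrows seen and of right arrows still to come, for the exploration of a
stack which stops at the `k`-th right arrow. -/
def explore (p : ℝ) (s : ℕ → ℝ) (k : ℕ) : ℕ → ℕ × ℕ
  | 0 => (0, k)
  | n + 1 =>
    if (explore p s k n).2 = 0 then explore p s k n
    else if s n < thr p (explore p s k n).1 then
      ((explore p s k n).1, (explore p s k n).2 - 1)
    else ((explore p s k n).1 + 1, (explore p s k n).2)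

theorem explore_of_rights_lt {p : ℝ} {s : ℕ → ℝ} {k n : ℕ} (h : rights p s n < k) :
    explore p s k n = (lefts p s n, k - rights p s n) := by
  induction n with
  | zero => rfl
  | succ n ih =>
    have hn : rights p s n < k := (rights_mono p s n.le_succ).trans_lt h
    have hne : k - rights p s n ≠ 0 := by omega
    rw [rights] at h
    rw [explore, ih hn, lefts, rights]
    simp only [hne, if_false]
    split_ifs <;> simp <;> omega

theorem explore_fst_mono (p : ℝ) (s : ℕ → ℝ) (k : ℕ) : Monotone fun n => (explore p s k n).1 :=
  monotone_nat_of_le_succ fun n => by rw [explore]; split_ifs <;> simp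

theorem leftsBefore_le_iSup_explore (p : ℝ) (s : ℕ → ℝ) (k : ℕ) :
    leftsBefore p s k ≤ ⨆ n, ((explore p s k n).1 : ℕ∞) := by
  refine iSup₂_le fun n hn => le_iSup_of_le n ?_
  rw [explore_of_rights_lt (by exact_mod_cast hn)]

theorem explore_congr {p : ℝ} {s t : ℕ → ℝ} {k n : ℕ} (h : ∀ i < n, s i = t i) :
    explore p s k n = explore p t k n := by
  induction n with
  | zero => rfl
  | succ n ih => rw [explore, explore, ih fun i hi => h i (by omega), h n (by omega)]

theorem measurable_explore (p : ℝ) (k n : ℕ) : Measurable fun s => explore p s k n := by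
  induction n with
  | zero => exact measurable_const
  | succ n ih =>
    have h2 : Measurable fun s => thr p (explore p s k n).1 :=
      (measurable_of_countable fun z : ℕ × ℕ => thr p z.1).comp ih
    refine Measurable.ite (ih (MeasurableSet.of_discrete (s := {z : ℕ × ℕ | z.2 = 0}))) ih ?_
    exact Measurable.ite (measurableSet_lt (measurable_pi_apply n) h2)
      ((measurable_of_countable fun z : ℕ × ℕ => (z.1, z.2 - 1)).comp ih)
      ((measurable_of_countable fun z : ℕ × ℕ => (z.1 + 1, z.2)).comp ih)

/-- The harmonic function of the exploration of a stack. -/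
def exploreHarm (p : ℝ) (z : ℕ × ℕ) : ℝ :=
  if z.1 = 0 then (1 - p) * ((z.2 : ℝ) ^ 2 + 3 * z.2)
  else (1 - p) * (((z.1 : ℝ) + z.2) ^ 2 + 2 * z.2) + (3 * p - 1) * (z.1 + z.2)

theorem exploreHarm_nonneg {p : ℝ} (hp : p ∈ Set.Ioo (3 / 4 : ℝ) 1) (z : ℕ × ℕ) :
    0 ≤ exploreHarm p z := by
  have h1 : 0 ≤ 1 - p := by linarith [hp.2]
  have h2 : 0 ≤ 3 * p - 1 := by linarith [hp.1]
  unfold exploreHarm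
  split_ifs <;> positivity

theorem exploreHarm_step (p : ℝ) (j r : ℕ) :
    thr p j * exploreHarm p (j, r) + (1 - thr p j) * exploreHarm p (j + 1, r + 1) =
      exploreHarm p (j, r + 1) := by
  by_cases hj : j = 0
  · subst hj
    simp only [thr, exploreHarm]
    push_cast
    ring
  · simp only [thr, exploreHarm, hj, if_false, Nat.add_eq_zero_iff, false_and]
    push_cast
    ring

theorem lintegral_exploreHarm {p : ℝ} (hp : p ∈ Set.Ioo (3 / 4 : ℝ) 1) (k n : ℕ) :
    ∫⁻ s, ENNReal.ofReal (exploreHarm p (explore p s k n)) ∂stackLaw =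
      ENNReal.ofReal (exploreHarm p (0, k)) := by
  have hmeas : ∀ n, Measurable fun s => ENNReal.ofReal (exploreHarm p (explore p s k n)) :=
    fun n => (measurable_of_countable fun z => ENNReal.ofReal (exploreHarm p z)).comp
      (measurable_explore p k n)
  induction n with
  | zero => simp [explore]
  | succ n ih =>
    rw [← ih]
    unfold stackLaw
    rw [lintegral_resample unif n (hmeas (n + 1))]
    refine lintegral_congr fun s => ?_
    have hc : ∀ a, explore p (Function.update s n a) k n = explore p s k n := fun a =>
      explore_congr fun i hi => by simp [hi.ne]
    simp only [explore, hc, Function.update_self]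
    generalize explore p s k n = z
    obtain ⟨j, r⟩ := z
    rcases r with _ | r
    · simp
    · simp only [Nat.add_eq_zero_iff, one_ne_zero, and_false, if_false, Nat.add_sub_cancel]
      have ht : 0 ≤ thr p j ∧ thr p j ≤ 1 := by
        unfold thr
        split_ifs
        · exact ⟨by linarith [hp.1], hp.2.le⟩
        · norm_num
      rw [← exploreHarm_step, ← lintegral_unif_ite ht.1 ht.2 (exploreHarm_nonneg hp _)
        (exploreHarm_nonneg hp _)]
      exact lintegral_congr fun u => by split_ifs <;> rfl

/-- The Lyapunov function of the chain of left jumps. -/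
def lyap (p : ℝ) (x : ENNReal) : ENNReal :=
  ENNReal.ofReal (1 - p) * x ^ 2 + ENNReal.ofReal (3 * p - 1) * x

theorem lyap_mono (p : ℝ) : Monotone (lyap p) := fun x y h => by unfold lyap; gcongr

theorem continuous_lyap (p : ℝ) : Continuous (lyap p) := by
  unfold lyap
  exact ((ENNReal.continuous_const_mul ENNReal.ofReal_ne_top).comp (ENNReal.continuous_pow 2)).add
    (ENNReal.continuous_const_mul ENNReal.ofReal_ne_top)

theorem lyap_zero (p : ℝ) : lyap p 0 = 0 := by simp [lyap]

theorem lyap_natCast {p : ℝ} (hp : p ∈ Set.Ioo (3 / 4 : ℝ) 1) (k : ℕ) :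
    lyap p k = ENNReal.ofReal ((1 - p) * (k : ℝ) ^ 2 + (3 * p - 1) * k) := by
  have h1 : 0 ≤ 1 - p := by linarith [hp.2]
  have h2 : 0 ≤ 3 * p - 1 := by linarith [hp.1]
  rw [ENNReal.ofReal_add (by positivity) (by positivity), ENNReal.ofReal_mul h1,
    ENNReal.ofReal_mul h2, ENNReal.ofReal_pow (by positivity), ENNReal.ofReal_natCast, lyap]

theorem lyap_le_exploreHarm {p : ℝ} (hp : p ∈ Set.Ioo (3 / 4 : ℝ) 1) (z : ℕ × ℕ) :
    lyap p z.1 ≤ ENNReal.ofReal (exploreHarm p z) := by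
  rw [lyap_natCast hp]
  have h1 : 0 ≤ 1 - p := by linarith [hp.2]
  have h2 : 0 ≤ 3 * p - 1 := by linarith [hp.1]
  refine ENNReal.ofReal_le_ofReal ?_
  by_cases h : z.1 = 0
  · have := exploreHarm_nonneg hp z
    simpa [h] using this
  · simp only [exploreHarm, h, if_false]
    have : (0 : ℝ) ≤ z.2 := by positivity
    have h3 : (0 : ℝ) ≤ z.1 := by positivity
    gcongr
    · nlinarith
    · linarith

theorem lintegral_lyap_leftsBefore {p : ℝ} (hp : p ∈ Set.Ioo (3 / 4 : ℝ) 1) (k : ℕ) :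
    ∫⁻ s, lyap p (leftsBefore p s k : ℕ∞) ∂stackLaw ≤
      ENNReal.ofReal ((1 - p) * ((k : ℝ) ^ 2 + 3 * k)) := by
  have hmono : ∀ s, Monotone fun n => ((explore p s k n).1 : ENNReal) := fun s _ _ h => by
    exact Nat.cast_le.2 (explore_fst_mono p s k h)
  have hb : ∀ s, lyap p (leftsBefore p s k : ℕ∞) ≤
      ⨆ n, lyap p ((explore p s k n).1 : ENNReal) := fun s => by
    rw [← (lyap_mono p).map_iSup_of_continuousAt (continuous_lyap p).continuousAt (lyap_zero p)]
    refine lyap_mono p ?_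
    have := ENat.toENNReal_le.2 (leftsBefore_le_iSup_explore p s k)
    rwa [ENat.toENNReal_iSup] at this
  refine (lintegral_mono hb).trans ?_
  rw [lintegral_iSup]
  · refine iSup_le fun n => (lintegral_mono fun s => lyap_le_exploreHarm hp _).trans ?_
    rw [lintegral_exploreHarm hp]
    simp [exploreHarm]
  · exact fun n => (measurable_of_countable fun z : ℕ × ℕ => lyap p z.1).comp
      (measurable_explore p k n)
  · exact fun m n h s => lyap_mono p (hmono s h)

theorem lintegral_lyap_leftsBefore_add_one {p : ℝ} (hp : p ∈ Set.Ioo (3 / 4 : ℝ) 1) (k : ℕ∞) :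
    ∫⁻ s, lyap p (leftsBefore p s (k + 1) : ℕ∞) ∂stackLaw +
        ENNReal.ofReal (8 * p - 6) * (k : ENNReal) ≤
      lyap p k + ENNReal.ofReal (4 * (1 - p)) := by
  induction k using ENat.recTopCoe with
  | top =>
    have : ENNReal.ofReal (3 * p - 1) ≠ 0 := by simp; linarith [hp.1]
    simp [lyap, ENNReal.mul_top, this]
  | coe k =>
    have := lintegral_lyap_leftsBefore hp (k + 1)
    have h1 : 0 ≤ 1 - p := by linarith [hp.2]
    have h2 : 0 ≤ 3 * p - 1 := by linarith [hp.1]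
    have h3 : 0 ≤ 8 * p - 6 := by linarith [hp.1]
    push_cast at this ⊢
    refine (add_le_add_left this _).trans ?_
    rw [lyap_natCast hp, ← ENNReal.ofReal_natCast, ← ENNReal.ofReal_mul h3,
      ← ENNReal.ofReal_add (by positivity) (by positivity),
      ← ENNReal.ofReal_add (by positivity) (by positivity)]
    refine ENNReal.ofReal_le_ofReal (le_of_eq ?_)
    ring

theorem lintegral_lyap_leftsBefore_add {p : ℝ} (hp : p ∈ Set.Ioo (3 / 4 : ℝ) 1) (k : ℕ∞) :
    ∫⁻ s, lyap p (leftsBefore p s k : ℕ∞) ∂stackLaw +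
        ENNReal.ofReal (6 * p - 4) * (k : ENNReal) ≤ lyap p k := by
  induction k using ENat.recTopCoe with
  | top =>
    have : ENNReal.ofReal (3 * p - 1) ≠ 0 := by simp; linarith [hp.1]
    simp [lyap, ENNReal.mul_top, this]
  | coe k =>
    have := lintegral_lyap_leftsBefore hp k
    have h1 : 0 ≤ 1 - p := by linarith [hp.2]
    have h3 : 0 ≤ 6 * p - 4 := by linarith [hp.1]
    refine (add_le_add_left this _).trans ?_
    simp only [ENat.toENNReal_coe]
    rw [lyap_natCast hp, ← ENNReal.ofReal_natCast, ← ENNReal.ofReal_mul h3,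
      ← ENNReal.ofReal_add (by positivity) (by positivity)]
    refine ENNReal.ofReal_le_ofReal (le_of_eq ?_)
    ring

/-! ### The walk driven by stacks of arrows -/

/-- Position and numbers of visits of the walk which reads the stacks `σ`. -/
def walk (p : ℝ) (σ : ℤ → ℕ → ℝ) : ℕ → ℤ × (ℤ → ℕ)
  | 0 => (0, fun _ => 0)
  | n + 1 =>
    (if σ (walk p σ n).1 ((walk p σ n).2 (walk p σ n).1) <
        thr p (lefts p (σ (walk p σ n).1) ((walk p σ n).2 (walk p σ n).1))
      then (walk p σ n).1 + 1 else (walk p σ n).1 - 1,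
      Function.update (walk p σ n).2 (walk p σ n).1 ((walk p σ n).2 (walk p σ n).1 + 1))

/-- Position of the walk at time `n`. -/
def pos (p : ℝ) (σ : ℤ → ℕ → ℝ) (n : ℕ) : ℤ := (walk p σ n).1

/-- Number of jumps from `y` before time `n`. -/
def vis (p : ℝ) (σ : ℤ → ℕ → ℝ) (n : ℕ) (y : ℤ) : ℕ := (walk p σ n).2 y

/-- Number of left jumps from `y` before time `n`. -/
def leftJumps (p : ℝ) (σ : ℤ → ℕ → ℝ) (n : ℕ) (y : ℤ) : ℕ := lefts p (σ y) (vis p σ n y)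

/-- Number of right jumps from `y` before time `n`. -/
def rightJumps (p : ℝ) (σ : ℤ → ℕ → ℝ) (n : ℕ) (y : ℤ) : ℕ := rights p (σ y) (vis p σ n y)

variable {p : ℝ} {σ : ℤ → ℕ → ℝ}

@[simp] theorem pos_zero : pos p σ 0 = 0 := rfl

@[simp] theorem vis_zero (y : ℤ) : vis p σ 0 y = 0 := rfl

@[simp] theorem leftJumps_zero (y : ℤ) : leftJumps p σ 0 y = 0 := rfl

@[simp] theorem rightJumps_zero (y : ℤ) : rightJumps p σ 0 y = 0 := rfl

theorem pos_succ (n : ℕ) : pos p σ (n + 1) =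
    if σ (pos p σ n) (vis p σ n (pos p σ n)) < thr p (leftJumps p σ n (pos p σ n))
      then pos p σ n + 1 else pos p σ n - 1 := rfl

theorem vis_succ_self (n : ℕ) :
    vis p σ (n + 1) (pos p σ n) = vis p σ n (pos p σ n) + 1 := by
  simp [vis, pos, walk]

theorem vis_succ_of_ne {n : ℕ} {y : ℤ} (h : y ≠ pos p σ n) :
    vis p σ (n + 1) y = vis p σ n y := by
  rw [pos] at h
  simp [vis, walk, h]

theorem jumps_succ_of_ne {n : ℕ} {y : ℤ} (h : y ≠ pos p σ n) :
    leftJumps p σ (n + 1) y = leftJumps p σ n y ∧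
      rightJumps p σ (n + 1) y = rightJumps p σ n y := by
  simp [leftJumps, rightJumps, vis_succ_of_ne h]

theorem step_cases (p : ℝ) (σ : ℤ → ℕ → ℝ) (n : ℕ) :
    (pos p σ (n + 1) = pos p σ n + 1 ∧
      leftJumps p σ (n + 1) (pos p σ n) = leftJumps p σ n (pos p σ n) ∧
      rightJumps p σ (n + 1) (pos p σ n) = rightJumps p σ n (pos p σ n) + 1) ∨
    (pos p σ (n + 1) = pos p σ n - 1 ∧
      leftJumps p σ (n + 1) (pos p σ n) = leftJumps p σ n (pos p σ n) + 1 ∧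
      rightJumps p σ (n + 1) (pos p σ n) = rightJumps p σ n (pos p σ n)) := by
  rw [pos_succ]
  by_cases h : σ (pos p σ n) (vis p σ n (pos p σ n)) < thr p (leftJumps p σ n (pos p σ n))
  · left
    rw [if_pos h]
    rw [leftJumps] at h
    simp [leftJumps, rightJumps, vis_succ_self, lefts, rights, h]
  · right
    rw [if_neg h]
    rw [leftJumps] at h
    simp only [leftJumps, rightJumps, vis_succ_self, lefts, rights, if_neg h, and_self]

theorem abs_pos_le (n : ℕ) : |pos p σ n| ≤ n := by
  induction n with
  | zero => simp
  | succ n ih =>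
    rw [abs_le] at *
    push_cast
    rcases step_cases p σ n with h | h <;> omega

theorem vis_eq_zero {n : ℕ} {y : ℤ} (h : ∀ i < n, pos p σ i ≠ y) : vis p σ n y = 0 := by
  induction n with
  | zero => rfl
  | succ n ih => rw [vis_succ_of_ne (h n n.lt_succ_self).symm, ih fun i hi => h i (by omega)]

theorem jumps_flow (n : ℕ) (y : ℤ) :
    (rightJumps p σ n y : ℤ) - leftJumps p σ n (y + 1) =
      (if y < pos p σ n then 1 else 0) - if y < 0 then 1 else 0 := by
  induction n with
  | zero => by_cases h : y < 0 <;> simp [h]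
  | succ n ih =>
    have hy : y ≠ pos p σ n → _ := fun h => jumps_succ_of_ne h
    have hy1 : y + 1 ≠ pos p σ n → _ := fun h => jumps_succ_of_ne h
    by_cases h1 : y = pos p σ n
    · have h2 : y + 1 ≠ pos p σ n := by omega
      specialize hy1 h2
      subst h1
      rcases step_cases p σ n with h | h <;> split_ifs at * <;> omega
    · specialize hy h1
      by_cases h2 : y + 1 = pos p σ n
      · have h3 := step_cases p σ n
        rw [← h2] at h3 ih
        rcases h3 with h | h <;> split_ifs at * <;> omega
      · specialize hy1 h2
        rcases step_cases p σ n with h | h <;> split_ifs at * <;> omega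

theorem last_arrow_right {n : ℕ} {y : ℤ} (hy : y < pos p σ n) :
    vis p σ n y = 0 ∨ ∃ v, rightJumps p σ n y = rights p (σ y) v + 1 ∧
      leftJumps p σ n y = lefts p (σ y) v := by
  induction n with
  | zero => simp
  | succ n ih =>
    by_cases h : y = pos p σ n
    · subst h
      rcases step_cases p σ n with h | h
      · exact Or.inr ⟨vis p σ n (pos p σ n), h.2.2, h.2.1⟩
      · omega
    · rw [vis_succ_of_ne h, (jumps_succ_of_ne h).1, (jumps_succ_of_ne h).2]
      refine ih ?_
      rcases step_cases p σ n with h | h <;> omega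

theorem pos_eq_sub_leftJumps {n A : ℕ} (h : n ≤ A) :
    pos p σ n = n - 2 * ((∑ y ∈ Finset.range A, leftJumps p σ n y : ℕ) +
      (∑ j ∈ Finset.range A, leftJumps p σ n (-(j + 1)) : ℕ)) := by
  induction n with
  | zero => simp
  | succ n ih =>
    specialize ih (by omega)
    have ha := abs_le.1 (abs_pos_le (p := p) (σ := σ) n)
    rcases step_cases p σ n with hs | hs
    · have hL : ∀ y, leftJumps p σ (n + 1) y = leftJumps p σ n y := fun y => by
        by_cases hy : y = pos p σ n
        · rw [hy, hs.2.1]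
        · exact (jumps_succ_of_ne hy).1
      simp only [hL]
      push_cast at ih ⊢
      omega
    · have hL : ∀ y, leftJumps p σ (n + 1) y =
          leftJumps p σ n y + if y = pos p σ n then 1 else 0 := fun y => by
        by_cases hy : y = pos p σ n
        · rw [hy, hs.2.1, if_pos rfl]
        · rw [if_neg hy, (jumps_succ_of_ne hy).1, add_zero]
      simp only [hL, Finset.sum_add_distrib]
      have : (∑ y ∈ Finset.range A, if (y : ℤ) = pos p σ n then 1 else 0) +
          (∑ j ∈ Finset.range A, if (-(j + 1) : ℤ) = pos p σ n then 1 else 0) = 1 := by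
        rcases le_or_gt 0 (pos p σ n) with h0 | h0
        · obtain ⟨a, ha'⟩ := Int.eq_ofNat_of_zero_le h0
          have h1 : ∀ j : ℕ, ¬ (-(j + 1) : ℤ) = a := by omega
          have h2 : a < A := by omega
          simp only [ha', h1, if_false]
          simp [h2]
        · obtain ⟨a, ha'⟩ := Int.eq_ofNat_of_zero_le (a := -pos p σ n - 1) (by omega)
          have h1 : ∀ j : ℕ, ((-(j + 1) : ℤ) = pos p σ n) = (j = a) := fun j => by
            rw [eq_iff_iff]; omega
          have h2 : a < A := by omega
          have h3 : ∀ j : ℕ, ¬ (j : ℤ) = pos p σ n := by omega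
          simp only [h1, h3, if_false]
          simp [h2]
      push_cast at ih ⊢
      zify at this
      omega

/-! ### The branching chains of left jumps -/

/-- Number of left jumps from `y` before the first visit to `y + m`. -/
def leftChain (p : ℝ) (σ : ℤ → ℕ → ℝ) : ℕ → ℤ → ℕ∞
  | 0, _ => 0
  | m + 1, y => leftsBefore p (σ y) (leftChain p σ m (y + 1) + 1)

/-- Total number of left jumps from `y` on the way to infinity. -/
def leftTotal (p : ℝ) (σ : ℤ → ℕ → ℝ) (y : ℤ) : ℕ∞ := ⨆ m, leftChain p σ m y

/-- Bound for the number of left jumps from `-j` if there are at most `K` of them from `0`. -/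
def negChain (p : ℝ) (σ : ℤ → ℕ → ℝ) (K : ℕ∞) : ℕ → ℕ∞
  | 0 => K
  | j + 1 => leftsBefore p (σ (-(j + 1))) (negChain p σ K j)

theorem leftChain_mono (p : ℝ) (σ : ℤ → ℕ → ℝ) (y : ℤ) :
    Monotone fun m => leftChain p σ m y := by
  refine monotone_nat_of_le_succ fun m => ?_
  induction m generalizing y with
  | zero => simp [leftChain]
  | succ m ih => exact leftsBefore_mono (by gcongr; exact ih (y + 1))

theorem leftJumps_le_leftChain {n m : ℕ} {y : ℤ} (hy : 0 ≤ y)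
    (h : leftJumps p σ n (y + m) = 0) : (leftJumps p σ n y : ℕ∞) ≤ leftChain p σ m y := by
  induction m generalizing y with
  | zero => simp_all
  | succ m ih =>
    have ih := ih (y := y + 1) (by omega) (by rw [← h]; push_cast; ring_nf)
    have hlt : (leftJumps p σ n (y + 1) : ℕ∞) < leftChain p σ m (y + 1) + 1 :=
      lt_of_lt_of_le (by exact_mod_cast Nat.lt_succ_self _) (add_le_add_left ih 1)
    have hf := jumps_flow (p := p) (σ := σ) n y
    rw [if_neg (not_lt.2 hy)] at hf
    rw [leftChain]
    by_cases hp : y < pos p σ n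
    · rw [if_pos hp] at hf
      rcases last_arrow_right hp with h0 | ⟨v, h1, h2⟩
      · rw [leftJumps, h0, lefts]
        exact zero_le
      · rw [h2]
        refine le_leftsBefore ?_
        rwa [show rights p (σ y) v = leftJumps p σ n (y + 1) by omega]
    · rw [if_neg hp] at hf
      refine le_leftsBefore (n := vis p σ n y) ?_
      rwa [← rightJumps, show rightJumps p σ n y = leftJumps p σ n (y + 1) by omega]

theorem leftChain_le_leftJumps {n m : ℕ} {y : ℤ} (hy : 0 ≤ y) (h : y + m ≤ pos p σ n) :
    leftChain p σ m y ≤ leftJumps p σ n y := by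
  induction m generalizing y with
  | zero => simp [leftChain]
  | succ m ih =>
    push_cast at h
    have ih := ih (y := y + 1) (by omega) (by omega)
    have hf := jumps_flow (p := p) (σ := σ) n y
    rw [if_neg (not_lt.2 hy), if_pos (by omega)] at hf
    refine leftsBefore_le ?_
    rw [← rightJumps, show rightJumps p σ n y = leftJumps p σ n (y + 1) + 1 by omega]
    push_cast
    gcongr

theorem leftJumps_le_negChain {n : ℕ} {K : ℕ∞} (h : (leftJumps p σ n 0 : ℕ∞) ≤ K) (j : ℕ) :
    (leftJumps p σ n (-j) : ℕ∞) ≤ negChain p σ K j := by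
  induction j with
  | zero => simpa [negChain] using h
  | succ j ih =>
    have hf := jumps_flow (p := p) (σ := σ) n (-(j + 1))
    rw [if_pos (c := -((j : ℤ) + 1) < 0) (by omega),
      show -((j : ℤ) + 1) + 1 = -j by ring] at hf
    rw [negChain, Nat.cast_add, Nat.cast_one]
    by_cases hp : -((j : ℤ) + 1) < pos p σ n
    · rw [if_pos hp] at hf
      rcases last_arrow_right hp with h0 | ⟨v, h1, h2⟩
      · rw [leftJumps, h0, lefts]
        exact zero_le
      · rw [h2]
        refine le_leftsBefore (lt_of_lt_of_le ?_ ih)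
        exact_mod_cast (by omega : rights p (σ (-(j + 1))) v < leftJumps p σ n (-j))
    · rw [if_neg hp] at hf
      refine le_leftsBefore (n := vis p σ n (-(j + 1))) (lt_of_lt_of_le ?_ ih)
      rw [← rightJumps]
      exact_mod_cast (by omega : rightJumps p σ n (-(j + 1)) < leftJumps p σ n (-j))

theorem leftJumps_le_leftTotal (n : ℕ) {y : ℤ} (hy : 0 ≤ y) :
    (leftJumps p σ n y : ℕ∞) ≤ leftTotal p σ y := by
  refine le_iSup_of_le (n + 1) (leftJumps_le_leftChain hy ?_)
  rw [leftJumps, vis_eq_zero, lefts]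
  intro i hi
  have := abs_le.1 (abs_pos_le (p := p) (σ := σ) i)
  omega

theorem exists_runningMax (x : ℕ → ℤ) (h0 : x 0 = 0) (n : ℕ) :
    ∃ M : ℕ, (∀ i ≤ n, x i ≤ M) ∧ ∃ t ≤ n, x t = M := by
  induction n with
  | zero => exact ⟨0, by simp [h0], 0, le_rfl, by simp [h0]⟩
  | succ n ih =>
    obtain ⟨M, h1, t, h2, h3⟩ := ih
    by_cases h : x (n + 1) ≤ M
    · exact ⟨M, fun i hi => (Nat.le_succ_iff.1 hi).elim (h1 i) fun h' => h' ▸ h, t, by omega, h3⟩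
    · refine ⟨(x (n + 1)).toNat, fun i hi => ?_, n + 1, le_rfl, by omega⟩
      rcases Nat.lt_or_eq_of_le hi with h' | rfl
      · have := h1 i (by omega)
        omega
      · omega

/-- A sequence is squeezed to linear growth by its running maximum. -/
theorem tendsto_div_of_le_of_mul_le {q : ℝ} (hq : 1 ≤ q) {a b : ℕ → ℝ} (hab : ∀ n, a n ≤ b n)
    (h1 : ∀ ε > 0, ∀ᶠ n : ℕ in atTop, (q - ε) * b n ≤ n)
    (h2 : ∀ ε > 0, ∀ᶠ n : ℕ in atTop, n - (q - 1 + ε) * b n ≤ a n) :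
    Tendsto (fun n => a n / n) atTop (nhds (1 / q)) := by
  have hU : Tendsto (fun ε : ℝ => 1 / (q - ε)) (nhdsWithin 0 (Set.Ioi 0)) (nhds (1 / q)) := by
    have : ContinuousAt (fun ε : ℝ => 1 / (q - ε)) 0 :=
      continuousAt_const.div (continuousAt_const.sub continuousAt_id) (by simp; linarith)
    simpa using this.tendsto.mono_left nhdsWithin_le_nhds
  have hL : Tendsto (fun ε : ℝ => 1 - (q - 1 + ε) * (1 / (q - ε)))
      (nhdsWithin 0 (Set.Ioi 0)) (nhds (1 / q)) := by
    have hε : Tendsto (fun ε : ℝ => q - 1 + ε) (nhdsWithin 0 (Set.Ioi 0)) (nhds (q - 1 + 0)) :=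
      (tendsto_const_nhds.add tendsto_id).mono_left nhdsWithin_le_nhds
    convert tendsto_const_nhds.sub (hε.mul hU) using 2
    field_simp
    ring
  have hsmall : ∀ᶠ ε : ℝ in nhdsWithin 0 (Set.Ioi 0), 0 < ε ∧ ε < 1 :=
    Ioo_mem_nhdsGT one_pos
  refine tendsto_order.2 ⟨fun c hc => ?_, fun c hc => ?_⟩
  · obtain ⟨ε, hc, hε0, hε1⟩ := ((hL.eventually (lt_mem_nhds hc)).and hsmall).exists
    filter_upwards [h1 ε hε0, h2 ε hε0, eventually_gt_atTop 0] with n hn1 hn2 hn0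
    have hn0 : (0 : ℝ) < n := by exact_mod_cast hn0
    have hq' : 0 < q - ε := by linarith
    refine hc.trans_le ?_
    rw [le_div_iff₀ hn0]
    have hb : b n ≤ 1 / (q - ε) * n := by
      rw [one_div, inv_mul_eq_div, le_div_iff₀ hq']
      linarith
    have : (q - 1 + ε) * b n ≤ (q - 1 + ε) * (1 / (q - ε) * n) := by
      gcongr
    linarith
  · obtain ⟨ε, hc, hε0, hε1⟩ := ((hU.eventually (gt_mem_nhds hc)).and hsmall).exists
    filter_upwards [h1 ε hε0, eventually_gt_atTop 0] with n hn1 hn0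
    have hn0 : (0 : ℝ) < n := by exact_mod_cast hn0
    have hq' : 0 < q - ε := by linarith
    refine lt_of_le_of_lt ?_ hc
    rw [div_le_div_iff₀ hn0 hq']
    nlinarith [hab n]

variable {p : ℝ} {σ : ℤ → ℕ → ℝ}

theorem le_of_runningMax {n M m : ℕ} {t : ℕ} (ht : t ≤ n) (hM : pos p σ t = M) :
    ((M + 2 * (∑ y ∈ Finset.range (M + 1 - m), (leftChain p σ m y : ENNReal))) : ENNReal) ≤ n := by
  have hMt : M ≤ t := by
    have := abs_le.1 (abs_pos_le (p := p) (σ := σ) t)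
    omega
  have h1 : (∑ y ∈ Finset.range (M + 1 - m), (leftChain p σ m y : ENNReal)) ≤
      (∑ y ∈ Finset.range (t + 1), leftJumps p σ t y : ℕ) := by
    push_cast
    refine (Finset.sum_le_sum (g := fun y : ℕ => ((leftJumps p σ t y : ℕ) : ENNReal))
      fun y hy => ?_).trans
      (Finset.sum_le_sum_of_subset (Finset.range_subset_range.2 (by omega)))
    have := leftChain_le_leftJumps (p := p) (σ := σ) (n := t) (m := m) (y := y) (by omega)
      (by have := Finset.mem_range.1 hy; omega)
    exact (ENat.toENNReal_le.2 this).trans (by simp)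
  have h2 := pos_eq_sub_leftJumps (p := p) (σ := σ) (n := t) (A := t + 1) (by omega)
  refine (add_le_add_right (mul_le_mul_right h1 2) _).trans ?_
  have : M + 2 * (∑ y ∈ Finset.range (t + 1), leftJumps p σ t y) ≤ n := by omega
  exact_mod_cast this

theorem le_pos_add_leftTotal {n M K C : ℕ} (hM : ∀ i ≤ n, pos p σ i ≤ M)
    (hK : leftTotal p σ 0 ≤ K)
    (hC : ∀ J, ∑ j ∈ Finset.range J, (negChain p σ K (j + 1) : ENNReal) ≤ C) :
    ∃ S : ℕ, (S : ENNReal) ≤ ∑ y ∈ Finset.range (M + 1), (leftTotal p σ y : ENNReal) ∧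
      (n : ℤ) ≤ pos p σ n + 2 * C + 2 * S := by
  refine ⟨∑ y ∈ Finset.range (M + 1), leftJumps p σ n y, ?_, ?_⟩
  · push_cast
    refine Finset.sum_le_sum fun y _ => ?_
    exact (by simp : ((leftJumps p σ n y : ℕ) : ENNReal) ≤
      ((leftJumps p σ n y : ℕ∞) : ENNReal)).trans
      (ENat.toENNReal_le.2 (leftJumps_le_leftTotal n (by omega)))
  · have h1 : ∑ j ∈ Finset.range (n + M + 1), leftJumps p σ n (-(j + 1)) ≤ C := by
      rw [← Nat.cast_le (α := ENNReal)]
      push_cast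
      refine (Finset.sum_le_sum fun j _ => ?_).trans (hC (n + M + 1))
      have := leftJumps_le_negChain ((leftJumps_le_leftTotal n le_rfl).trans hK) (j + 1)
      have := ENat.toENNReal_le.2 this
      push_cast at this
      simpa using this
    have h2 : ∑ y ∈ Finset.range (n + M + 1), leftJumps p σ n y =
        ∑ y ∈ Finset.range (M + 1), leftJumps p σ n y := by
      refine (Finset.sum_subset (Finset.range_subset_range.2 (by omega)) fun y _ hy => ?_).symm
      rw [leftJumps, vis_eq_zero, lefts]
      intro i hi
      have := hM i hi.le
      have := Finset.mem_range.not.1 hy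
      omega
    have h3 := pos_eq_sub_leftJumps (p := p) (σ := σ) (n := n) (A := n + M + 1) (by omega)
    rw [h2] at h3
    omega

theorem tendsto_pos_div {ℓ : ℝ} (hℓ : 0 ≤ ℓ)
    (hup : ∀ ε > 0, ∀ᶠ M : ℕ in atTop,
      ∑ y ∈ Finset.range M, (leftTotal p σ y : ENNReal) ≤ ENNReal.ofReal ((ℓ + ε) * M))
    (hlow : ∀ ε > 0, ∃ m, ∀ᶠ M : ℕ in atTop,
      ENNReal.ofReal ((ℓ - ε) * M) ≤ ∑ y ∈ Finset.range M, (leftChain p σ m y : ENNReal))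
    (hneg : ∀ K : ℕ, ∃ C : ℕ, ∀ J,
      ∑ j ∈ Finset.range J, (negChain p σ K (j + 1) : ENNReal) ≤ C) :
    Tendsto (fun n : ℕ => (pos p σ n : ℝ) / n) atTop (nhds (1 / (1 + 2 * ℓ))) := by
  have hfin : ∀ M, ∑ y ∈ Finset.range M, (leftTotal p σ y : ENNReal) < ⊤ := fun M => by
    obtain ⟨M', h, hM'⟩ := ((hup 1 one_pos).and (eventually_ge_atTop M)).exists
    exact ((Finset.sum_le_sum_of_subset (Finset.range_subset_range.2 hM')).trans h).trans_lt
      ENNReal.ofReal_lt_top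
  obtain ⟨K, hK⟩ : ∃ K : ℕ, leftTotal p σ 0 ≤ K := by
    have := hfin 1
    simp only [Finset.range_one, Finset.sum_singleton, Nat.cast_zero] at this
    obtain ⟨K, hK⟩ := ENat.ne_top_iff_exists.1 (ENat.toENNReal_lt_top.1 this).ne
    exact ⟨K, hK.ge⟩
  obtain ⟨C, hC⟩ := hneg K
  choose M hM using fun n => exists_runningMax (pos p σ) pos_zero n
  have hMtop : Tendsto M atTop atTop := by
    refine tendsto_atTop.2 fun B => ?_
    obtain ⟨S, hS⟩ := ENNReal.exists_nat_gt (hfin (B + 1)).ne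
    filter_upwards [eventually_gt_atTop (B + 2 * C + 2 * S)] with n hn
    by_contra! hlt
    obtain ⟨S', h1, h2⟩ := le_pos_add_leftTotal (hM n).1 hK hC
    have h3 : S' < S := by
      rw [← Nat.cast_lt (α := ENNReal)]
      exact (h1.trans (Finset.sum_le_sum_of_subset
        (Finset.range_subset_range.2 (by omega)))).trans_lt hS
    have := (hM n).1 n le_rfl
    omega
  refine tendsto_div_of_le_of_mul_le (b := fun n => (M n : ℝ)) (by linarith)
    (fun n => by exact_mod_cast (hM n).1 n le_rfl) (fun ε hε => ?_) fun ε hε => ?_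
  · obtain ⟨m, hm⟩ := hlow (ε / 4) (by positivity)
    have ht : Tendsto (fun n => M n + 1 - m) atTop atTop :=
      (tendsto_sub_atTop_nat m).comp ((tendsto_add_atTop_nat 1).comp hMtop)
    obtain ⟨c, hc⟩ := exists_nat_gt ((4 * (ℓ * m) + ε) / ε)
    filter_upwards [ht.eventually hm, hMtop.eventually_ge_atTop (c + m)] with n hn hcn
    obtain ⟨t, ht, htM⟩ := (hM n).2
    have h1 := (add_le_add_right (mul_le_mul_right hn 2) _).trans
      (le_of_runningMax (m := m) ht htM)
    rw [Nat.cast_sub (by omega), Nat.cast_add, Nat.cast_one] at h1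
    have h2 : (M n : ℝ) + 2 * ((ℓ - ε / 4) * (M n + 1 - m)) ≤ n := by
      rw [← ENNReal.ofReal_natCast n, ← ENNReal.ofReal_natCast (M n),
        ← ENNReal.ofReal_ofNat 2, ← ENNReal.ofReal_mul (by norm_num)] at h1
      have h3 := ENNReal.ofReal_add_le.trans h1
      rwa [ENNReal.ofReal_le_ofReal_iff (by positivity)] at h3
    have h4 : (c : ℝ) + m ≤ M n := by exact_mod_cast hcn
    rw [div_lt_iff₀ hε] at hc
    nlinarith [mul_le_mul_of_nonneg_left h4 hε.le, mul_nonneg hε.le (Nat.cast_nonneg (α := ℝ) m)]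
  · have ht : Tendsto (fun n => M n + 1) atTop atTop := (tendsto_add_atTop_nat 1).comp hMtop
    obtain ⟨c, hc⟩ := exists_nat_gt ((2 * C + 2 * ℓ + ε) / (ε / 2))
    filter_upwards [ht.eventually (hup (ε / 4) (by positivity)),
      hMtop.eventually_ge_atTop c] with n hn hcn
    obtain ⟨S, h1, h2⟩ := le_pos_add_leftTotal (hM n).1 hK hC
    have h3 : (S : ℝ) ≤ (ℓ + ε / 4) * (M n + 1) := by
      have := h1.trans hn
      rw [← ENNReal.ofReal_natCast, ENNReal.ofReal_le_ofReal_iff (by positivity)] at this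
      exact_mod_cast this
    have h4 : (n : ℝ) ≤ pos p σ n + 2 * C + 2 * S := by exact_mod_cast h2
    have h5 : (c : ℝ) ≤ M n := by exact_mod_cast hcn
    rw [div_lt_iff₀ (by positivity)] at hc
    nlinarith

/-! ### Moments of the chains -/

/-- The law of a family of independent stacks. -/
def stacksLaw : Measure (ℤ → ℕ → ℝ) := Measure.infinitePi fun _ => stackLaw

instance : IsProbabilityMeasure stacksLaw := by unfold stacksLaw; infer_instance

/-- Translation of a family of stacks. -/
def shift (k : ℤ) (σ : ℤ → ℕ → ℝ) : ℤ → ℕ → ℝ := fun y => σ (y + k)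

theorem measurable_shift (k : ℤ) : Measurable (shift k) :=
  measurable_pi_iff.2 fun y => measurable_pi_apply (y + k)

theorem measurePreserving_shift (k : ℤ) : MeasurePreserving (shift k) stacksLaw stacksLaw := by
  refine ⟨measurable_shift k, ?_⟩
  exact Measure.map_infinitePi_infinitePi_of_inj (P := fun _ : ℤ => stackLaw) (add_left_injective k)

theorem leftChain_shift (p : ℝ) (σ : ℤ → ℕ → ℝ) (m : ℕ) (k y : ℤ) :
    leftChain p (shift k σ) m y = leftChain p σ m (y + k) := by
  induction m generalizing y with
  | zero => rfl
  | succ m ih => rw [leftChain, leftChain, ih, shift, show y + 1 + k = y + k + 1 by ring]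

theorem leftTotal_shift (p : ℝ) (σ : ℤ → ℕ → ℝ) (k y : ℤ) :
    leftTotal p (shift k σ) y = leftTotal p σ (y + k) := by
  simp only [leftTotal, leftChain_shift]

theorem leftChain_congr {p : ℝ} {σ τ : ℤ → ℕ → ℝ} {m : ℕ} {y : ℤ}
    (h : ∀ z, y ≤ z → z < y + m → σ z = τ z) : leftChain p σ m y = leftChain p τ m y := by
  induction m generalizing y with
  | zero => rfl
  | succ m ih =>
    rw [leftChain, leftChain, h y le_rfl (by push_cast; omega),
      ih fun z hz hz' => h z (by omega) (by push_cast; omega)]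

theorem negChain_congr {p : ℝ} {σ τ : ℤ → ℕ → ℝ} {K : ℕ∞} {j : ℕ}
    (h : ∀ z, -(j : ℤ) ≤ z → σ z = τ z) : negChain p σ K j = negChain p τ K j := by
  induction j with
  | zero => rfl
  | succ j ih =>
    rw [negChain, negChain, h (-(j + 1)) (by push_cast; omega),
      ih fun z hz => h z (by push_cast; omega)]

theorem measurable_leftChain (p : ℝ) (m : ℕ) (y : ℤ) : Measurable fun σ => leftChain p σ m y := by
  induction m generalizing y with
  | zero => exact measurable_const
  | succ m ih =>
    exact (measurable_leftsBefore p).comp ((measurable_pi_apply y).prodMk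
      ((measurable_of_countable fun k : ℕ∞ => k + 1).comp (ih (y + 1))))

theorem measurable_leftTotal (p : ℝ) (y : ℤ) : Measurable fun σ => leftTotal p σ y :=
  Measurable.iSup fun m => measurable_leftChain p m y

theorem measurable_negChain (p : ℝ) (K : ℕ∞) (j : ℕ) : Measurable fun σ => negChain p σ K j := by
  induction j with
  | zero => exact measurable_const
  | succ j ih => exact (measurable_leftsBefore p).comp ((measurable_pi_apply _).prodMk ih)

theorem measurable_enat_toENNReal {α : Type*} [MeasurableSpace α] {f : α → ℕ∞}
    (hf : Measurable f) : Measurable fun x => (f x : ENNReal) :=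
  (measurable_of_countable fun k : ℕ∞ => (k : ENNReal)).comp hf

theorem measurable_enat_add_one {α : Type*} [MeasurableSpace α] {f : α → ℕ∞}
    (hf : Measurable f) : Measurable fun x => f x + 1 :=
  (measurable_of_countable fun k : ℕ∞ => k + 1).comp hf

theorem lintegral_leftsBefore (p : ℝ) (y : ℤ) {k : (ℤ → ℕ → ℝ) → ℕ∞} (hk : Measurable k)
    (hky : ∀ σ a, k (Function.update σ y a) = k σ) :
    ∫⁻ σ, lyap p (leftsBefore p (σ y) (k σ) : ℕ∞) ∂stacksLaw =
      ∫⁻ σ, ∫⁻ s, lyap p (leftsBefore p s (k σ) : ℕ∞) ∂stackLaw ∂stacksLaw := by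
  unfold stacksLaw
  rw [lintegral_resample stackLaw y]
  · simp only [hky, Function.update_self]
  · exact (continuous_lyap p).measurable.comp (measurable_enat_toENNReal
      ((measurable_leftsBefore p).comp ((measurable_pi_apply y).prodMk hk)))

theorem lintegral_leftChain_eq (p : ℝ) (m : ℕ) (y : ℤ) {f : ℕ∞ → ENNReal} :
    ∫⁻ σ, f (leftChain p σ m y) ∂stacksLaw = ∫⁻ σ, f (leftChain p σ m 0) ∂stacksLaw := by
  have hm : Measurable fun σ => f (leftChain p σ m 0) :=
    (measurable_of_countable f).comp (measurable_leftChain p m 0)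
  rw [← (measurePreserving_shift y).lintegral_comp hm]
  simp only [leftChain_shift, zero_add]

/-- The mean number of left jumps from a site before the walk first moves `m` steps beyond it. -/
def meanChain (p : ℝ) (m : ℕ) : ENNReal := ∫⁻ σ, (leftChain p σ m 0 : ENNReal) ∂stacksLaw

theorem meanChain_mono (p : ℝ) : Monotone (meanChain p) := fun _ _ h =>
  lintegral_mono fun σ => ENat.toENNReal_le.2 (leftChain_mono p σ 0 h)

theorem lintegral_lyap_leftChain_add {p : ℝ} (hp : p ∈ Set.Ioo (3 / 4 : ℝ) 1) (n : ℕ) :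
    ∫⁻ σ, lyap p (leftChain p σ n 0) ∂stacksLaw +
        ENNReal.ofReal (8 * p - 6) * ∑ j ∈ Finset.range n, meanChain p j ≤
      n * ENNReal.ofReal (4 * (1 - p)) := by
  induction n with
  | zero => simp [leftChain, lyap_zero]
  | succ n ih =>
    have hm := measurable_leftChain p n 1
    have h1 : ∫⁻ σ, lyap p (leftChain p σ (n + 1) 0) ∂stacksLaw +
        ENNReal.ofReal (8 * p - 6) * meanChain p n ≤
        ∫⁻ σ, lyap p (leftChain p σ n 0) ∂stacksLaw + ENNReal.ofReal (4 * (1 - p)) := by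
      rw [meanChain, ← lintegral_leftChain_eq p n 1 (f := fun k => (k : ENNReal)),
        ← lintegral_leftChain_eq p n 1 (f := fun k => lyap p k)]
      simp only [leftChain, zero_add]
      rw [lintegral_leftsBefore p 0 (measurable_enat_add_one hm),
        ← lintegral_const_mul _ (measurable_enat_toENNReal hm), ← lintegral_add_right]
      · refine (lintegral_mono fun σ => lintegral_lyap_leftsBefore_add_one hp _).trans ?_
        rw [lintegral_add_right _ measurable_const]
        simp
      · exact (measurable_enat_toENNReal hm).const_mul _
      · intro σ a
        rw [leftChain_congr fun z hz _ => Function.update_of_ne (by omega) _ _]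
    rw [Finset.sum_range_succ, mul_add]
    calc _ = (∫⁻ σ, lyap p (leftChain p σ (n + 1) 0) ∂stacksLaw +
          ENNReal.ofReal (8 * p - 6) * meanChain p n) +
          ENNReal.ofReal (8 * p - 6) * ∑ j ∈ Finset.range n, meanChain p j := by ring
      _ ≤ _ := add_le_add_left h1 _
      _ = (∫⁻ σ, lyap p (leftChain p σ n 0) ∂stacksLaw +
          ENNReal.ofReal (8 * p - 6) * ∑ j ∈ Finset.range n, meanChain p j) +
          ENNReal.ofReal (4 * (1 - p)) := by ring
      _ ≤ _ := add_le_add_left ih _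
      _ = _ := by push_cast; ring

theorem meanChain_le {p : ℝ} (hp : p ∈ Set.Ioo (3 / 4 : ℝ) 1) (j : ℕ) :
    meanChain p j ≤ ENNReal.ofReal (2 * (1 - p) / (4 * p - 3)) := by
  have h1 : 0 < 1 - p := by linarith [hp.2]
  have h2 : 0 < 4 * p - 3 := by linarith [hp.1]
  have h3 : 0 < 8 * p - 6 := by linarith [hp.1]
  have hkey : ∀ n : ℕ, ENNReal.ofReal (8 * p - 6) * (n * meanChain p j) ≤
      ((n + j : ℕ) : ENNReal) * ENNReal.ofReal (4 * (1 - p)) := fun n => by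
    refine le_trans ?_ (le_add_self.trans (lintegral_lyap_leftChain_add hp (n + j)))
    gcongr
    calc (n : ENNReal) * meanChain p j = ∑ i ∈ Finset.range n, meanChain p j := by simp
      _ ≤ ∑ i ∈ Finset.range n, meanChain p (j + i) :=
        Finset.sum_le_sum fun i _ => meanChain_mono p (by omega)
      _ ≤ _ := by
        rw [add_comm n j, Finset.sum_range_add]
        exact le_add_self
  have hfin : meanChain p j ≠ ⊤ := by
    intro h
    have := hkey 1
    rw [h, Nat.cast_one, one_mul, ENNReal.mul_top (by simpa using h3)] at this
    exact ne_top_of_le_ne_top (by finiteness) this rfl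
  obtain ⟨a, ha⟩ : ∃ a : NNReal, meanChain p j = a := ⟨_, (ENNReal.coe_toNNReal hfin).symm⟩
  have hreal : ∀ n : ℕ, (8 * p - 6) * (n * a) ≤ (n + j) * (4 * (1 - p)) := fun n => by
    have := ENNReal.toReal_mono (by finiteness) (hkey n)
    rw [ha] at this
    simpa [ENNReal.toReal_ofReal, h3.le, h1.le, ENNReal.toReal_add] using this
  rw [ha, ← ENNReal.ofReal_coe_nnreal]
  refine ENNReal.ofReal_le_ofReal ?_
  rw [le_div_iff₀ h2]
  by_contra! hlt
  obtain ⟨n, hn⟩ := exists_nat_gt (j * (4 * (1 - p)) / ((8 * p - 6) * a - 4 * (1 - p)))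
  have hpos : 0 < (8 * p - 6) * a - 4 * (1 - p) := by linarith
  rw [div_lt_iff₀ hpos] at hn
  linarith [hreal n]

theorem lintegral_leftTotal (p : ℝ) :
    ∫⁻ σ, (leftTotal p σ 0 : ENNReal) ∂stacksLaw = ⨆ m, meanChain p m := by
  simp only [leftTotal, ENat.toENNReal_iSup]
  rw [lintegral_iSup fun m => measurable_enat_toENNReal (measurable_leftChain p m 0)]
  · rfl
  · exact fun m n h σ => ENat.toENNReal_le.2 (leftChain_mono p σ 0 h)

theorem lintegral_lyap_negChain_add {p : ℝ} (hp : p ∈ Set.Ioo (3 / 4 : ℝ) 1) (K : ℕ∞) (n : ℕ) :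
    ∫⁻ σ, lyap p (negChain p σ K n) ∂stacksLaw + ENNReal.ofReal (6 * p - 4) *
      ∑ j ∈ Finset.range n, ∫⁻ σ, (negChain p σ K j : ENNReal) ∂stacksLaw ≤ lyap p K := by
  induction n with
  | zero => simp [negChain]
  | succ n ih =>
    have hm := measurable_negChain p K n
    have h1 : ∫⁻ σ, lyap p (negChain p σ K (n + 1)) ∂stacksLaw +
        ENNReal.ofReal (6 * p - 4) * ∫⁻ σ, (negChain p σ K n : ENNReal) ∂stacksLaw ≤
        ∫⁻ σ, lyap p (negChain p σ K n) ∂stacksLaw := by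
      simp only [negChain]
      rw [lintegral_leftsBefore p _ hm,
        ← lintegral_const_mul _ (measurable_enat_toENNReal hm), ← lintegral_add_right]
      · exact lintegral_mono fun σ => lintegral_lyap_leftsBefore_add hp _
      · exact (measurable_enat_toENNReal hm).const_mul _
      · exact fun σ a => negChain_congr fun z hz => Function.update_of_ne (by omega) _ _
    rw [Finset.sum_range_succ, mul_add]
    calc _ = (∫⁻ σ, lyap p (negChain p σ K (n + 1)) ∂stacksLaw +
          ENNReal.ofReal (6 * p - 4) * ∫⁻ σ, (negChain p σ K n : ENNReal) ∂stacksLaw) +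
          ENNReal.ofReal (6 * p - 4) *
            ∑ j ∈ Finset.range n, ∫⁻ σ, (negChain p σ K j : ENNReal) ∂stacksLaw := by ring
      _ ≤ _ := add_le_add_left h1 _
      _ ≤ _ := ih

theorem ae_negChain_bounded {p : ℝ} (hp : p ∈ Set.Ioo (3 / 4 : ℝ) 1) :
    ∀ᵐ σ ∂stacksLaw, ∀ K : ℕ, ∃ C : ℕ, ∀ J,
      ∑ j ∈ Finset.range J, (negChain p σ K (j + 1) : ENNReal) ≤ C := by
  refine ae_all_iff.2 fun K => ?_
  have hpos : 0 < 6 * p - 4 := by linarith [hp.1]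
  have hm : ∀ j, Measurable fun σ => (negChain p σ K j : ENNReal) := fun j =>
    measurable_enat_toENNReal (measurable_negChain p K j)
  have hint : ∫⁻ σ, ∑' j, (negChain p σ K j : ENNReal) ∂stacksLaw ≠ ⊤ := by
    rw [lintegral_tsum fun j => (hm j).aemeasurable]
    have hle : ENNReal.ofReal (6 * p - 4) *
        ∑' j, ∫⁻ σ, (negChain p σ K j : ENNReal) ∂stacksLaw ≤ lyap p K := by
      rw [ENNReal.tsum_eq_iSup_nat, ENNReal.mul_iSup]
      exact iSup_le fun n => le_add_self.trans (lintegral_lyap_negChain_add hp K n)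
    intro h
    rw [h, ENNReal.mul_top (by simpa using hpos), lyap] at hle
    refine ne_top_of_le_ne_top ?_ hle rfl
    finiteness
  filter_upwards [ae_lt_top (Measurable.tsum hm) hint] with σ hσ
  obtain ⟨C, hC⟩ := ENNReal.exists_nat_gt hσ.ne
  refine ⟨C, fun J => le_trans ?_ hC.le⟩
  refine le_trans ?_ (ENNReal.sum_le_tsum (Finset.range (J + 1)))
  rw [Finset.sum_range_succ']
  exact le_self_add

/-! ### The maximal ergodic inequality -/

section Maximal

variable {Ω : Type*}

/-- Maximum of the first `n` ergodic sums of `f`, and `0`. -/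
def maxSum (T : Ω → Ω) (f : Ω → ℝ) : ℕ → Ω → ℝ
  | 0 => fun _ => 0
  | n + 1 => fun ω => max 0 (f ω + maxSum T f n (T ω))

theorem maxSum_mono (T : Ω → Ω) (f : Ω → ℝ) (ω : Ω) : Monotone fun n => maxSum T f n ω := by
  refine monotone_nat_of_le_succ fun n => ?_
  induction n generalizing ω with
  | zero => exact le_max_left _ _
  | succ n ih => exact max_le_max le_rfl (add_le_add le_rfl (ih (T ω)))

theorem maxSum_nonneg (T : Ω → Ω) (f : Ω → ℝ) (n : ℕ) (ω : Ω) : 0 ≤ maxSum T f n ω :=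
  maxSum_mono T f ω (Nat.zero_le n)

theorem sum_le_maxSum (T : Ω → Ω) (f : Ω → ℝ) (n : ℕ) (ω : Ω) :
    ∑ i ∈ Finset.range n, f (T^[i] ω) ≤ maxSum T f n ω := by
  induction n generalizing ω with
  | zero => simp [maxSum]
  | succ n ih =>
    rw [Finset.sum_range_succ', maxSum]
    refine le_max_of_le_right ?_
    have := ih (T ω)
    simp only [Function.iterate_succ_apply, Function.iterate_zero, id]
    linarith

variable [MeasurableSpace Ω] {μ : Measure Ω} {T : Ω → Ω}

theorem measurable_maxSum (hT : Measurable T) {f : Ω → ℝ} (hf : Measurable f) (n : ℕ) :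
    Measurable (maxSum T f n) := by
  induction n with
  | zero => exact measurable_const
  | succ n ih => exact measurable_const.max (hf.add (ih.comp hT))

theorem integrable_maxSum (hT : MeasurePreserving T μ μ) {f : Ω → ℝ} (hf : Integrable f μ)
    (n : ℕ) : Integrable (maxSum T f n) μ := by
  induction n with
  | zero => exact integrable_zero _ _ _
  | succ n ih =>
    exact (integrable_zero _ _ _).sup (hf.add ((hT.integrable_comp ih.aestronglyMeasurable).2 ih))

theorem setIntegral_maxSum_nonneg (hT : MeasurePreserving T μ μ) {f : Ω → ℝ} (hf : Integrable f μ)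
    (hfm : Measurable f) (n : ℕ) : 0 ≤ ∫ ω in {ω | 0 < maxSum T f n ω}, f ω ∂μ := by
  have hA : MeasurableSet {ω | 0 < maxSum T f n ω} :=
    measurableSet_lt measurable_const (measurable_maxSum hT.measurable hfm n)
  have hM := integrable_maxSum hT hf n
  have hMT : Integrable (fun ω => maxSum T f n (T ω)) μ :=
    (hT.integrable_comp hM.aestronglyMeasurable).2 hM
  have h1 : ∫ ω, maxSum T f n ω - maxSum T f n (T ω) ∂μ = 0 := by
    have h2 : ∫ ω, maxSum T f n (T ω) ∂μ = ∫ ω, maxSum T f n ω ∂μ := by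
      conv_rhs => rw [← hT.map_eq]
      rw [integral_map hT.measurable.aemeasurable]
      exact (measurable_maxSum hT.measurable hfm n).aestronglyMeasurable
    rw [integral_sub hM hMT, h2, sub_self]
  rw [← integral_indicator hA]
  refine h1.symm.le.trans ?_
  refine integral_mono (hM.sub hMT) (hf.indicator hA) fun ω => ?_
  by_cases h : 0 < maxSum T f n ω
  · rw [Set.indicator_of_mem (show ω ∈ {ω | 0 < maxSum T f n ω} from h)]
    rcases n with _ | n
    · exact absurd h (lt_irrefl _)
    · have h3 := maxSum_mono T f (T ω) n.le_succ
      rw [maxSum] at h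
      have h4 : maxSum T f (n + 1) ω = f ω + maxSum T f n (T ω) :=
        max_eq_right ((lt_max_iff.1 h).resolve_left (lt_irrefl _)).le
      simp only [Nat.succ_eq_add_one] at h3
      linarith
  · rw [Set.indicator_of_notMem (show ω ∉ {ω | 0 < maxSum T f n ω} from h)]
    have := maxSum_nonneg T f n (T ω)
    linarith

theorem measure_exists_lt_sum_le [IsProbabilityMeasure μ] (hT : MeasurePreserving T μ μ)
    {Y : Ω → ℝ} (hY : Integrable Y μ) (hYm : Measurable Y) (h0 : ∀ ω, 0 ≤ Y ω) {ε : ℝ}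
    (hε : 0 < ε) :
    μ {ω | ∃ n : ℕ, ε * n < ∑ i ∈ Finset.range n, Y (T^[i] ω)} ≤
      ENNReal.ofReal ((∫ ω, Y ω ∂μ) / ε) := by
  set f : Ω → ℝ := fun ω => Y ω - ε with hfdef
  have hf : Integrable f μ := hY.sub (integrable_const ε)
  have hfm : Measurable f := hYm.sub_const ε
  have hA : ∀ n, MeasurableSet {ω | 0 < maxSum T f n ω} := fun n =>
    measurableSet_lt measurable_const (measurable_maxSum hT.measurable hfm n)
  have hsub : {ω | ∃ n : ℕ, ε * n < ∑ i ∈ Finset.range n, Y (T^[i] ω)} ⊆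
      ⋃ n, {ω | 0 < maxSum T f n ω} := by
    rintro ω ⟨n, hn⟩
    refine Set.mem_iUnion.2 ⟨n, lt_of_lt_of_le ?_ (sum_le_maxSum T f n ω)⟩
    simp only [hfdef, Finset.sum_sub_distrib, Finset.sum_const, Finset.card_range, nsmul_eq_mul]
    linarith
  have hmono : Monotone fun n => {ω | 0 < maxSum T f n ω} := fun m n h ω hω =>
    lt_of_lt_of_le (show 0 < maxSum T f m ω from hω) (maxSum_mono T f ω h)
  refine (measure_mono hsub).trans ?_
  rw [hmono.measure_iUnion]
  refine iSup_le fun n => ?_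
  have h1 := setIntegral_maxSum_nonneg hT hf hfm n
  rw [integral_sub hY.integrableOn (integrable_const ε), setIntegral_const, smul_eq_mul] at h1
  have h2 := setIntegral_le_integral (s := {ω | 0 < maxSum T f n ω}) hY
    (Eventually.of_forall h0)
  rw [← ofReal_measureReal]
  refine ENNReal.ofReal_le_ofReal ?_
  rw [le_div_iff₀ hε]
  linarith

end Maximal

/-! ### Laws of large numbers along the shift -/

theorem tendsto_sum_div_of_tendsto_blocks {a : ℕ → ℝ} (ha : ∀ i, 0 ≤ a i) {m : ℕ} (hm : 0 < m)
    {e : ℝ} (h : ∀ r < m, Tendsto (fun n : ℕ => (∑ k ∈ Finset.range n, a (m * k + r)) / n) atTop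
      (nhds e)) :
    Tendsto (fun M : ℕ => (∑ i ∈ Finset.range M, a i) / M) atTop (nhds e) := by
  have hm' : (0 : ℝ) < m := by exact_mod_cast hm
  set S : ℕ → ℝ := fun M => ∑ i ∈ Finset.range M, a i with hS
  have hSmono : Monotone S := fun i j hij =>
    Finset.sum_le_sum_of_subset_of_nonneg (Finset.range_subset_range.2 hij) fun k _ _ => ha k
  have hblock : ∀ n, S (m * n) = ∑ r ∈ Finset.range m, ∑ k ∈ Finset.range n, a (m * k + r) := by
    intro n
    induction n with
    | zero => simp [hS]
    | succ n ih =>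
      simp only [Finset.sum_range_succ, Finset.sum_add_distrib]
      rw [← ih, mul_add, mul_one, hS]
      exact Finset.sum_range_add _ _ _
  refine tendsto_div_of_monotone_of_exists_subseq_tendsto_div S e hSmono fun c hc =>
    ⟨fun n => m * n, ?_, tendsto_id.const_mul_atTop' hm, ?_⟩
  · obtain ⟨N, hN⟩ := exists_nat_gt (1 / (c - 1))
    filter_upwards [eventually_ge_atTop N] with n hn
    have h1 : (N : ℝ) ≤ n := by exact_mod_cast hn
    rw [div_lt_iff₀ (by linarith)] at hN
    have h2 : 1 ≤ n * (c - 1) := hN.le.trans (by gcongr)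
    push_cast
    nlinarith
  · have := (tendsto_finsetSum (Finset.range m) fun r hr => h r (Finset.mem_range.1 hr)).const_mul
      (1 / (m : ℝ))
    convert this using 1
    · ext n
      rw [hblock, ← Finset.sum_div]
      push_cast
      field_simp
    · simp
      field_simp

section Independence

variable {ι A : Type*} [MeasurableSpace A] [Inhabited A]

open Classical in
theorem indepFun_infinitePi_of_dependsOn (ν : Measure A) [IsProbabilityMeasure ν] {S T : Finset ι}
    (hST : Disjoint S T) {f g : (ι → A) → ℝ} (hf : Measurable f) (hg : Measurable g)
    (hfS : DependsOn f S) (hgT : DependsOn g T) :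
    ProbabilityTheory.IndepFun f g (Measure.infinitePi fun _ : ι => ν) := by
  have hext : ∀ U : Finset ι, Measurable fun (u : U → A) (i : ι) =>
      if h : i ∈ U then u ⟨i, h⟩ else default := fun U => by
    refine measurable_pi_iff.2 fun i => ?_
    by_cases h : i ∈ U
    · simpa [h] using measurable_pi_apply _
    · simp [h]
  have hind := ProbabilityTheory.iIndepFun_infinitePi (P := fun _ : ι => ν)
    (X := fun _ : ι => (id : A → A)) fun _ => measurable_id
  have := hind.indepFun_finset S T hST fun i => measurable_pi_apply i
  have := this.comp (hf.comp (hext S)) (hg.comp (hext T))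
  convert this using 1
  · ext x
    exact hfS fun i hi => by simp [Finset.mem_coe.1 hi]
  · ext x
    exact hgT fun i hi => by simp [Finset.mem_coe.1 hi]

end Independence

/-- The number of left jumps from `y` before `y + m` is visited, as a real number. -/
def chainReal (p : ℝ) (m : ℕ) (y : ℤ) (σ : ℤ → ℕ → ℝ) : ℝ :=
  (leftChain p σ m y : ENNReal).toReal

/-- The number of left jumps from `y` on the way to infinity, as a real number. -/
def totalReal (p : ℝ) (y : ℤ) (σ : ℤ → ℕ → ℝ) : ℝ := (leftTotal p σ y : ENNReal).toReal

theorem measurable_chainReal (p : ℝ) (m : ℕ) (y : ℤ) : Measurable (chainReal p m y) :=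
  (measurable_enat_toENNReal (measurable_leftChain p m y)).ennreal_toReal

theorem measurable_totalReal (p : ℝ) (y : ℤ) : Measurable (totalReal p y) :=
  (measurable_enat_toENNReal (measurable_leftTotal p y)).ennreal_toReal

theorem chainReal_shift (p : ℝ) (m : ℕ) (k y : ℤ) (σ : ℤ → ℕ → ℝ) :
    chainReal p m y (shift k σ) = chainReal p m (y + k) σ := by
  simp only [chainReal, leftChain_shift]

theorem totalReal_shift (p : ℝ) (k y : ℤ) (σ : ℤ → ℕ → ℝ) :
    totalReal p y (shift k σ) = totalReal p (y + k) σ := by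
  simp only [totalReal, leftTotal_shift]

theorem shift_one_iterate (n : ℕ) (σ : ℤ → ℕ → ℝ) : (shift 1)^[n] σ = shift n σ := by
  induction n with
  | zero => ext y i; simp [shift]
  | succ n ih =>
    rw [Function.iterate_succ_apply', ih]
    ext y i
    simp only [shift]
    push_cast
    ring_nf

/-- The mean of the total number of left jumps from a site. -/
def meanTotal (p : ℝ) : ENNReal := ∫⁻ σ, (leftTotal p σ 0 : ENNReal) ∂stacksLaw

theorem meanTotal_le {p : ℝ} (hp : p ∈ Set.Ioo (3 / 4 : ℝ) 1) :
    meanTotal p ≤ ENNReal.ofReal (2 * (1 - p) / (4 * p - 3)) := by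
  rw [meanTotal, lintegral_leftTotal]
  exact iSup_le fun m => meanChain_le hp m

theorem meanTotal_ne_top {p : ℝ} (hp : p ∈ Set.Ioo (3 / 4 : ℝ) 1) : meanTotal p ≠ ⊤ :=
  ne_top_of_le_ne_top ENNReal.ofReal_ne_top (meanTotal_le hp)

theorem meanChain_ne_top {p : ℝ} (hp : p ∈ Set.Ioo (3 / 4 : ℝ) 1) (m : ℕ) : meanChain p m ≠ ⊤ :=
  ne_top_of_le_ne_top ENNReal.ofReal_ne_top (meanChain_le hp m)

theorem tendsto_meanChain {p : ℝ} (hp : p ∈ Set.Ioo (3 / 4 : ℝ) 1) :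
    Tendsto (fun m => (meanChain p m).toReal) atTop (nhds (meanTotal p).toReal) := by
  refine (ENNReal.tendsto_toReal (meanTotal_ne_top hp)).comp ?_
  rw [meanTotal, lintegral_leftTotal]
  exact tendsto_atTop_iSup (meanChain_mono p)

theorem ae_leftTotal_lt_top {p : ℝ} (hp : p ∈ Set.Ioo (3 / 4 : ℝ) 1) :
    ∀ᵐ σ ∂stacksLaw, ∀ y, (leftTotal p σ y : ENNReal) < ⊤ := by
  refine ae_all_iff.2 fun y => ?_
  have h0 := ae_lt_top (measurable_enat_toENNReal (measurable_leftTotal p 0)) (meanTotal_ne_top hp)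
  filter_upwards [(measurePreserving_shift y).quasiMeasurePreserving.ae h0] with σ hσ
  rwa [leftTotal_shift, zero_add] at hσ

theorem integrable_totalReal {p : ℝ} (hp : p ∈ Set.Ioo (3 / 4 : ℝ) 1) :
    Integrable (totalReal p 0) stacksLaw :=
  integrable_toReal_of_lintegral_ne_top
    (measurable_enat_toENNReal (measurable_leftTotal p 0)).aemeasurable (meanTotal_ne_top hp)

theorem integral_totalReal {p : ℝ} (hp : p ∈ Set.Ioo (3 / 4 : ℝ) 1) :
    ∫ σ, totalReal p 0 σ ∂stacksLaw = (meanTotal p).toReal :=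
  integral_toReal (measurable_enat_toENNReal (measurable_leftTotal p 0)).aemeasurable
    (ae_lt_top (measurable_enat_toENNReal (measurable_leftTotal p 0)) (meanTotal_ne_top hp))

theorem lintegral_leftChain_ne_top {p : ℝ} (hp : p ∈ Set.Ioo (3 / 4 : ℝ) 1) (m : ℕ) (y : ℤ) :
    ∫⁻ σ, (leftChain p σ m y : ENNReal) ∂stacksLaw ≠ ⊤ := by
  rw [lintegral_leftChain_eq p m y (f := fun k => (k : ENNReal))]
  exact meanChain_ne_top hp m

theorem integrable_chainReal {p : ℝ} (hp : p ∈ Set.Ioo (3 / 4 : ℝ) 1) (m : ℕ) (y : ℤ) :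
    Integrable (chainReal p m y) stacksLaw :=
  integrable_toReal_of_lintegral_ne_top
    (measurable_enat_toENNReal (measurable_leftChain p m y)).aemeasurable
    (lintegral_leftChain_ne_top hp m y)

theorem integral_chainReal {p : ℝ} (hp : p ∈ Set.Ioo (3 / 4 : ℝ) 1) (m : ℕ) (y : ℤ) :
    ∫ σ, chainReal p m y σ ∂stacksLaw = (meanChain p m).toReal := by
  unfold chainReal
  rw [integral_toReal (measurable_enat_toENNReal (measurable_leftChain p m y)).aemeasurable
    (ae_lt_top (measurable_enat_toENNReal (measurable_leftChain p m y))
      (lintegral_leftChain_ne_top hp m y)),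
    lintegral_leftChain_eq p m y (f := fun k => (k : ENNReal)), meanChain]

theorem identDistrib_chainReal (p : ℝ) (m : ℕ) (y z : ℤ) :
    ProbabilityTheory.IdentDistrib (chainReal p m y) (chainReal p m z) stacksLaw stacksLaw := by
  refine ⟨(measurable_chainReal p m y).aemeasurable, (measurable_chainReal p m z).aemeasurable, ?_⟩
  have : chainReal p m y = chainReal p m z ∘ shift (y - z) := by
    ext σ
    rw [Function.comp, chainReal_shift, add_sub_cancel]
  rw [this, ← Measure.map_map (measurable_chainReal p m z) (measurable_shift _),
    (measurePreserving_shift _).map_eq]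

theorem indepFun_chainReal (p : ℝ) {m : ℕ} {y z : ℤ} (h : y + m ≤ z) :
    ProbabilityTheory.IndepFun (chainReal p m y) (chainReal p m z) stacksLaw := by
  have hdep : ∀ y, DependsOn (chainReal p m y) (Finset.Ico y (y + m) : Finset ℤ) :=
    fun y σ τ hστ => by
      rw [chainReal, chainReal, leftChain_congr fun z h1 h2 => hστ z (by simp [h1, h2])]
  exact indepFun_infinitePi_of_dependsOn stackLaw (Finset.disjoint_left.2 fun a h1 h2 => by
    simp only [Finset.mem_Ico] at h1 h2; omega) (measurable_chainReal p m y)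
    (measurable_chainReal p m z) (hdep y) (hdep z)

theorem ae_tendsto_sum_chainReal {p : ℝ} (hp : p ∈ Set.Ioo (3 / 4 : ℝ) 1) (m : ℕ) :
    ∀ᵐ σ ∂stacksLaw, Tendsto (fun M : ℕ => (∑ y ∈ Finset.range M, chainReal p m y σ) / M) atTop
      (nhds (meanChain p m).toReal) := by
  have h : ∀ r : ℕ, ∀ᵐ σ ∂stacksLaw, Tendsto (fun n : ℕ => (∑ k ∈ Finset.range n,
      chainReal p m (((m + 1) * k + r : ℕ) : ℤ) σ) / n) atTop (nhds (meanChain p m).toReal) := by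
    intro r
    have := ProbabilityTheory.strong_law_ae_real
      (fun k : ℕ => chainReal p m (((m + 1) * k + r : ℕ) : ℤ)) (μ := stacksLaw)
      (integrable_chainReal hp m _) ?_ fun i => identDistrib_chainReal p m _ _
    · rwa [integral_chainReal hp] at this
    · have hlt : ∀ i j : ℕ, i < j → (((m + 1) * i + r : ℕ) : ℤ) + m ≤ ((m + 1) * j + r : ℕ) := by
        intro i j hij
        have : (m + 1) * (i + 1) ≤ (m + 1) * j := Nat.mul_le_mul_left _ hij
        rw [mul_add] at this
        omega
      intro i j hij
      rcases lt_or_gt_of_ne hij with h | h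
      · exact indepFun_chainReal p (hlt i j h)
      · exact (indepFun_chainReal p (hlt j i h)).symm
  filter_upwards [ae_all_iff.2 h] with σ hσ
  exact tendsto_sum_div_of_tendsto_blocks (a := fun i => chainReal p m i σ)
    (fun _ => ENNReal.toReal_nonneg) m.succ_pos fun r _ => hσ r

theorem ae_eventually_le_sum_leftChain {p : ℝ} (hp : p ∈ Set.Ioo (3 / 4 : ℝ) 1) :
    ∀ᵐ σ ∂stacksLaw, ∀ ε > 0, ∃ m, ∀ᶠ M : ℕ in atTop,
      ENNReal.ofReal (((meanTotal p).toReal - ε) * M) ≤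
        ∑ y ∈ Finset.range M, (leftChain p σ m y : ENNReal) := by
  filter_upwards [ae_all_iff.2 (ae_tendsto_sum_chainReal hp)] with σ h2 ε hε
  obtain ⟨m, hm⟩ := ((tendsto_meanChain hp).eventually
    (lt_mem_nhds (show (meanTotal p).toReal - ε < (meanTotal p).toReal by linarith))).exists
  refine ⟨m, ?_⟩
  filter_upwards [(h2 m).eventually (lt_mem_nhds hm), eventually_gt_atTop 0] with M hM hM0
  rw [lt_div_iff₀ (by exact_mod_cast hM0)] at hM
  refine (ENNReal.ofReal_le_ofReal hM.le).trans ?_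
  simp only [chainReal]
  rw [ENNReal.ofReal_sum_of_nonneg fun _ _ => ENNReal.toReal_nonneg]
  exact Finset.sum_le_sum fun y _ => ENNReal.ofReal_toReal_le

theorem ae_eventually_sum_totalReal_le {p : ℝ} (hp : p ∈ Set.Ioo (3 / 4 : ℝ) 1) {ε : ℝ}
    (hε : 0 < ε) : ∀ᵐ σ ∂stacksLaw, ∀ᶠ M : ℕ in atTop,
      ∑ y ∈ Finset.range M, totalReal p y σ ≤ ((meanTotal p).toReal + ε) * M := by
  set bad := {σ | ¬ ∀ᶠ M : ℕ in atTop,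
      ∑ y ∈ Finset.range M, totalReal p y σ ≤ ((meanTotal p).toReal + ε) * M} with hbad
  have hbound : ∀ m, stacksLaw bad ≤
      ENNReal.ofReal (((meanTotal p).toReal - (meanChain p m).toReal) / (ε / 2)) := fun m => by
    set Y : (ℤ → ℕ → ℝ) → ℝ := fun σ => max 0 (totalReal p 0 σ - chainReal p m 0 σ) with hY
    have hYm : Measurable Y :=
      measurable_const.max ((measurable_totalReal p 0).sub (measurable_chainReal p m 0))
    have hdiff : ∀ᵐ σ ∂stacksLaw, ∀ y, chainReal p m y σ ≤ totalReal p y σ := by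
      filter_upwards [ae_leftTotal_lt_top hp] with σ hσ y
      exact ENNReal.toReal_mono (hσ y).ne (ENat.toENNReal_le.2 (le_iSup (leftChain p σ · y) m))
    have hYae : Y =ᵐ[stacksLaw] fun σ => totalReal p 0 σ - chainReal p m 0 σ := by
      filter_upwards [hdiff] with σ hσ
      exact max_eq_right (sub_nonneg.2 (hσ 0))
    have hYint : Integrable Y stacksLaw :=
      ((integrable_totalReal hp).sub (integrable_chainReal hp m 0)).congr hYae.symm
    have hYE : ∫ σ, Y σ ∂stacksLaw = (meanTotal p).toReal - (meanChain p m).toReal := by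
      rw [integral_congr_ae hYae, integral_sub (integrable_totalReal hp)
        (integrable_chainReal hp m 0), integral_totalReal hp, integral_chainReal hp]
    rw [← hYE]
    refine le_trans ?_ (measure_exists_lt_sum_le (measurePreserving_shift 1) hYint hYm
      (fun σ => le_max_left _ _) (half_pos hε))
    refine measure_mono_ae ?_
    filter_upwards [ae_tendsto_sum_chainReal hp m] with σ hσ hσbad
    by_contra hcon
    refine hσbad ?_
    have hle : (meanChain p m).toReal ≤ (meanTotal p).toReal :=
      ENNReal.toReal_mono (meanTotal_ne_top hp)
        (by rw [meanTotal, lintegral_leftTotal]; exact le_iSup (meanChain p) m)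
    have hcon' : ∀ n : ℕ, ∑ i ∈ Finset.range n, Y ((shift 1)^[i] σ) ≤ ε / 2 * n := fun n => by
      by_contra! h
      exact hcon ⟨n, h⟩
    filter_upwards [hσ.eventually (gt_mem_nhds
      (show (meanChain p m).toReal < (meanTotal p).toReal + ε / 2 by linarith)),
      eventually_gt_atTop 0] with M hM hM0
    rw [div_lt_iff₀ (by exact_mod_cast hM0)] at hM
    have h1 := hcon' M
    have h2 : ∑ y ∈ Finset.range M, totalReal p y σ ≤ ∑ y ∈ Finset.range M, chainReal p m y σ +
        ∑ i ∈ Finset.range M, Y ((shift 1)^[i] σ) := by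
      rw [← Finset.sum_add_distrib]
      refine Finset.sum_le_sum fun y _ => ?_
      rw [shift_one_iterate, hY]
      simp only [totalReal_shift, chainReal_shift, zero_add]
      linarith [le_max_right 0 (totalReal p y σ - chainReal p m y σ)]
    linarith
  have hlim : Tendsto (fun m => ENNReal.ofReal
      (((meanTotal p).toReal - (meanChain p m).toReal) / (ε / 2))) atTop (nhds 0) := by
    have := ENNReal.tendsto_ofReal
      (((tendsto_const_nhds (x := (meanTotal p).toReal)).sub (tendsto_meanChain hp)).div_const
        (ε / 2))
    simpa using this
  exact le_antisymm (ge_of_tendsto' hlim hbound) zero_le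

theorem ae_eventually_sum_leftTotal_le {p : ℝ} (hp : p ∈ Set.Ioo (3 / 4 : ℝ) 1) :
    ∀ᵐ σ ∂stacksLaw, ∀ ε > 0, ∀ᶠ M : ℕ in atTop,
      ∑ y ∈ Finset.range M, (leftTotal p σ y : ENNReal) ≤
        ENNReal.ofReal (((meanTotal p).toReal + ε) * M) := by
  filter_upwards [ae_leftTotal_lt_top hp, ae_all_iff.2 fun k : ℕ =>
    ae_eventually_sum_totalReal_le hp (Nat.one_div_pos_of_nat (α := ℝ) (n := k))] with σ h1 h2 ε hε
  obtain ⟨k, hk⟩ := exists_nat_one_div_lt hε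
  filter_upwards [h2 k] with M hM
  refine le_trans ?_ (ENNReal.ofReal_le_ofReal (hM.trans
    (mul_le_mul_of_nonneg_right (by linarith) M.cast_nonneg)))
  simp only [totalReal]
  rw [ENNReal.ofReal_sum_of_nonneg fun _ _ => ENNReal.toReal_nonneg]
  exact Finset.sum_le_sum fun y _ => (ENNReal.ofReal_toReal (h1 y).ne).ge

theorem ae_tendsto_pos_div {p : ℝ} (hp : p ∈ Set.Ioo (3 / 4 : ℝ) 1) :
    ∀ᵐ σ ∂stacksLaw, Tendsto (fun n : ℕ => (pos p σ n : ℝ) / n) atTop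
      (nhds (1 / (1 + 2 * (meanTotal p).toReal))) := by
  filter_upwards [ae_eventually_sum_leftTotal_le hp, ae_eventually_le_sum_leftChain hp,
    ae_negChain_bounded hp] with σ h1 h2 h3
  exact tendsto_pos_div ENNReal.toReal_nonneg h1 h2 h3

theorem le_speed {p : ℝ} (hp : p ∈ Set.Ioo (3 / 4 : ℝ) 1) :
    4 * p - 3 ≤ 1 / (1 + 2 * (meanTotal p).toReal) := by
  have h1 : 0 < 4 * p - 3 := by linarith [hp.1]
  have h2 : 0 ≤ 1 - p := by linarith [hp.2]
  have h3 := ENNReal.toReal_mono ENNReal.ofReal_ne_top (meanTotal_le hp)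
  rw [ENNReal.toReal_ofReal (by positivity), le_div_iff₀ h1] at h3
  rw [le_div_iff₀ (by positivity)]
  linarith

/-! ### Identification of the law of the walk -/

/-- Number of left jumps from `y` along the path `γ` before time `n`. -/
def leftCount (γ : ℕ → ℤ) (y : ℤ) (n : ℕ) : ℕ := Nat.count (fun m => γ m = y ∧ γ (m + 1) = y - 1) n

/-- Number of jumps from `y` along the path `γ` before time `n`. -/
def visCount (γ : ℕ → ℤ) (y : ℤ) (n : ℕ) : ℕ := Nat.count (fun m => γ m = y) n

theorem leftCount_congr {γ δ : ℕ → ℤ} {n : ℕ} (h : ∀ i ≤ n, γ i = δ i) (y : ℤ) :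
    leftCount γ y n = leftCount δ y n := by
  induction n with
  | zero => simp [leftCount]
  | succ n ih =>
    simp only [leftCount, Nat.count_succ] at ih ⊢
    rw [ih fun i hi => h i (by omega), h n (by omega), h (n + 1) le_rfl]

theorem visCount_congr {γ δ : ℕ → ℤ} {n : ℕ} (h : ∀ i < n, γ i = δ i) (y : ℤ) :
    visCount γ y n = visCount δ y n := by
  induction n with
  | zero => simp [visCount]
  | succ n ih =>
    simp only [visCount, Nat.count_succ] at ih ⊢
    rw [ih fun i hi => h i (by omega), h n (by omega)]

theorem visCount_lt {γ : ℕ → ℤ} {i n : ℕ} (h : i < n) :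
    visCount γ (γ i) i < visCount γ (γ i) n :=
  Nat.count_strict_mono (p := fun m => γ m = γ i) rfl h

/-- The paths agreeing with `γ` up to time `n`. -/
def pathEvent {Ω : Type*} (Y : ℕ → Ω → ℤ) (γ : ℕ → ℤ) (n : ℕ) : Set Ω := {ω | ∀ i ≤ n, Y i ω = γ i}

/-- The law of `Y` under `μ` is that of the cookie random walk started at `0`, in terms of
probabilities of initial path segments. -/
structure IsCookieLaw {Ω : Type*} [MeasurableSpace Ω] (p : ℝ) (μ : Measure Ω)
    (Y : ℕ → Ω → ℤ) : Prop where
  meas : ∀ n, Measurable (Y n)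
  start : ∀ᵐ ω ∂μ, Y 0 ω = 0
  steps : ∀ n, ∀ᵐ ω ∂μ, |Y (n + 1) ω - Y n ω| = 1
  right : ∀ γ n, μ (pathEvent Y γ n ∩ {ω | Y (n + 1) ω = γ n + 1}) =
    ENNReal.ofReal (thr p (leftCount γ (γ n) n)) * μ (pathEvent Y γ n)

theorem pathEvent_succ {Ω : Type*} (Y : ℕ → Ω → ℤ) (γ : ℕ → ℤ) (n : ℕ) :
    pathEvent Y γ (n + 1) = pathEvent Y γ n ∩ {ω | Y (n + 1) ω = γ (n + 1)} := by
  ext ω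
  simp only [pathEvent, Set.mem_ofPred_eq, Set.mem_inter_iff]
  exact ⟨fun h => ⟨fun i hi => h i (by omega), h _ le_rfl⟩, fun h i hi => by
    rcases Nat.lt_or_ge n i with h1 | h1
    · rw [show i = n + 1 by omega]; exact h.2
    · exact h.1 i h1⟩

section Uniqueness

variable {Ω Ω' : Type*} [MeasurableSpace Ω] [MeasurableSpace Ω'] {p : ℝ}
  {μ : Measure Ω} {μ' : Measure Ω'} {Y : ℕ → Ω → ℤ} {Y' : ℕ → Ω' → ℤ}

theorem measurableSet_pathEvent (hY : ∀ n, Measurable (Y n)) (γ : ℕ → ℤ) (n : ℕ) :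
    MeasurableSet (pathEvent Y γ n) := by
  have : pathEvent Y γ n = ⋂ i ≤ n, Y i ⁻¹' {γ i} := by ext ω; simp [pathEvent]
  rw [this]
  exact MeasurableSet.biInter (Set.to_countable _) fun i _ => hY i (measurableSet_singleton _)

theorem IsCookieLaw.measure_zero [IsProbabilityMeasure μ] (h : IsCookieLaw p μ Y) (γ : ℕ → ℤ) :
    μ (pathEvent Y γ 0) = if γ 0 = 0 then 1 else 0 := by
  split_ifs with h0
  · refine (prob_compl_eq_zero_iff (measurableSet_pathEvent h.meas γ 0)).1 ?_
    refine measure_mono_null ?_ (ae_iff.1 h.start)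
    intro ω hω
    simpa [pathEvent, h0] using hω
  · refine measure_mono_null ?_ (ae_iff.1 h.start)
    intro ω hω
    have : Y 0 ω = γ 0 := hω 0 le_rfl
    simp [this, h0]

theorem IsCookieLaw.measure_succ [IsProbabilityMeasure μ] (h : IsCookieLaw p μ Y) (γ : ℕ → ℤ)
    (n : ℕ) : μ (pathEvent Y γ (n + 1)) =
      if γ (n + 1) = γ n + 1 then
        ENNReal.ofReal (thr p (leftCount γ (γ n) n)) * μ (pathEvent Y γ n)
      else if γ (n + 1) = γ n - 1 then μ (pathEvent Y γ n) -
        ENNReal.ofReal (thr p (leftCount γ (γ n) n)) * μ (pathEvent Y γ n)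
      else 0 := by
  rw [pathEvent_succ]
  split_ifs with h1 h2
  · rw [h1, h.right]
  · have hm : MeasurableSet (pathEvent Y γ n ∩ {ω | Y (n + 1) ω = γ n + 1}) :=
      (measurableSet_pathEvent h.meas γ n).inter (h.meas _ (measurableSet_singleton _))
    rw [← h.right, ← measure_sdiff Set.inter_subset_left hm.nullMeasurableSet (measure_ne_top _ _)]
    refine measure_congr ?_
    filter_upwards [h.steps n] with ω hω
    refine propext ?_
    show ω ∈ pathEvent Y γ n ∩ _ ↔ ω ∈ pathEvent Y γ n \ _
    simp only [Set.mem_inter_iff, Set.mem_sdiff, Set.mem_ofPred_eq, not_and]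
    refine and_congr_right fun hp => ?_
    have := hp n le_rfl
    rw [this] at hω
    simp only [hp, forall_const, h2]
    rcases (abs_eq (by norm_num)).1 hω with h | h <;> omega
  · refine measure_mono_null ?_ (ae_iff.1 (h.steps n))
    rintro ω ⟨hω, hs⟩
    have := hω n le_rfl
    simp only [Set.mem_ofPred_eq] at hs ⊢
    rw [hs, this, abs_eq (by norm_num)]
    omega

theorem IsCookieLaw.measure_eq [IsProbabilityMeasure μ] [IsProbabilityMeasure μ']
    (h : IsCookieLaw p μ Y) (h' : IsCookieLaw p μ' Y') (γ : ℕ → ℤ) (n : ℕ) :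
    μ (pathEvent Y γ n) = μ' (pathEvent Y' γ n) := by
  induction n with
  | zero => rw [h.measure_zero, h'.measure_zero]
  | succ n ih => rw [h.measure_succ, h'.measure_succ, ih]

theorem IsCookieLaw.map_eq [IsProbabilityMeasure μ] [IsProbabilityMeasure μ']
    (h : IsCookieLaw p μ Y) (h' : IsCookieLaw p μ' Y') :
    μ.map (fun ω n => Y n ω) = μ'.map (fun ω n => Y' n ω) := by
  have hm : Measurable fun ω n => Y n ω := measurable_pi_iff.2 h.meas
  have hm' : Measurable fun ω n => Y' n ω := measurable_pi_iff.2 h'.meas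
  have := Measure.isProbabilityMeasure_map (μ := μ) hm.aemeasurable
  have := Measure.isProbabilityMeasure_map (μ := μ') hm'.aemeasurable
  have key : ∀ n, (μ.map (fun ω n => Y n ω)).map (Preorder.frestrictLe n) =
      (μ'.map (fun ω n => Y' n ω)).map (Preorder.frestrictLe n) := fun n => by
    refine Measure.ext_of_singleton fun γ => ?_
    have hγ := measurableSet_singleton γ
    have hr := Preorder.measurable_frestrictLe (X := fun _ : ℕ => ℤ) n
    rw [Measure.map_apply hr hγ, Measure.map_apply hr hγ, Measure.map_apply hm (hr hγ),
      Measure.map_apply hm' (hr hγ)]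
    let δ : ℕ → ℤ := fun i => if hi : i ≤ n then γ ⟨i, Finset.mem_Iic.2 hi⟩ else 0
    have hpre : (Preorder.frestrictLe (π := fun _ : ℕ => ℤ) n) ⁻¹' {γ} =
        {γ' | ∀ i ≤ n, γ' i = δ i} := by
      ext γ'
      simp only [Set.mem_preimage, Set.mem_singleton_iff, funext_iff, Subtype.forall,
        Finset.mem_Iic, Set.mem_ofPred_eq]
      refine forall₂_congr fun i hi => ?_
      simp [δ, hi, Preorder.frestrictLe]
    rw [hpre]
    exact h.measure_eq h' δ n
  refine IsProjectiveLimit.unique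
    (P := fun I => (μ'.map (fun ω n => Y' n ω)).map I.restrict) (fun I => ?_) fun _ => rfl
  have hI := I.subset_Iic_sup_id
  have hr : I.restrict (π := fun _ : ℕ => ℤ) =
    Finset.restrict₂ hI ∘ Preorder.frestrictLe (I.sup id) := rfl
  rw [hr, ← Measure.map_map (by fun_prop) (by fun_prop), key,
    Measure.map_map (by fun_prop) (by fun_prop), ← hr]

theorem IsCookieLaw.ae_tendsto [IsProbabilityMeasure μ] [IsProbabilityMeasure μ']
    (h : IsCookieLaw p μ Y) (h' : IsCookieLaw p μ' Y') {v : ℝ}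
    (ht : ∀ᵐ ω ∂μ, Tendsto (fun n : ℕ => (Y n ω : ℝ) / n) atTop (nhds v)) :
    ∀ᵐ ω ∂μ', Tendsto (fun n : ℕ => (Y' n ω : ℝ) / n) atTop (nhds v) := by
  have hs : MeasurableSet {γ : ℕ → ℤ | Tendsto (fun n : ℕ => (γ n : ℝ) / n) atTop (nhds v)} :=
    measurableSet_tendsto _ fun n =>
      ((measurable_from_top (f := fun z : ℤ => (z : ℝ))).comp (measurable_pi_apply n)).div_const _
  have hm : Measurable fun ω n => Y n ω := measurable_pi_iff.2 h.meas
  have hm' : Measurable fun ω n => Y' n ω := measurable_pi_iff.2 h'.meas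
  have := (ae_map_iff hm.aemeasurable hs).2 ht
  rw [h.map_eq h'] at this
  exact (ae_map_iff hm'.aemeasurable hs).1 this

end Uniqueness

theorem _root_.IsCookieRW.isCookieLaw {Ω : Type*} [MeasurableSpace Ω] {p : ℝ} {P : Measure Ω}
    [IsProbabilityMeasure P] {X : ℕ → Ω → ℤ} (hX : IsCookieRW P (fun _ => p) X)
    (hX0 : ∀ᵐ ω ∂P, X 0 ω = 0) : IsCookieLaw p P X := by
  refine ⟨hX.meas, hX0, hX.steps, fun γ n => ?_⟩
  have hm : natSA X n ≤ ‹MeasurableSpace Ω› :=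
    iSup₂_le fun m _ => (hX.meas m).comap_le
  have hXn : ∀ i ≤ n, Measurable[natSA X n] (X i) := fun i hi =>
    Measurable.of_comap_le (le_iSup₂_of_le i (Finset.mem_range.2 (by omega)) le_rfl)
  have hS : MeasurableSet[natSA X n] (pathEvent X γ n) := by
    have : pathEvent X γ n = ⋂ i ≤ n, X i ⁻¹' {γ i} := by ext ω; simp [pathEvent]
    rw [this]
    exact MeasurableSet.biInter (Set.to_countable _) fun i hi =>
      hXn i hi (measurableSet_singleton _)
  have hp : p ∈ Set.Ico (1 / 2 : ℝ) 1 := hX.envRange 0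
  have hR : MeasurableSet {ω | X (n + 1) ω = X n ω + 1} :=
    measurableSet_eq_fun (hX.meas _) ((hX.meas _).add_const 1)
  have hint : Integrable (Set.indicator {ω | X (n + 1) ω = X n ω + 1} fun _ => (1 : ℝ)) P :=
    (integrable_const _).indicator hR
  have h1 := setIntegral_condExp hm hint hS
  rw [setIntegral_congr_ae (g := fun _ => thr p (leftCount γ (γ n) n)) (hm _ hS) ?_,
    setIntegral_const, setIntegral_indicator hR, setIntegral_const] at h1
  · have he : pathEvent X γ n ∩ {ω | X (n + 1) ω = γ n + 1} =
        pathEvent X γ n ∩ {ω | X (n + 1) ω = X n ω + 1} := by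
      ext ω
      refine and_congr_right fun h => ?_
      have := h n le_rfl
      simp [this]
    simp only [smul_eq_mul, mul_one] at h1
    rw [he, ← ofReal_measureReal, ← h1, mul_comm, ENNReal.ofReal_mul, ofReal_measureReal]
    unfold thr; split_ifs <;> linarith [hp.1]
  · filter_upwards [hX.cond n] with ω hω hγ
    rw [hω]
    have hf : ω ∈ freshEvent X n ↔ leftCount γ (γ n) n = 0 := by
      rw [← leftCount_congr (γ := fun i => X i ω) hγ, ← hγ n le_rfl, leftCount,
        Nat.count_iff_forall_not, freshEvent, Set.mem_ofPred_eq]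
      refine forall₂_congr fun m _ => not_congr (and_congr_right fun h => ?_)
      rw [h]
    by_cases h0 : leftCount γ (γ n) n = 0
    · simp [hf.2 h0, h0, thr]
    · have := mt hf.1 h0
      simp [this, h0, thr]

theorem vis_eq_visCount (p : ℝ) (σ : ℤ → ℕ → ℝ) (n : ℕ) (y : ℤ) :
    vis p σ n y = visCount (pos p σ) y n := by
  induction n with
  | zero => simp [visCount]
  | succ n ih =>
    rw [visCount, Nat.count_succ, ← visCount, ← ih]
    split_ifs with h
    · rw [← h, vis_succ_self]
    · rw [vis_succ_of_ne (Ne.symm h), add_zero]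

theorem leftJumps_eq_leftCount (p : ℝ) (σ : ℤ → ℕ → ℝ) (n : ℕ) (y : ℤ) :
    leftJumps p σ n y = leftCount (pos p σ) y n := by
  induction n with
  | zero => simp [leftCount]
  | succ n ih =>
    rw [leftCount, Nat.count_succ, ← leftCount, ← ih]
    by_cases h : pos p σ n = y
    · subst h
      rcases step_cases p σ n with h | h
      · rw [if_neg (by omega), h.2.1, add_zero]
      · rw [if_pos ⟨rfl, h.1⟩, h.2.1]
    · rw [if_neg (by tauto), (jumps_succ_of_ne (Ne.symm h)).1, add_zero]

theorem pos_congr {p : ℝ} {σ τ : ℤ → ℕ → ℝ} {n : ℕ}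
    (h : ∀ y i, i < vis p σ n y → σ y i = τ y i) {i : ℕ} (hi : i ≤ n) :
    pos p τ i = pos p σ i := by
  induction i using Nat.strong_induction_on with
  | _ i ih =>
    rcases i with _ | i
    · rfl
    · have hpre : ∀ j ≤ i, pos p τ j = pos p σ j := fun j hj => ih j (by omega) (by omega)
      have hl := leftCount_congr hpre (pos p σ i)
      have hv := visCount_congr (fun j hj => hpre j (le_of_lt hj)) (pos p σ i)
      rw [pos_succ, pos_succ, hpre i le_rfl, leftJumps_eq_leftCount, leftJumps_eq_leftCount,
        vis_eq_visCount, vis_eq_visCount, hl, hv, h]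
      rw [vis_eq_visCount]
      exact visCount_lt (by omega)

theorem measurable_eval_countable {Ω ι A : Type*} [MeasurableSpace Ω] [MeasurableSpace ι]
    [MeasurableSpace A] [Countable ι] [MeasurableSingletonClass ι] {g : ι → Ω → A} {f : Ω → ι}
    (hg : ∀ i, Measurable (g i)) (hf : Measurable f) : Measurable fun ω => g (f ω) ω :=
  (measurable_from_prod_countable_right (f := fun z : ι × Ω => g z.1 z.2) hg).comp
    (hf.prodMk measurable_id)

theorem measurable_pos_vis (p : ℝ) (n : ℕ) :
    (Measurable fun σ => pos p σ n) ∧ ∀ y, Measurable fun σ => vis p σ n y := by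
  induction n with
  | zero => simp [measurable_const]
  | succ n ih =>
    have hx : ∀ y, Measurable fun σ : ℤ → ℕ → ℝ => σ y (vis p σ n y) := fun y =>
      measurable_eval_countable (g := fun i σ => σ y i)
        (fun i => (measurable_pi_apply i).comp (measurable_pi_apply y)) (ih.2 y)
    have hl : ∀ y, Measurable fun σ : ℤ → ℕ → ℝ => leftJumps p σ n y := fun y =>
      measurable_eval_countable (g := fun i (σ : ℤ → ℕ → ℝ) => lefts p (σ y) i)
        (fun i => (measurable_lefts p i).comp (measurable_pi_apply y)) (ih.2 y)
    constructor
    · simp only [pos_succ]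
      refine Measurable.ite (measurableSet_lt
        (measurable_eval_countable (g := fun y σ => σ y (vis p σ n y)) hx ih.1)
        ((measurable_from_top (f := thr p)).comp
          (measurable_eval_countable (g := fun y σ => leftJumps p σ n y) hl ih.1)))
        (ih.1.add_const 1) (ih.1.sub_const 1)
    · intro y
      have : (fun σ => vis p σ (n + 1) y) =
          fun σ => if pos p σ n = y then vis p σ n y + 1 else vis p σ n y := by
        ext σ
        split_ifs with h
        · rw [← h, vis_succ_self]
        · rw [vis_succ_of_ne (Ne.symm h)]
      rw [this]
      exact Measurable.ite (ih.1 (measurableSet_singleton y)) ((ih.2 y).add_const 1) (ih.2 y)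

theorem lintegral_stacksLaw_resample (x : ℤ) (k : ℕ) {f : (ℤ → ℕ → ℝ) → ENNReal}
    (hf : Measurable f) : ∫⁻ σ, f σ ∂stacksLaw =
      ∫⁻ σ, ∫⁻ t, ∫⁻ a, f (Function.update σ x (Function.update t k a)) ∂unif ∂stackLaw
        ∂stacksLaw := by
  rw [stacksLaw, lintegral_resample stackLaw x hf]
  refine lintegral_congr fun σ => ?_
  exact lintegral_resample unif k (hf.comp (measurable_update σ))

theorem isCookieLaw_pos {p : ℝ} (hp : p ≤ 1) : IsCookieLaw p stacksLaw fun n σ => pos p σ n := by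
  refine ⟨fun n => (measurable_pos_vis p n).1, ae_of_all _ fun _ => rfl, fun n => ae_of_all _
    fun σ => ?_, fun γ n => ?_⟩
  · rcases step_cases p σ n with h | h <;> simp [h.1]
  have hE := measurableSet_pathEvent (fun n => (measurable_pos_vis p n).1) γ n
  set E := pathEvent (fun n σ => pos p σ n) γ n with hE'
  set x := γ n
  set k := visCount γ x n
  set l := leftCount γ x n
  have hmem : ∀ σ τ : ℤ → ℕ → ℝ, (∀ y i, (y, i) ≠ (x, k) → σ y i = τ y i) → σ ∈ E → τ ∈ E := by
    intro σ τ h hσ i hi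
    refine (pos_congr (fun y j hj => h y j ?_) hi).trans (hσ i hi)
    rintro ⟨⟩
    rw [vis_eq_visCount, visCount_congr (fun i hi => hσ i hi.le)] at hj
    exact hj.ne rfl
  have hset : E ∩ {σ | pos p σ (n + 1) = x + 1} = E ∩ {σ | σ x k < thr p l} := by
    ext σ
    refine and_congr_right fun hσ => ?_
    have h0 : pos p σ n = x := hσ n le_rfl
    have h1 : vis p σ n x = k := by
      rw [vis_eq_visCount, visCount_congr (fun i hi => hσ i hi.le)]
    have h2 : leftJumps p σ n x = l := by
      rw [leftJumps_eq_leftCount, leftCount_congr hσ]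
    simp only [Set.mem_ofPred_eq, pos_succ, h0, h1, h2]
    split_ifs with h <;> simp [h]; omega
  have hT : MeasurableSet {σ : ℤ → ℕ → ℝ | σ x k < thr p l} :=
    measurableSet_lt ((measurable_pi_apply k).comp (measurable_pi_apply x)) measurable_const
  have ht : thr p l ≤ 1 := by unfold thr; split_ifs <;> linarith
  have hupd : ∀ σ t a, Function.update σ x (Function.update t k a) ∈ E ↔
      Function.update σ x t ∈ E := fun σ t a => by
    refine ⟨hmem _ _ ?_, hmem _ _ ?_⟩ <;>
    · intro y i hyi
      by_cases hy : y = x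
      · subst hy
        have : i ≠ k := fun h => hyi (by rw [h])
        simp [this]
      · simp [hy]
  rw [hset, ← lintegral_indicator_one (hE.inter hT), ← lintegral_indicator_one hE,
    lintegral_stacksLaw_resample x k (measurable_one.indicator (hE.inter hT)),
    lintegral_stacksLaw_resample x k (measurable_one.indicator hE), ← unif_Iio ht,
    ← lintegral_const_mul' _ _ (measure_ne_top _ _)]
  refine lintegral_congr fun σ => ?_
  rw [← lintegral_const_mul' _ _ (measure_ne_top _ _)]
  refine lintegral_congr fun t => ?_
  classical
  simp only [Set.indicator_apply, Set.mem_inter_iff, hupd, Set.mem_ofPred_eq,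
    Function.update_self, Pi.one_apply]
  by_cases h : Function.update σ x t ∈ E
  · simp only [h, true_and, if_true, lintegral_one, measure_univ, mul_one]
    rw [← lintegral_indicator_one measurableSet_Iio]
    rfl
  · simp [h]

end CookieRW

/-- For `p ∈ (3/4, 1)` the homogeneous walk started at `0` is ballistic, with speed
`v ≥ 4p - 3 > 0`. -/
theorem stmt10 (p : ℝ) (hp : p ∈ Set.Ioo (3 / 4 : ℝ) 1)
    {Ω : Type*} [MeasurableSpace Ω] (P : Measure Ω) [IsProbabilityMeasure P]
    (X : ℕ → Ω → ℤ) (hX : IsCookieRW P (fun _ => p) X) (hX0 : ∀ᵐ ω ∂P, X 0 ω = 0) :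
    ∃ v : ℝ, 4 * p - 3 ≤ v ∧ 0 < 4 * p - 3 ∧
      ∀ᵐ ω ∂P, Tendsto (fun n : ℕ => (X n ω : ℝ) / n) atTop (nhds v) := by
  exact ⟨_, CookieRW.le_speed hp, by linarith [hp.1],
    (CookieRW.isCookieLaw_pos hp.2.le).ae_tendsto (hX.isCookieLaw hX0)
      (CookieRW.ae_tendsto_pos_div hp)⟩
end
end
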